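/- Let 3 ≤ m_1 ≤ m_2 and b ≥ 1 be integers. Then OP*(m_1, m_2, 2^⟨b⟩) has a solution in each of the following cases: (i) OP*(m_1, m_2) has a solution and either 2b ≥ m_1 + m_2 + δ(m_1) + δ(m_2) or 2b ≤ m_2 − m_1 − δ(m_1); (ii) (m_1, m_2) = (3, 3); (iii) m_1 ∈ {4, 6}, m_2 is even, m_1 + m_2 ≥ 14, and either 2b ≥ m_1 + m_2 + 4 or 2b ≤ m_2 − m_1. -/

import Mathlib

/-- A solution to the directed Oberwolfach problem OP*(m₁, …, m_k). -/
def HasOPSolution (m : List ℕ) : Prop :=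
  ∃ σ : Fin (m.sum - 1) → Equiv.Perm (Fin m.sum),
    (∀ i, (σ i).cycleType = (m : Multiset ℕ)) ∧
    ∀ x y : Fin m.sum, x ≠ y → ∃! i, σ i x = y

/-- δ(m) = 0 if m is even, 1 if m is odd. -/
def deltaOdd (m : ℕ) : ℕ := m % 2

open Equiv

theorem HasOPSolution.of_cover {V I : Type*} [Fintype V] [DecidableEq V] [Fintype I]
    (m : List ℕ) (hV : Fintype.card V = m.sum) (hI : Fintype.card I = m.sum - 1)
    (σ : I → Perm V) (hc : ∀ i, (σ i).cycleType = (m : Multiset ℕ))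
    (hcov : ∀ x y : V, x ≠ y → ∃ i, σ i x = y) : HasOPSolution m := by
  classical
  have hfix : ∀ i x, σ i x ≠ x := by
    intro i x
    have h1 : (σ i).support.card = Fintype.card V := by
      rw [← Perm.sum_cycleType, hc, hV]; simp
    have h2 : (σ i).support = Finset.univ := Finset.card_eq_iff_eq_univ _ |>.1 h1
    have := Finset.mem_univ x
    rw [← h2, Perm.mem_support] at this
    exact this
  have hinj : ∀ x, Function.Injective (fun i => σ i x) := by
    intro x
    let f : I → {y : V // x ≠ y} := fun i => ⟨σ i x, (hfix i x).symm⟩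
    have hs : Function.Surjective f := by
      rintro ⟨y, hy⟩
      obtain ⟨i, hi⟩ := hcov x y hy
      exact ⟨i, Subtype.ext hi⟩
    have hcard : Fintype.card I = Fintype.card {y : V // x ≠ y} := by
      rw [hI, ← hV]
      rw [Fintype.card_subtype_compl, Fintype.card_subtype_eq']
    have hb := (Fintype.bijective_iff_surjective_and_card f).2 ⟨hs, hcard⟩
    intro i j hij
    exact hb.1 (Subtype.ext hij)
  let eV : V ≃ Fin m.sum := Fintype.equivFinOfCardEq hV
  let eI : I ≃ Fin (m.sum - 1) := Fintype.equivFinOfCardEq hI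
  refine ⟨fun i => eV.permCongr (σ (eI.symm i)), fun i => ?_, fun x y hxy => ?_⟩
  · rw [← hc (eI.symm i)]
    change (eV.permCongr (σ (eI.symm i))).cycleType = _
    convert Perm.cycleType_extendDomain (p := fun _ : Fin m.sum => True)
      (eV.trans (Equiv.subtypeUnivEquiv (fun _ => trivial)).symm) using 2
    ext x
    simp [Perm.extendDomain, Perm.subtypeCongr]
  · obtain ⟨i, hi⟩ := hcov (eV.symm x) (eV.symm y) (by simpa using hxy)
    refine ⟨eI i, by simp [hi], fun j hj => ?_⟩
    have : σ (eI.symm j) (eV.symm x) = eV.symm y := by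
      rw [← hj]; simp
    have := hinj _ (this.trans hi.symm)
    simp [← this]

/-- `a` is followed by `b` in the cyclic list `l`. -/
def CycNext {α : Type*} (l : List α) (a b : α) : Prop := ∃ t, l ~r (a :: b :: t)

theorem CycNext.formPerm {α : Type*} [DecidableEq α] {l : List α} {a b : α}
    (h : CycNext l a b) (hl : l.Nodup) : l.formPerm a = b := by
  obtain ⟨t, ht⟩ := h
  rw [List.formPerm_eq_of_isRotated hl ht]
  exact List.formPerm_apply_head _ _ _ (ht.nodup_iff.1 hl)

theorem CycNext.of_isRotated {α : Type*} {l l' : List α} {a b : α}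
    (h : CycNext l a b) (hl : l' ~r l) : CycNext l' a b := by
  obtain ⟨t, ht⟩ := h
  exact ⟨t, hl.trans ht⟩

theorem CycNext.of_append {α : Type*} (p q : List α) (a b : α) :
    CycNext (p ++ a :: b :: q) a b :=
  ⟨q ++ p, by simpa using List.isRotated_append (l := p) (l' := a :: b :: q)⟩

theorem CycNext.map {α β : Type*} (f : α → β) {l : List α} {a b : α}
    (h : CycNext l a b) : CycNext (l.map f) (f a) (f b) := by
  obtain ⟨t, ht⟩ := h
  exact ⟨t.map f, by simpa using ht.map f⟩

theorem CycNext.mem_left {α : Type*} {l : List α} {a b : α} (h : CycNext l a b) : a ∈ l := by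
  obtain ⟨t, ht⟩ := h
  exact ht.mem_iff.2 (by simp)

/-- The permutation whose cycles are the lists in `LL`. -/
theorem exists_perm_of_cycles {V : Type*} [Fintype V] [DecidableEq V] (LL : List (List V))
    (hn : LL.flatten.Nodup) (h2 : ∀ l ∈ LL, 2 ≤ l.length) :
    ∃ π : Perm V, π.cycleType = (LL.map List.length : Multiset ℕ) ∧
      ∀ l ∈ LL, ∀ a b, CycNext l a b → π a = b := by
  suffices ∃ π : Perm V, π.cycleType = (LL.map List.length : Multiset ℕ) ∧
      (∀ l ∈ LL, ∀ a b, CycNext l a b → π a = b) ∧ ∀ a, a ∉ LL.flatten → π a = a by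
    obtain ⟨π, h, h', -⟩ := this
    exact ⟨π, h, h'⟩
  induction LL with
  | nil => exact ⟨1, by simp, by simp, by simp⟩
  | cons l LL ih =>
    rw [List.flatten_cons, List.nodup_append] at hn
    obtain ⟨hl, hLL, hd⟩ := hn
    obtain ⟨π, h1, h3, h4⟩ := ih hLL (fun l' h' => h2 l' (by simp [h']))
    have hll := h2 l (by simp)
    have hdis : Perm.Disjoint l.formPerm π := by
      intro x
      by_cases hx : x ∈ l
      · right; exact h4 x (fun h => hd x hx x h rfl)
      · left; exact List.formPerm_apply_of_notMem hx
    refine ⟨l.formPerm * π, ?_, ?_, ?_⟩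
    · rw [hdis.cycleType_mul, h1, (List.isCycle_formPerm hl hll).cycleType,
        List.support_formPerm_of_nodup _ hl (by rintro x rfl; simp at hll),
        List.toFinset_card_of_nodup hl]
      rfl
    · intro l' hl' a b hab
      rcases List.mem_cons.1 hl' with rfl | hl'
      · have : π a = a := h4 a (fun h => hd a hab.mem_left a h rfl)
        rw [Perm.mul_apply, this, hab.formPerm hl]
      · rw [hdis.commute.eq, Perm.mul_apply, List.formPerm_apply_of_notMem, h3 l' hl' a b hab]
        intro h
        exact hd a h a (List.mem_flatten.2 ⟨l', hl', hab.mem_left⟩) rfl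
    · intro a ha
      simp only [List.flatten_cons, List.mem_append, not_or] at ha
      rw [Perm.mul_apply, h4 a ha.2, List.formPerm_apply_of_notMem ha.1]

theorem cycleType_sumCongr {α β : Type*} [Fintype α] [DecidableEq α] [Fintype β] [DecidableEq β]
    (σ : Perm α) (τ : Perm β) :
    Perm.cycleType (sumCongr σ τ : Perm (α ⊕ β)) = σ.cycleType + τ.cycleType := by
  have e : (sumCongr σ τ : Perm (α ⊕ β)) = Perm.sumCongr σ 1 * Perm.sumCongr 1 τ := by
    ext x; cases x <;> simp
  have hd : Perm.Disjoint (Perm.sumCongr σ (1 : Perm β)) (Perm.sumCongr (1 : Perm α) τ) := by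
    rintro (x | x) <;> simp
  rw [e, hd.cycleType_mul]
  congr 1
  · convert Perm.cycleType_extendDomain (g := σ) (p := fun x : α ⊕ β => x ∈ Set.range Sum.inl)
      (Equiv.ofInjective (Sum.inl : α → α ⊕ β) Sum.inl_injective) using 2
    ext x
    rcases x with x | x
    · have := Perm.extendDomain_apply_image σ
        (p := fun x : α ⊕ β => x ∈ Set.range Sum.inl)
        (Equiv.ofInjective (Sum.inl : α → α ⊕ β) Sum.inl_injective) x
      simpa using this.symm
    · rw [Perm.extendDomain_apply_not_subtype]
      · simp
      · simp
  · convert Perm.cycleType_extendDomain (g := τ) (p := fun x : α ⊕ β => x ∈ Set.range Sum.inr)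
      (Equiv.ofInjective (Sum.inr : β → α ⊕ β) Sum.inr_injective) using 2
    ext x
    rcases x with x | x
    · rw [Perm.extendDomain_apply_not_subtype]
      · simp
      · simp
    · have := Perm.extendDomain_apply_image τ
        (p := fun x : α ⊕ β => x ∈ Set.range Sum.inr)
        (Equiv.ofInjective (Sum.inr : β → α ⊕ β) Sum.inr_injective) x
      simpa using this.symm

theorem cycleType_involution {α : Type*} [Fintype α] [DecidableEq α] (f : α → α)
    (hf : Function.Involutive f) (hne : ∀ x, f x ≠ x) (c : ℕ) (hc : Fintype.card α = 2 * c) :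
    (hf.toPerm f).cycleType = Multiset.replicate c 2 := by
  have h2 : ∀ n ∈ (hf.toPerm f).cycleType, n = 2 := by
    intro n hn
    have h := Perm.two_le_of_mem_cycleType hn
    have h' := Perm.dvd_of_mem_cycleType hn
    have : orderOf (hf.toPerm f) ∣ 2 := by
      apply orderOf_dvd_of_pow_eq_one
      ext x; simp [pow_two, hf x]
    have := Nat.le_of_dvd (by norm_num) (h'.trans this)
    omega
  rw [Multiset.eq_replicate]
  refine ⟨?_, h2⟩
  have hs : (hf.toPerm f).support = Finset.univ := by
    ext x; simp [hne x]
  have h3 := Perm.sum_cycleType (hf.toPerm f)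
  rw [hs, Finset.card_univ, hc] at h3
  rw [Multiset.eq_replicate.2 ⟨rfl, h2⟩] at h3
  simp at h3
  omega

/-- Extension of a solution on `L.sum` points by `2c` points arranged cyclically. -/
theorem HasOPSolution.extend_of_starter {L : List ℕ} {c : ℕ} [NeZero (2 * c)]
    (hL : HasOPSolution L) (hs : 1 ≤ L.sum)
    (τ : Fin (L.sum - 1) → ZMod (2 * c) → ZMod (2 * c))
    (hτ : ∀ i, Function.Involutive (τ i)) (hτ' : ∀ i x, τ i x ≠ x)
    (LL : List (List (Fin L.sum ⊕ ZMod (2 * c)))) (hn : LL.flatten.Nodup)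
    (h2 : ∀ l ∈ LL, 2 ≤ l.length)
    (hlen : (LL.map List.length : Multiset ℕ) = (L ++ List.replicate c 2 : List ℕ))
    (hS : ∀ i, (∃ x, ∃ l ∈ LL, CycNext l (Sum.inl i) (Sum.inr x)) ∧
      ∃ x, ∃ l ∈ LL, CycNext l (Sum.inr x) (Sum.inl i))
    (hT : ∀ x y, x ≠ y → (∃ i, τ i x = y) ∨
      ∃ l ∈ LL, ∃ a b, CycNext l (Sum.inr a) (Sum.inr b) ∧ b - a = y - x) :
    HasOPSolution (L ++ List.replicate c 2) := by
  obtain ⟨ρ, hρ, hρ'⟩ := hL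
  obtain ⟨π, hπ, hπ'⟩ := exists_perm_of_cycles LL hn h2
  let tr : ZMod (2 * c) → Perm (Fin L.sum ⊕ ZMod (2 * c)) := fun z =>
    Perm.sumCongr 1 (Equiv.addRight z)
  let σ : Fin (L.sum - 1) ⊕ ZMod (2 * c) → Perm (Fin L.sum ⊕ ZMod (2 * c)) := fun j =>
    match j with
    | Sum.inl i => Perm.sumCongr (ρ i) ((hτ i).toPerm (τ i))
    | Sum.inr z => tr z * π * (tr z)⁻¹
  have hr : ∀ z u v, π u = v → σ (Sum.inr z) (tr z u) = tr z v := by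
    intro z u v h
    simp [σ, h]
  refine HasOPSolution.of_cover _ ?_ ?_ σ ?_ ?_
  · simp [ZMod.card]; ring
  · simp [ZMod.card]; omega
  · rintro (i | z)
    · change Perm.cycleType (sumCongr _ _) = _
      rw [cycleType_sumCongr, hρ, cycleType_involution _ (hτ i) (hτ' i) c (by simp [ZMod.card])]
      rw [← Multiset.coe_replicate, Multiset.coe_add]
    · change Perm.cycleType (tr z * π * (tr z)⁻¹) = _
      rw [Perm.cycleType_conj, hπ, hlen]
  · rintro (x | x) (y | y) hxy
    · obtain ⟨i, hi, -⟩ := hρ' x y (by simpa using hxy)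
      exact ⟨Sum.inl i, by simp [σ, hi]⟩
    · obtain ⟨a, l, hl, h⟩ := (hS x).1
      refine ⟨Sum.inr (y - a), ?_⟩
      simpa [tr] using hr (y - a) _ _ (hπ' l hl _ _ h)
    · obtain ⟨a, l, hl, h⟩ := (hS y).2
      refine ⟨Sum.inr (x - a), ?_⟩
      simpa [tr] using hr (x - a) _ _ (hπ' l hl _ _ h)
    · rcases hT x y (by simpa using hxy) with ⟨i, hi⟩ | ⟨l, hl, a, b, h, hab⟩
      · exact ⟨Sum.inl i, by simp [σ, hi]⟩
      · refine ⟨Sum.inr (x - a), ?_⟩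
        have h1 : b + (x - a) = y := by linear_combination hab
        simpa [tr, h1] using hr (x - a) _ _ (hπ' l hl _ _ h)

/-- The vertex sequence of a list of blocks. -/
def blockSeq {σ τ : Type*} (g : List (σ × List τ)) : List (σ ⊕ τ) :=
  g.flatMap fun b => b.2.map Sum.inr ++ [Sum.inl b.1]

theorem blockSeq_perm {σ τ : Type*} (g : List (σ × List τ)) :
    (blockSeq g).Perm ((g.map Prod.fst).map Sum.inl ++ (g.flatMap Prod.snd).map Sum.inr) := by
  induction g with
  | nil => simp [blockSeq]
  | cons b g ih =>
    simp only [blockSeq, List.flatMap_cons, List.map_cons, List.map_append, List.append_assoc,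
      List.cons_append, List.nil_append] at ih ⊢
    refine List.perm_middle.trans (List.Perm.cons _ ?_)
    refine (List.Perm.append_left _ ih).trans ?_
    rw [← List.append_assoc, ← List.append_assoc]
    exact List.Perm.append_right _ List.perm_append_comm

theorem blockSeq_length {σ τ : Type*} (g : List (σ × List τ)) :
    (blockSeq g).length = ((g.map Prod.snd).map fun l => l.length + 1).sum := by
  simp [blockSeq, List.length_flatMap, Function.comp_def]

theorem exists_label {σ τ : Type*} (HH : List (List τ)) (S : List σ)
    (h : S.length = HH.flatten.length) :
    ∃ GG : List (List (σ × τ)), GG.map (List.map Prod.snd) = HH ∧ GG.flatten.map Prod.fst = S := by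
  induction HH generalizing S with
  | nil => exact ⟨[], by simp, by simpa [eq_comm] using h⟩
  | cons a HH ih =>
    rw [List.flatten_cons, List.length_append] at h
    obtain ⟨GG, h1, h2⟩ := ih (S.drop a.length) (by rw [List.length_drop]; omega)
    refine ⟨(S.take a.length).zip a :: GG, ?_, ?_⟩
    · simp only [List.map_cons, h1, List.cons.injEq, and_true]
      exact List.map_snd_zip (by simp; omega)
    · simp only [List.flatten_cons, List.map_append, h2]
      rw [List.map_fst_zip (by simp), List.take_append_drop]

theorem CycNext.blockSeq_rotate {σ τ : Type*} {p q : List (σ × List τ)} {b : σ × List τ}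
    {u v : σ ⊕ τ} (h : CycNext (blockSeq (b :: (q ++ p))) u v) :
    CycNext (blockSeq (p ++ b :: q)) u v := by
  refine h.of_isRotated ?_
  have h1 : blockSeq (p ++ b :: q) = blockSeq p ++ blockSeq (b :: q) := by simp [blockSeq]
  have h2 : blockSeq (b :: (q ++ p)) = blockSeq (b :: q) ++ blockSeq p := by simp [blockSeq]
  rw [h1, h2]
  exact List.isRotated_append

theorem CycNext.blockSeq_out {σ τ : Type*} {g : List (σ × List τ)} {b : σ × List τ}
    (hb : b ∈ g) (hne : ∀ b ∈ g, b.2 ≠ []) :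
    ∃ x, CycNext (blockSeq g) (Sum.inl b.1) (Sum.inr x) := by
  obtain ⟨p, q, rfl⟩ := List.append_of_mem hb
  obtain ⟨i, l⟩ := b
  rcases hqp : q ++ p with _ | ⟨⟨j, l'⟩, r⟩
  · obtain ⟨x, l, rfl⟩ := List.exists_cons_of_ne_nil (hne _ hb)
    refine ⟨x, CycNext.blockSeq_rotate ?_⟩
    rw [hqp]
    refine ⟨l.map Sum.inr, ?_⟩
    simp only [blockSeq, List.flatMap_cons, List.flatMap_nil, List.append_nil]
    exact (List.isRotated_append (l := _) (l' := [Sum.inl i])).trans (by simp [List.IsRotated.refl])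
  · have hj : (j, l') ∈ p ++ (i, l) :: q := by
      have : (j, l') ∈ q ++ p := by simp [hqp]
      simp only [List.mem_append, List.mem_cons] at this ⊢
      tauto
    obtain ⟨x, l', rfl⟩ := List.exists_cons_of_ne_nil (hne _ hj)
    refine ⟨x, CycNext.blockSeq_rotate ?_⟩
    rw [hqp]
    have : blockSeq ((i, l) :: (j, x :: l') :: r) = l.map Sum.inr ++ Sum.inl i :: Sum.inr x ::
        (l'.map Sum.inr ++ [Sum.inl j] ++ blockSeq r) := by
      simp [blockSeq]
    rw [this]
    exact CycNext.of_append _ _ _ _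

theorem CycNext.blockSeq_in {σ τ : Type*} {g : List (σ × List τ)} {b : σ × List τ}
    (hb : b ∈ g) (hne : b.2 ≠ []) :
    ∃ x, CycNext (blockSeq g) (Sum.inr x) (Sum.inl b.1) := by
  obtain ⟨p, q, rfl⟩ := List.append_of_mem hb
  obtain ⟨i, l⟩ := b
  obtain ⟨l', x, rfl⟩ := List.eq_nil_or_concat l |>.resolve_left hne
  refine ⟨x, ?_⟩
  have : blockSeq (p ++ (i, l'.concat x) :: q) = (blockSeq p ++ l'.map Sum.inr) ++
      Sum.inr x :: Sum.inl i :: blockSeq q := by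
    simp [blockSeq]
  simp only [List.concat_eq_append] at this ⊢
  rw [this]
  exact CycNext.of_append _ _ _ _

theorem CycNext.blockSeq_arc {σ τ : Type*} {g : List (σ × List τ)} {i : σ} {x y : τ}
    (hb : (i, [x, y]) ∈ g) : CycNext (blockSeq g) (Sum.inr x) (Sum.inr y) := by
  obtain ⟨p, q, rfl⟩ := List.append_of_mem hb
  have : blockSeq (p ++ (i, [x, y]) :: q) = blockSeq p ++
      Sum.inr x :: Sum.inr y :: (Sum.inl i :: blockSeq q) := by
    simp [blockSeq]
  rw [this]
  exact CycNext.of_append _ _ _ _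

theorem exists_split {α : Type*} (l : List α) (n₁ n₂ n₃ n₄ n₅ : ℕ)
    (h : l.length = n₁ + n₂ + n₃ + n₄ + n₅) : ∃ a b c d e : List α, l = a ++ b ++ c ++ d ++ e ∧
      a.length = n₁ ∧ b.length = n₂ ∧ c.length = n₃ ∧ d.length = n₄ ∧ e.length = n₅ := by
  refine ⟨l.take n₁, (l.drop n₁).take n₂, (l.drop (n₁ + n₂)).take n₃,
    (l.drop (n₁ + n₂ + n₃)).take n₄, l.drop (n₁ + n₂ + n₃ + n₄), ?_, ?_, ?_, ?_, ?_, ?_⟩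
  · rw [← List.take_add, ← List.take_add, ← List.take_add, List.take_append_drop]
  all_goals simp; omega

theorem flatten_map_singleton {α β : Type*} (f : α → β) (R : List α) :
    (R.map fun x => [f x]).flatten = R.map f := by
  induction R with
  | nil => rfl
  | cons a R ih => rw [List.map_cons, List.flatten_cons, ih]; rfl

theorem flatten_map_blockSeq {σ τ : Type*} (GG : List (List (σ × List τ))) :
    (GG.map blockSeq).flatten = blockSeq GG.flatten := by
  induction GG with
  | nil => rfl
  | cons g GG ih =>
    rw [List.map_cons, List.flatten_cons, ih, List.flatten_cons]
    simp [blockSeq]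

theorem flatten_map_pair {α β : Type*} (f : α → β) (D : List (α × α)) :
    (D.map fun p => [f p.1, f p.2]).flatten = (D.flatMap fun p => [p.1, p.2]).map f := by
  induction D with
  | nil => rfl
  | cons g GG ih => rw [List.map_cons, List.flatten_cons, ih]; simp

/-- Extension of a solution from digons and extra arcs on a cyclic vertex set. -/
theorem HasOPSolution.extend_of_digons {m₁ m₂ r c : ℕ} [NeZero (2 * c)]
    (h₁ : 2 ≤ m₁) (h₂ : 2 ≤ m₂)
    (hL : HasOPSolution ([m₁, m₂] ++ List.replicate r 2))
    (Q₁ Q₂ : List (ZMod (2 * c))) (hQ₁ : Q₁.length = 2 * (m₁ % 2))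
    (hQ₂ : Q₂.length = 2 * (m₂ % 2)) (Dg : List (ZMod (2 * c) × ZMod (2 * c)))
    (hn : (Q₁ ++ Q₂ ++ Dg.flatMap fun p => [p.1, p.2]).Nodup)
    (hcount : 2 * c = m₁ + m₂ + 2 * r + m₁ % 2 + m₂ % 2 + 2 * Dg.length)
    {J : Type*} [Fintype J] (hJ : Fintype.card J ≤ m₁ + m₂ + 2 * r - 1)
    (τ : J → ZMod (2 * c) → ZMod (2 * c))
    (hτ : ∀ i, Function.Involutive (τ i)) (hτ' : ∀ i x, τ i x ≠ x)
    (hT : ∀ x y, x ≠ y → (∃ i, τ i x = y) ∨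
      (∃ p ∈ Dg, p.2 - p.1 = y - x ∨ p.1 - p.2 = y - x) ∨
      ∃ a b, (Q₁ = [a, b] ∨ Q₂ = [a, b]) ∧ b - a = y - x) :
    HasOPSolution ([m₁, m₂] ++ List.replicate (r + c) 2) := by
  classical
  have hsum : ([m₁, m₂] ++ List.replicate r 2).sum = m₁ + m₂ + 2 * r := by
    simp; ring
  rw [← List.replicate_append_replicate, ← List.append_assoc]
  have hc : 0 < 2 * c := Nat.pos_of_ne_zero (NeZero.ne _)
  -- the free cells
  set Dl := Dg.flatMap fun p => [p.1, p.2] with hDl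
  have hDlen : Dl.length = 2 * Dg.length := by
    simp [hDl, List.length_flatMap, mul_comm]
  set U := Q₁ ++ Q₂ ++ Dl with hU
  let C : List (ZMod (2 * c)) := (Finset.univ \ U.toFinset).toList
  have hClen : C.length = 2 * c - U.length := by
    simp only [C, Finset.length_toList]
    rw [Finset.card_sdiff_of_subset (Finset.subset_univ _), Finset.card_univ, ZMod.card,
      List.toFinset_card_of_nodup hn]
  have hUC : (U ++ C).Nodup := by
    rw [List.nodup_append]
    refine ⟨hn, Finset.nodup_toList _, fun a ha b hb => ?_⟩
    simp only [C, Finset.mem_toList, Finset.mem_sdiff, List.mem_toFinset] at hb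
    rintro rfl
    exact hb.2 ha
  have hUlen : U.length = 2 * (m₁ % 2) + 2 * (m₂ % 2) + 2 * Dg.length := by
    simp only [hU, List.length_append, hQ₁, hQ₂, hDlen]
  obtain ⟨C₁, C₂, R₁, R₂, R₃, hC, l1, l2, l3, l4, l5⟩ := exists_split C (1 - m₁ % 2)
    (1 - m₂ % 2) (m₁ / 2 - 1) (m₂ / 2 - 1) (m₁ + m₂ + 2 * r - m₁ / 2 - m₂ / 2) (by omega)
  let HH : List (List (List (ZMod (2 * c)))) :=
    ((Q₁ ++ C₁) :: R₁.map fun x => [x]) :: ((Q₂ ++ C₂) :: R₂.map fun x => [x]) ::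
      R₃.map fun x => [[x]]
  have hfl : ∀ R : List (ZMod (2 * c)), (R.map fun x => [x]).flatten = R := fun R => by
    simpa using flatten_map_singleton id R
  have hfl2 : ∀ R : List (ZMod (2 * c)), (R.map fun x => [[x]]).flatten = R.map fun x => [x] :=
    fun R => flatten_map_singleton (fun x => [x]) R
  have hHH : HH.flatten.flatten = (Q₁ ++ C₁) ++ R₁ ++ ((Q₂ ++ C₂) ++ R₂) ++ R₃ := by
    simp only [HH, List.flatten_cons, List.flatten_append, hfl, hfl2, List.append_assoc]
  have hHne : ∀ h ∈ HH, ∀ b ∈ h, b ≠ [] := by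
    have e1 : Q₁ ++ C₁ ≠ [] := by
      intro h; have := congrArg List.length h; simp at this; simp [this.1] at hQ₁
      simp [this.2] at l1; omega
    have e2 : Q₂ ++ C₂ ≠ [] := by
      intro h; have := congrArg List.length h; simp at this; simp [this.1] at hQ₂
      simp [this.2] at l2; omega
    intro h hh b hb
    simp only [HH, List.mem_cons, List.mem_map] at hh
    rcases hh with rfl | rfl | ⟨x, -, rfl⟩
    · simp only [List.mem_cons, List.mem_map] at hb
      rcases hb with rfl | ⟨x, -, rfl⟩
      · exact e1
      · simp
    · simp only [List.mem_cons, List.mem_map] at hb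
      rcases hb with rfl | ⟨x, -, rfl⟩
      · exact e2
      · simp
    · simp only [List.mem_singleton] at hb
      simp [hb]
  obtain ⟨GG, hG1, hG2⟩ := exists_label HH (List.finRange ([m₁, m₂] ++ List.replicate r 2).sum)
    (by
      rw [List.length_finRange, hsum]
      simp only [HH, List.flatten_cons, List.length_append, hfl2, List.length_cons,
        List.length_map]
      omega)
  have hGne : ∀ g ∈ GG, ∀ b ∈ g, b.2 ≠ [] := by
    intro g hg b hb
    refine hHne (g.map Prod.snd) ?_ b.2 (List.mem_map_of_mem hb)
    rw [← hG1]
    exact List.mem_map_of_mem hg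
  let LL : List (List (Fin ([m₁, m₂] ++ List.replicate r 2).sum ⊕ ZMod (2 * c))) :=
    GG.map blockSeq ++ Dg.map fun p => [Sum.inr p.1, Sum.inr p.2]
  have hGG2 : GG.flatten.flatMap Prod.snd = HH.flatten.flatten := by
    rw [← hG1, List.flatMap_def, List.map_flatten]
  have hflat : LL.flatten = blockSeq GG.flatten ++ Dl.map Sum.inr := by
    rw [List.flatten_append, flatten_map_blockSeq, flatten_map_pair]
  have hlens : LL.map List.length = m₁ :: m₂ :: List.replicate (r + c) 2 := by
    have h1 : (GG.map blockSeq).map List.length =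
        (GG.map (List.map Prod.snd)).map fun h => (h.map fun l => l.length + 1).sum := by
      rw [List.map_map, List.map_map]
      exact List.map_congr_left fun g _ => blockSeq_length g
    simp only [LL, List.map_append, h1, hG1, HH, List.map_cons, List.map_map, List.sum_cons,
      List.length_append, Function.comp_def, List.length_cons, List.length_nil]
    simp only [List.map_const', List.sum_replicate, l1, l2, l3, l4, l5,
      hQ₁, hQ₂, smul_eq_mul, List.cons_append, zero_add]
    congr 1
    · omega
    · congr 1
      · omega
      · simp [List.replicate_append_replicate]; omega
  have hLLn : LL.flatten.Nodup := by
    rw [hflat, ((blockSeq_perm GG.flatten).append_right _).nodup_iff, hG2, hGG2, List.append_assoc,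
      ← List.map_append, List.nodup_append]
    refine ⟨(List.nodup_finRange _).map Sum.inl_injective, ?_, ?_⟩
    · refine List.Nodup.map Sum.inr_injective ?_
      refine (List.Perm.nodup_iff ?_).1 hUC
      rw [hHH, hC, hU]
      refine List.perm_iff_count.2 fun a => ?_
      simp only [List.count_append]
      omega
    · intro a ha b hb
      obtain ⟨i, -, rfl⟩ := List.mem_map.1 ha
      obtain ⟨j, -, rfl⟩ := List.mem_map.1 hb
      simp
  have hLL2 : ∀ l ∈ LL, 2 ≤ l.length := by
    intro l hl
    have : l.length ∈ LL.map List.length := List.mem_map_of_mem hl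
    rw [hlens] at this
    simp only [List.mem_cons, List.mem_replicate] at this
    omega
  have hcc : ((c : ℕ) : ZMod (2 * c)) + c = 0 := by
    have := ZMod.natCast_self (2 * c)
    push_cast at this
    linear_combination this
  have hc0 : ((c : ℕ) : ZMod (2 * c)) ≠ 0 := by
    rw [Ne, ZMod.natCast_eq_zero_iff]
    intro h
    have := Nat.le_of_dvd (by omega) h
    omega
  obtain ⟨emb⟩ : Nonempty (J ↪ Fin (([m₁, m₂] ++ List.replicate r 2).sum - 1)) :=
    Function.Embedding.nonempty_of_card_le (by rw [Fintype.card_fin, hsum]; exact hJ)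
  have hmem : ∀ b ∈ GG.flatten, ∃ g ∈ GG, b ∈ g := fun b hb =>
    List.mem_flatten.1 hb
  refine HasOPSolution.extend_of_starter hL (by rw [hsum]; omega)
    (Function.extend emb τ fun _ x => x + c) ?_ ?_ LL hLLn hLL2 (by rw [hlens]; simp) ?_ ?_
  · intro i
    by_cases h : ∃ j, emb j = i
    · obtain ⟨j, rfl⟩ := h
      rw [emb.injective.extend_apply]; exact hτ j
    · rw [Function.extend_apply' _ _ _ h]
      intro x
      linear_combination hcc
  · intro i x
    by_cases h : ∃ j, emb j = i
    · obtain ⟨j, rfl⟩ := h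
      rw [emb.injective.extend_apply]; exact hτ' j x
    · rw [Function.extend_apply' _ _ _ h]
      simpa using hc0
  · intro i
    have : i ∈ GG.flatten.map Prod.fst := by rw [hG2]; exact List.mem_finRange i
    obtain ⟨b, hb, rfl⟩ := List.mem_map.1 this
    obtain ⟨g, hg, hbg⟩ := hmem b hb
    have hLg : blockSeq g ∈ LL := List.mem_append_left _ (List.mem_map_of_mem hg)
    obtain ⟨x, hx⟩ := CycNext.blockSeq_out hbg (hGne g hg)
    obtain ⟨y, hy⟩ := CycNext.blockSeq_in hbg (hGne g hg b hbg)
    exact ⟨⟨x, _, hLg, hx⟩, y, _, hLg, hy⟩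
  · intro x y hxy
    rcases hT x y hxy with ⟨j, hj⟩ | ⟨p, hp, h⟩ | ⟨a, b, hQ, hab⟩
    · exact Or.inl ⟨emb j, by rw [emb.injective.extend_apply]; exact hj⟩
    · right
      have hpL : ([Sum.inr p.1, Sum.inr p.2] :
          List (Fin ([m₁, m₂] ++ List.replicate r 2).sum ⊕ ZMod (2 * c))) ∈ LL :=
        List.mem_append_right _ (List.mem_map.2 ⟨p, hp, rfl⟩)
      rcases h with h | h
      · exact ⟨_, hpL, p.1, p.2, ⟨[], List.IsRotated.refl _⟩, h⟩
      · exact ⟨_, hpL, p.2, p.1, ⟨[], ⟨1, by simp⟩⟩, h⟩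
    · right
      have hh : ∃ h ∈ HH, [a, b] ∈ h := by
        rcases hQ with hQ | hQ
        · refine ⟨_, List.mem_cons_self, ?_⟩
          rw [hQ] at hQ₁ ⊢
          simp only [List.length_cons, List.length_nil] at hQ₁
          have : C₁ = [] := List.length_eq_zero_iff.1 (by omega)
          simp [this]
        · refine ⟨_, List.mem_cons_of_mem _ List.mem_cons_self, ?_⟩
          rw [hQ] at hQ₂ ⊢
          simp only [List.length_cons, List.length_nil] at hQ₂
          have : C₂ = [] := List.length_eq_zero_iff.1 (by omega)
          simp [this]
      obtain ⟨h, hh, hab'⟩ := hh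
      rw [← hG1] at hh
      obtain ⟨g, hg, rfl⟩ := List.mem_map.1 hh
      obtain ⟨⟨i, l⟩, hb, rfl⟩ := List.mem_map.1 hab'
      exact ⟨_, List.mem_append_left _ (List.mem_map_of_mem hg), a, b,
        CycNext.blockSeq_arc hb, hab⟩

/-- Nested pairs around the gap from `a` to `b`. -/
def nest (a b n : ℕ) : List (ℕ × ℕ) := (List.range n).map fun j => (a - 1 - j, b + 1 + j)

/-- The entries of a list of pairs. -/
def entries {α : Type*} (D : List (α × α)) : List α := D.flatMap fun p => [p.1, p.2]

theorem mem_entries_nest {a b n x : ℕ} (hx : x ∈ entries (nest a b n)) :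
    ∃ j < n, x = a - 1 - j ∨ x = b + 1 + j := by
  simp only [entries, nest, List.mem_flatMap, List.mem_map, List.mem_range] at hx
  obtain ⟨p, ⟨j, hj, rfl⟩, hx⟩ := hx
  exact ⟨j, hj, by simpa using hx⟩

theorem nodup_entries_nest {a b n : ℕ} (h : n ≤ a) (h' : a ≤ b) :
    (entries (nest a b n)).Nodup := by
  rw [entries, nest, List.flatMap_def, List.map_map, ← List.flatMap_def, List.nodup_flatMap]
  refine ⟨fun j hj => ?_, ?_⟩
  · simp only [List.mem_range] at hj
    simp; omega
  · refine List.pairwise_lt_range.imp_of_mem ?_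
    intro i j hi hj hij
    simp only [List.mem_range] at hi hj
    simp only [Function.onFun, List.Disjoint, Function.comp_apply, List.mem_cons, List.not_mem_nil,
      or_false]
    rintro x (rfl | rfl) h <;> omega

theorem HasOPSolution.extend_of_nests {m₁ m₂ r c : ℕ} [NeZero (2 * c)]
    (h₁ : 2 ≤ m₁) (h₂ : 2 ≤ m₂)
    (hL : HasOPSolution ([m₁, m₂] ++ List.replicate r 2)) (h k f : ℕ)
    (hf : 2 * h + k < f) (hfc : f + 1 + k < 2 * c)
    (Q₁ Q₂ : List ℕ) (hQ₁ : Q₁.length = 2 * (m₁ % 2))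
    (hQ₂ : Q₂.length = 2 * (m₂ % 2)) (hQ : (Q₁ ++ Q₂).Nodup)
    (hQf : ∀ q ∈ Q₁ ++ Q₂, q < 2 * c ∧ (q = h ∨ q = f ∨ q = f + 1 ∨ f + 1 + k < q))
    (hcount : 2 * c = m₁ + m₂ + 2 * r + m₁ % 2 + m₂ % 2 + 2 * (h + k))
    {J : Type*} [Fintype J] (hJ : Fintype.card J ≤ m₁ + m₂ + 2 * r - 1)
    (τ : J → ZMod (2 * c) → ZMod (2 * c))
    (hτ : ∀ i, Function.Involutive (τ i)) (hτ' : ∀ i x, τ i x ≠ x)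
    (hT : ∀ (v : ℕ) (x : ZMod (2 * c)), 0 < v → v < 2 * c → (∃ i, τ i x = x + v) ∨
      (v % 2 = 0 ∧ (v ≤ 2 * h ∨ 2 * c ≤ v + 2 * h)) ∨
      (v % 2 = 1 ∧ (3 ≤ v ∧ v ≤ 2 * k + 1 ∨ 3 + v ≤ 2 * c ∧ 2 * c ≤ 2 * k + 1 + v)) ∨
      ∃ a b, (Q₁ = [a, b] ∨ Q₂ = [a, b]) ∧ ((b : ZMod (2 * c)) - a = v)) :
    HasOPSolution ([m₁, m₂] ++ List.replicate (r + c) 2) := by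
  have key : (Q₁ ++ Q₂ ++ entries (nest h h h ++ nest f (f + 1) k)).Nodup ∧
      ∀ x ∈ Q₁ ++ Q₂ ++ entries (nest h h h ++ nest f (f + 1) k), x < 2 * c := by
    have e : entries (nest h h h ++ nest f (f + 1) k) =
        entries (nest h h h) ++ entries (nest f (f + 1) k) := by simp [entries]
    rw [e]
    constructor
    · refine List.nodup_append.2 ⟨hQ, List.nodup_append.2 ⟨nodup_entries_nest le_rfl le_rfl,
        nodup_entries_nest (by omega) (by omega), ?_⟩, ?_⟩
      · intro x hx y hy
        obtain ⟨i, hi, hx⟩ := mem_entries_nest hx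
        obtain ⟨j, hj, hy⟩ := mem_entries_nest hy
        omega
      · intro x hx y hy
        have := hQf x hx
        rcases List.mem_append.1 hy with hy | hy <;> obtain ⟨j, hj, hy⟩ := mem_entries_nest hy <;>
          omega
    · intro x hx
      simp only [List.mem_append] at hx
      rcases hx with hx | hx | hx
      · exact (hQf x (by simpa using hx)).1
      · obtain ⟨j, hj, hx⟩ := mem_entries_nest hx
        omega
      · obtain ⟨j, hj, hx⟩ := mem_entries_nest hx
        omega
  let C : ℕ → ZMod (2 * c) := Nat.cast
  refine HasOPSolution.extend_of_digons h₁ h₂ hL (Q₁.map C) (Q₂.map C) (by simpa using hQ₁)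
    (by simpa using hQ₂) ((nest h h h ++ nest f (f + 1) k).map (Prod.map C C)) ?_ ?_ hJ τ hτ hτ' ?_
  · have : (Q₁.map C ++ Q₂.map C ++ ((nest h h h ++ nest f (f + 1) k).map (Prod.map C C)).flatMap
        fun p => [p.1, p.2]) = (Q₁ ++ Q₂ ++ entries (nest h h h ++ nest f (f + 1) k)).map C := by
      simp [entries, List.map_flatMap, List.flatMap_map, Prod.map]
    rw [this]
    refine List.Nodup.map_on ?_ key.1
    intro x hx y hy hxy
    have := (ZMod.natCast_eq_natCast_iff' x y (2 * c)).1 hxy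
    rwa [Nat.mod_eq_of_lt (key.2 x hx), Nat.mod_eq_of_lt (key.2 y hy)] at this
  · simp [nest]; omega
  · intro x y hxy
    have hd : ((y - x).val : ZMod (2 * c)) = y - x := ZMod.natCast_zmod_val _
    have hv0 : 0 < (y - x).val := by
      rw [Nat.pos_iff_ne_zero, Ne, ZMod.val_eq_zero, sub_eq_zero]; exact hxy.symm
    have hv1 : (y - x).val < 2 * c := ZMod.val_lt _
    generalize (y - x).val = v at hd hv0 hv1
    have hcz : (2 * c : ZMod (2 * c)) = 0 := by exact_mod_cast ZMod.natCast_self (2 * c)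
    have inE : ∀ j < h, Prod.map C C (h - 1 - j, h + 1 + j) ∈
        (nest h h h ++ nest f (f + 1) k).map (Prod.map C C) := fun j hj =>
      List.mem_map_of_mem (List.mem_append_left _ (List.mem_map.2 ⟨j, by simpa using hj, rfl⟩))
    have inO : ∀ j < k, Prod.map C C (f - 1 - j, f + 1 + 1 + j) ∈
        (nest h h h ++ nest f (f + 1) k).map (Prod.map C C) := fun j hj =>
      List.mem_map_of_mem (List.mem_append_right _ (List.mem_map.2 ⟨j, by simpa using hj, rfl⟩))
    have eqv : ∀ p q : ℕ, (p + v = q ∨ p + v = q + 2 * c) → C q - C p = y - x := by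
      intro p q hpq
      rw [← hd]
      rcases hpq with hpq | hpq
      · simp only [C, ← hpq]; push_cast; ring
      · have := congrArg (Nat.cast : ℕ → ZMod (2 * c)) hpq
        push_cast at this
        simp only [C]
        linear_combination -this - hcz
    rcases hT v x hv0 hv1 with ⟨i, hi⟩ | ⟨hv, h3 | h3⟩ | ⟨hv, h3 | h3⟩ | ⟨a, b, hab, h4⟩
    · exact Or.inl ⟨i, by rw [hi, hd]; ring⟩
    · exact Or.inr (Or.inl ⟨_, inE (v / 2 - 1) (by omega), Or.inl (eqv _ _ (by omega))⟩)
    · exact Or.inr (Or.inl ⟨_, inE ((2 * c - v) / 2 - 1) (by omega),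
        Or.inr (eqv _ _ (by omega))⟩)
    · exact Or.inr (Or.inl ⟨_, inO ((v - 1) / 2 - 1) (by omega), Or.inl (eqv _ _ (by omega))⟩)
    · exact Or.inr (Or.inl ⟨_, inO ((2 * c - v - 1) / 2 - 1) (by omega),
        Or.inr (eqv _ _ (by omega))⟩)
    · refine Or.inr (Or.inr ⟨a, b, ?_, by rw [h4, hd]⟩)
      rcases hab with rfl | rfl <;> simp [C]

section Involutions

variable {c : ℕ}

/-- The parity of a residue modulo `2c`. -/
def parity (c : ℕ) : ZMod (2 * c) →+* ZMod 2 := ZMod.castHom (dvd_mul_right 2 c) (ZMod 2)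

/-- A fixed-point-free involution. -/
def IsMatching {α : Type*} (f : α → α) : Prop := Function.Involutive f ∧ ∀ x, f x ≠ x

theorem parity_natCast (n : ℕ) : parity c n = (n : ZMod 2) := map_natCast _ _

theorem zmod2_cases (z : ZMod 2) : z = 0 ∨ z = 1 := by
  revert z; decide

/-- Even `x` is matched with `x + d`. -/
def shiftMatch (d : ZMod (2 * c)) (x : ZMod (2 * c)) : ZMod (2 * c) :=
  if parity c x = 0 then x + d else x - d

theorem shiftMatch_isMatching {d : ZMod (2 * c)} (hd : parity c d = 1) :
    IsMatching (shiftMatch d) := by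
  have hd0 : d ≠ 0 := by rintro rfl; simp at hd
  constructor
  · intro x
    rcases zmod2_cases (parity c x) with h | h <;> simp [shiftMatch, h, hd]
  · intro x
    rcases zmod2_cases (parity c x) with h | h <;> simp [shiftMatch, h, hd0]

/-- Even `x` is reflected in `b / 2`, the even fixed points being matched by a shift by `d`. -/
def reflMatch (d b : ZMod (2 * c)) (x : ZMod (2 * c)) : ZMod (2 * c) :=
  if parity c x = 0 then if x + x = b then x + d else b - x
  else if x + x = b + 2 * d then x - d else b + 2 * d - x

theorem reflMatch_isMatching {d b : ZMod (2 * c)} (hd : parity c d = 1) (hb : parity c b = 0) :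
    IsMatching (reflMatch d b) := by
  have hd0 : d ≠ 0 := by rintro rfl; simp at hd
  have hp2 : parity c 2 = 0 := by rw [map_ofNat]; rfl
  have par : ∀ y, parity c y = -1 → parity c y = 1 := fun y hy => hy.trans (by decide)
  constructor
  · intro x
    rcases zmod2_cases (parity c x) with h | h
    · by_cases hx : x + x = b
      · have e : x + d + (x + d) = b + 2 * d := by rw [← hx]; ring
        simp [reflMatch, h, hd, hx, e]
      · have e : b - x + (b - x) ≠ b := fun e => hx (by linear_combination -e)
        simp [reflMatch, h, hb, hx, e]
    · by_cases hx : x + x = b + 2 * d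
      · have e : x - d + (x - d) = b := by linear_combination hx
        simp [reflMatch, h, hd, hx, e]
      · have e : b + 2 * d - x + (b + 2 * d - x) ≠ b + 2 * d :=
          fun e => hx (by linear_combination -e)
        simp [reflMatch, h, par (b + 2 * d - x) (by simp [h, hb, hp2]), hx, e]
  · intro x
    rcases zmod2_cases (parity c x) with h | h
    · by_cases hx : x + x = b
      · simp [reflMatch, h, hx, hd0]
      · simp only [reflMatch, h, hx, if_true, if_false]
        exact fun e => hx (by linear_combination -e)
    · by_cases hx : x + x = b + 2 * d
      · simp [reflMatch, h, hx, hd0]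
      · simp only [reflMatch, h, hx, one_ne_zero, if_false]
        exact fun e => hx (by linear_combination -e)

/-- Like `reflMatch`, with the pairs at distance `c` replaced. -/
def reflMatch' (d b : ZMod (2 * c)) (x : ZMod (2 * c)) : ZMod (2 * c) :=
  if parity c x = 0 then
    if x + x = b then x + d else if x + x = b + c then x + d + c else b - x
  else if x + x = b + 2 * d then x - d else if x + x = b + c + 2 * d then x - d - c
  else b + 2 * d - x

theorem natCast_add_self : ((c : ℕ) : ZMod (2 * c)) + c = 0 := by
  have := ZMod.natCast_self (2 * c)
  push_cast at this
  linear_combination this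

theorem natCast_half_ne_zero [NeZero (2 * c)] : ((c : ℕ) : ZMod (2 * c)) ≠ 0 := by
  have hc : 0 < 2 * c := Nat.pos_of_ne_zero (NeZero.ne _)
  rw [Ne, ZMod.natCast_eq_zero_iff]
  intro h
  have := Nat.le_of_dvd (by omega) h
  omega

theorem reflMatch'_isMatching [NeZero (2 * c)] {d b : ZMod (2 * c)} (hd : parity c d = 1) (hb : parity c b = 0)
    (hc : parity c c = 0) : IsMatching (reflMatch' d b) := by
  have hd0 : d ≠ 0 := by rintro rfl; simp at hd
  have hdc : d + c ≠ 0 := fun e => by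
    have := congrArg (parity c) e
    simp [hd, hc] at this
  have hp2 : parity c 2 = 0 := by rw [map_ofNat]; rfl
  have par : ∀ y, parity c y = -1 → parity c y = 1 := fun y hy => hy.trans (by decide)
  have hcc := natCast_add_self (c := c)
  have hc0 := natCast_half_ne_zero (c := c)
  constructor
  · intro x
    rcases zmod2_cases (parity c x) with h | h
    · by_cases hx : x + x = b
      · have e : x + d + (x + d) = b + 2 * d := by rw [← hx]; ring
        simp [reflMatch', h, hd, hx, e]
      by_cases hx' : x + x = b + c
      · have e : x + d + c + (x + d + c) = b + c + 2 * d := by linear_combination hx' + hcc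
        simp [reflMatch', h, hd, hx', e, hc, hc0]
        ring
      · have e : b - x + (b - x) ≠ b := fun e => hx (by linear_combination -e)
        have e' : b - x + (b - x) ≠ b + c := fun e => hx' (by linear_combination -e - hcc)
        simp [reflMatch', h, hb, hx, e, hx', e']
    · by_cases hx : x + x = b + 2 * d
      · have e : x - d + (x - d) = b := by linear_combination hx
        simp [reflMatch', h, hd, hx, e]
      by_cases hx' : x + x = b + c + 2 * d
      · have e : x - d - c + (x - d - c) = b + c := by linear_combination hx' - hcc
        simp [reflMatch', h, hd, hx', e, hc, hc0]
        ring
      · have e : b + 2 * d - x + (b + 2 * d - x) ≠ b + 2 * d :=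
          fun e => hx (by linear_combination -e)
        have e' : b + 2 * d - x + (b + 2 * d - x) ≠ b + c + 2 * d :=
          fun e => hx' (by linear_combination -e - hcc)
        simp [reflMatch', h, par (b + 2 * d - x) (by simp [h, hb, hp2]), hx, e, hx', e']
  · intro x
    rcases zmod2_cases (parity c x) with h | h
    · by_cases hx : x + x = b
      · simp [reflMatch', h, hx, hd0]
      by_cases hx' : x + x = b + c
      · simpa [reflMatch', h, hx', hc0, add_assoc] using hdc
      · simp only [reflMatch', h, hx, hx', if_true, if_false]
        exact fun e => hx (by linear_combination -e)
    · by_cases hx : x + x = b + 2 * d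
      · simp [reflMatch', h, hx, hd0]
      by_cases hx' : x + x = b + c + 2 * d
      · rw [reflMatch', if_neg (by simp [h]), if_neg hx, if_pos hx']
        exact fun e => hdc (by linear_combination -e)
      · simp only [reflMatch', h, hx, hx', one_ne_zero, if_false]
        exact fun e => hx (by linear_combination -e)

theorem exists_double [NeZero (2 * c)] {b : ZMod (2 * c)} (hb : parity c b = 0) :
    ∃ i : Fin c, ((2 * (i : ℕ) : ℕ) : ZMod (2 * c)) = b := by
  have h : (b.val : ZMod (2 * c)) = b := ZMod.natCast_zmod_val _
  rw [← h, parity_natCast, ZMod.natCast_eq_zero_iff] at hb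
  have hv : b.val < 2 * c := ZMod.val_lt _
  refine ⟨⟨b.val / 2, by omega⟩, ?_⟩
  refine Eq.trans (congrArg _ ?_) h
  change 2 * (b.val / 2) = b.val
  omega

/-- If all pairs with even first element and difference in the symmetric set `E` of odd
residues are covered by matchings, then all pairs with difference in `E` are. -/
theorem covers_of_even {J : Type*} {τ : J → ZMod (2 * c) → ZMod (2 * c)}
    (hτ : ∀ j, IsMatching (τ j)) {E : Finset (ZMod (2 * c))} (hE : ∀ e ∈ E, parity c e = 1)
    (hE' : ∀ e ∈ E, -e ∈ E)
    (h : ∀ x, parity c x = 0 → ∀ e ∈ E, ∃ j, τ j x = x + e) (x : ZMod (2 * c)) (e : ZMod (2 * c))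
    (he : e ∈ E) : ∃ j, τ j x = x + e := by
  rcases zmod2_cases (parity c x) with hx | hx
  · exact h x hx e he
  · have h0 : parity c (x + e) = 0 := by rw [map_add, hx, hE e he]; rfl
    obtain ⟨j, hj⟩ := h (x + e) h0 (-e) (hE' e he)
    rw [add_neg_cancel_right] at hj
    have h1 := (hτ j).1 (x + e)
    rw [hj] at h1
    exact ⟨j, h1⟩

theorem exists_matchings_odd (E : Finset (ZMod (2 * c))) (hE : ∀ e ∈ E, parity c e = 1)
    (hE' : ∀ e ∈ E, -e ∈ E) :
    ∃ τ : E → ZMod (2 * c) → ZMod (2 * c), (∀ j, IsMatching (τ j)) ∧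
      ∀ x, ∀ e ∈ E, ∃ j, τ j x = x + e := by
  have hM : ∀ j : E, IsMatching (shiftMatch j.1) := fun j => shiftMatch_isMatching (hE _ j.2)
  exact ⟨fun e => shiftMatch e.1, hM, covers_of_even hM hE hE' fun x hx e he =>
    ⟨⟨e, he⟩, by simp [shiftMatch, hx]⟩⟩

theorem exists_matchings_odd_half [NeZero (2 * c)] (E : Finset (ZMod (2 * c))) (hE : ∀ e ∈ E, parity c e = 1)
    (hE' : ∀ e ∈ E, -e ∈ E) :
    ∃ τ : Option E → ZMod (2 * c) → ZMod (2 * c), (∀ j, IsMatching (τ j)) ∧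
      ∀ x, (∀ e ∈ E, ∃ j, τ j x = x + e) ∧ ∃ j, τ j x = x + c := by
  obtain ⟨τ, h1, h2⟩ := exists_matchings_odd E hE hE'
  refine ⟨fun j => j.elim (fun x => x + c) τ, ?_, fun x => ⟨fun e he => ?_, none, rfl⟩⟩
  · rintro (_ | j)
    · refine ⟨fun x => ?_, fun x => ?_⟩
      · simp only [Option.elim]
        linear_combination natCast_add_self (c := c)
      · simpa using natCast_half_ne_zero
    · exact h1 j
  · obtain ⟨j, hj⟩ := h2 x e he
    exact ⟨some j, hj⟩

theorem exists_matchings_even [NeZero (2 * c)] (E : Finset (ZMod (2 * c))) (hE : ∀ e ∈ E, parity c e = 1)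
    (hE' : ∀ e ∈ E, -e ∈ E) (d : ZMod (2 * c)) (hd : d ∈ E) :
    ∃ τ : Fin c ⊕ E.erase d → ZMod (2 * c) → ZMod (2 * c), (∀ j, IsMatching (τ j)) ∧
      ∀ x, (∀ e ∈ E, ∃ j, τ j x = x + e) ∧
        ∀ e, parity c e = 0 → e ≠ 0 → ∃ j, τ j x = x + e := by
  have h2 : (2 : ZMod 2) = 0 := rfl
  let τ : Fin c ⊕ E.erase d → ZMod (2 * c) → ZMod (2 * c) :=
    Sum.elim (fun i => reflMatch d (2 * (i : ℕ) : ℕ)) fun e => shiftMatch e.1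
  have hM : ∀ j, IsMatching (τ j) := by
    rintro (i | j)
    · exact reflMatch_isMatching (hE d hd) (by rw [parity_natCast]; simp [h2])
    · exact shiftMatch_isMatching (hE _ (Finset.mem_of_mem_erase j.2))
  refine ⟨τ, hM, fun x => ⟨covers_of_even hM hE hE' (fun x hx e he => ?_) x, fun e he he0 => ?_⟩⟩
  · by_cases hed : e = d
    · obtain ⟨i, hi⟩ := exists_double (b := x + x) (by simp [hx])
      exact ⟨Sum.inl i, by simp only [τ, Sum.elim_inl, hi]; simp [reflMatch, hx, hed]⟩
    · exact ⟨Sum.inr ⟨e, Finset.mem_erase.2 ⟨hed, he⟩⟩, by simp [τ, shiftMatch, hx]⟩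
  · rcases zmod2_cases (parity c x) with hx | hx
    · obtain ⟨i, hi⟩ := exists_double (b := x + (x + e)) (by simp [hx, he])
      refine ⟨Sum.inl i, ?_⟩
      simp only [τ, Sum.elim_inl, hi]
      have : x + x ≠ x + (x + e) := by simpa using he0
      simp [reflMatch, hx, he0]
    · obtain ⟨i, hi⟩ := exists_double (b := x + (x + e) - 2 * d) (by
        simp only [map_sub, map_add, map_mul, hx, he, map_ofNat, h2, zero_mul]; decide)
      refine ⟨Sum.inl i, ?_⟩
      simp only [τ, Sum.elim_inl, hi]
      simp [reflMatch, hx, he0]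

theorem exists_matchings_even' [NeZero (2 * c)] (E : Finset (ZMod (2 * c))) (hE : ∀ e ∈ E, parity c e = 1)
    (hE' : ∀ e ∈ E, -e ∈ E) (hc : parity c c = 0) (d : ZMod (2 * c)) (hd : d ∈ E) :
    ∃ τ : Fin c ⊕ (E.erase d).erase (d + c) → ZMod (2 * c) → ZMod (2 * c),
      (∀ j, IsMatching (τ j)) ∧
      ∀ x, (∀ e ∈ E, ∃ j, τ j x = x + e) ∧
        ∀ e, parity c e = 0 → e ≠ 0 → e ≠ c → ∃ j, τ j x = x + e := by
  have h2 : (2 : ZMod 2) = 0 := rfl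
  have hcc := natCast_add_self (c := c)
  have hc0 := natCast_half_ne_zero (c := c)
  let τ : Fin c ⊕ (E.erase d).erase (d + c) → ZMod (2 * c) → ZMod (2 * c) :=
    Sum.elim (fun i => reflMatch' d (2 * (i : ℕ) : ℕ)) fun e => shiftMatch e.1
  have hM : ∀ j, IsMatching (τ j) := by
    rintro (i | j)
    · exact reflMatch'_isMatching (hE d hd) (by rw [parity_natCast]; simp [h2]) hc
    · exact shiftMatch_isMatching
        (hE _ (Finset.mem_of_mem_erase (Finset.mem_of_mem_erase j.2)))
  refine ⟨τ, hM, fun x => ⟨covers_of_even hM hE hE' (fun x hx e he => ?_) x,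
    fun e he he0 hec => ?_⟩⟩
  · by_cases hed : e = d
    · obtain ⟨i, hi⟩ := exists_double (b := x + x) (by simp [hx])
      exact ⟨Sum.inl i, by simp only [τ, Sum.elim_inl, hi]; simp [reflMatch', hx, hed]⟩
    by_cases hed' : e = d + c
    · obtain ⟨i, hi⟩ := exists_double (b := x + x + (c : ZMod (2 * c))) (by simp [hx, hc])
      refine ⟨Sum.inl i, ?_⟩
      have e1 : x + x = x + x + c + c := by linear_combination -hcc
      simp only [τ, Sum.elim_inl, hi]
      simp only [reflMatch', hx, if_true, ← e1]
      rw [if_neg (by simpa using hc0)]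
      rw [hed']; ring
    · exact ⟨Sum.inr ⟨e, Finset.mem_erase.2 ⟨hed', Finset.mem_erase.2 ⟨hed, he⟩⟩⟩,
        by simp [τ, shiftMatch, hx]⟩
  · rcases zmod2_cases (parity c x) with hx | hx
    · obtain ⟨i, hi⟩ := exists_double (b := x + (x + e)) (by simp [hx, he])
      refine ⟨Sum.inl i, ?_⟩
      have e1 : x + x ≠ x + (x + e) + c := fun h => hec (by linear_combination -h - hcc)
      simp only [τ, Sum.elim_inl, hi]
      simp only [reflMatch', hx, if_true, e1, if_false]
      rw [if_neg (by simpa using he0)]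
      ring
    · obtain ⟨i, hi⟩ := exists_double (b := x + (x + e) - 2 * d) (by
        simp only [map_sub, map_add, map_mul, hx, he, map_ofNat, h2, zero_mul]; decide)
      refine ⟨Sum.inl i, ?_⟩
      have e1 : x + x ≠ x + (x + e) - 2 * d + c + 2 * d :=
        fun h => hec (by linear_combination -h - hcc)
      have e2 : x + x ≠ x + (x + e) - 2 * d + 2 * d :=
        fun h => he0 (by linear_combination -h)
      simp only [τ, Sum.elim_inl, hi]
      simp only [reflMatch', hx, one_ne_zero, e1, e2, if_false]
      ring

end Involutions

section Extension

variable {c : ℕ}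

/-- The residues in the set `{v | P v}` modulo `2c` are differences of at most `n` matchings. -/
def Matchable (c n : ℕ) (P : ℕ → Prop) : Prop :=
  ∃ (J : Type) (_ : Fintype J) (τ : J → ZMod (2 * c) → ZMod (2 * c)), Fintype.card J ≤ n ∧
    (∀ j, IsMatching (τ j)) ∧ ∀ x v, 0 < v → v < 2 * c → P v → ∃ j, τ j x = x + (v : ℕ)

/-- The residues `2i + 1` for `i ∈ I`. -/
def oddResidues (c : ℕ) (I : Finset ℕ) : Finset (ZMod (2 * c)) :=
  I.image fun i => ((2 * i + 1 : ℕ) : ZMod (2 * c))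

theorem card_oddResidues_le (I : Finset ℕ) : (oddResidues c I).card ≤ I.card :=
  Finset.card_image_le

theorem parity_oddResidues {I : Finset ℕ} : ∀ e ∈ oddResidues c I, parity c e = 1 := by
  intro e he
  obtain ⟨i, -, rfl⟩ := Finset.mem_image.1 he
  rw [parity_natCast]
  push_cast
  rw [show (2 : ZMod 2) = 0 from rfl]
  simp

theorem neg_mem_oddResidues {I : Finset ℕ} (hI : ∀ i ∈ I, i < c ∧ c - 1 - i ∈ I) :
    ∀ e ∈ oddResidues c I, -e ∈ oddResidues c I := by
  intro e he
  obtain ⟨i, hi, rfl⟩ := Finset.mem_image.1 he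
  obtain ⟨h1, h2⟩ := hI i hi
  refine Finset.mem_image.2 ⟨_, h2, ?_⟩
  rw [eq_neg_iff_add_eq_zero, ← Nat.cast_add]
  convert ZMod.natCast_self (2 * c) using 2
  omega

theorem mem_oddResidues {I : Finset ℕ} {v : ℕ} (hv : v % 2 = 1) (h : v / 2 ∈ I) :
    (v : ZMod (2 * c)) ∈ oddResidues c I := by
  refine Finset.mem_image.2 ⟨_, h, ?_⟩
  congr 1
  omega

theorem natCast_ne_zero_of_lt {v : ℕ} (h : 0 < v) (h' : v < 2 * c) : (v : ZMod (2 * c)) ≠ 0 := by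
  rw [Ne, ZMod.natCast_eq_zero_iff]
  intro h
  have := Nat.le_of_dvd (by omega) h
  omega

theorem parity_eq_zero {v : ℕ} (h : v % 2 = 0) : parity c v = 0 := by
  rw [parity_natCast, ZMod.natCast_eq_zero_iff]
  omega

theorem matchable_odd {I : Finset ℕ} (hI : ∀ i ∈ I, i < c ∧ c - 1 - i ∈ I) :
    Matchable c I.card fun v => v % 2 = 1 ∧ v / 2 ∈ I := by
  obtain ⟨τ, h1, h2⟩ := exists_matchings_odd _ (parity_oddResidues (c := c) (I := I))
    (neg_mem_oddResidues hI)
  exact ⟨_, inferInstance, τ, by simpa using card_oddResidues_le I, h1,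
    fun x v _ _ hv => h2 x _ (mem_oddResidues hv.1 hv.2)⟩

theorem matchable_odd_half [NeZero (2 * c)] {I : Finset ℕ} (hI : ∀ i ∈ I, i < c ∧ c - 1 - i ∈ I) :
    Matchable c (I.card + 1) fun v => v % 2 = 1 ∧ v / 2 ∈ I ∨ v = c := by
  obtain ⟨τ, h1, h2⟩ := exists_matchings_odd_half _ (parity_oddResidues (c := c) (I := I))
    (neg_mem_oddResidues hI)
  refine ⟨_, inferInstance, τ, by simpa using card_oddResidues_le I, h1, fun x v _ _ hv => ?_⟩
  rcases hv with hv | rfl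
  · exact (h2 x).1 _ (mem_oddResidues hv.1 hv.2)
  · exact (h2 x).2

theorem matchable_even [NeZero (2 * c)] {I : Finset ℕ} (hI : ∀ i ∈ I, i < c ∧ c - 1 - i ∈ I)
    {i₀ : ℕ} (hi₀ : i₀ ∈ I) :
    Matchable c (c + (I.card - 1)) fun v => v % 2 = 1 ∧ v / 2 ∈ I ∨ v % 2 = 0 := by
  have hd : ((2 * i₀ + 1 : ℕ) : ZMod (2 * c)) ∈ oddResidues c I :=
    Finset.mem_image_of_mem _ hi₀
  obtain ⟨τ, h1, h2⟩ := exists_matchings_even _ (parity_oddResidues (c := c) (I := I))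
    (neg_mem_oddResidues hI) _ hd
  refine ⟨_, inferInstance, τ, ?_, h1, fun x v hv0 hvc hv => ?_⟩
  · rw [Fintype.card_sum, Fintype.card_fin, Fintype.card_coe, Finset.card_erase_of_mem hd]
    have := card_oddResidues_le (c := c) I
    omega
  · rcases hv with hv | hv
    · exact (h2 x).1 _ (mem_oddResidues hv.1 hv.2)
    · exact (h2 x).2 _ (parity_eq_zero hv) (natCast_ne_zero_of_lt hv0 hvc)

theorem matchable_even' [NeZero (2 * c)] {I : Finset ℕ} (hI : ∀ i ∈ I, i < c ∧ c - 1 - i ∈ I)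
    (hc : c % 2 = 0) {i₀ : ℕ} (hi₀ : i₀ ∈ I) (hi₁ : i₀ + c / 2 ∈ I) :
    Matchable c (c + (I.card - 2)) fun v => v % 2 = 1 ∧ v / 2 ∈ I ∨ v % 2 = 0 ∧ v ≠ c := by
  have hd : ((2 * i₀ + 1 : ℕ) : ZMod (2 * c)) ∈ oddResidues c I :=
    Finset.mem_image_of_mem _ hi₀
  have hd' : ((2 * i₀ + 1 : ℕ) + c : ZMod (2 * c)) ∈ oddResidues c I := by
    refine Finset.mem_image.2 ⟨_, hi₁, ?_⟩
    rw [← Nat.cast_add]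
    congr 1
    omega
  have hne : ((2 * i₀ + 1 : ℕ) + c : ZMod (2 * c)) ≠ (2 * i₀ + 1 : ℕ) := by
    simpa using natCast_half_ne_zero
  obtain ⟨τ, h1, h2⟩ := exists_matchings_even' _ (parity_oddResidues (c := c) (I := I))
    (neg_mem_oddResidues hI) (parity_eq_zero hc) _ hd
  refine ⟨_, inferInstance, τ, ?_, h1, fun x v hv0 hvc hv => ?_⟩
  · rw [Fintype.card_sum, Fintype.card_fin, Fintype.card_coe,
      Finset.card_erase_of_mem (Finset.mem_erase.2 ⟨hne, hd'⟩), Finset.card_erase_of_mem hd]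
    have := card_oddResidues_le (c := c) I
    omega
  · rcases hv with hv | ⟨hv, hvc'⟩
    · exact (h2 x).1 _ (mem_oddResidues hv.1 hv.2)
    · refine (h2 x).2 _ (parity_eq_zero hv) (natCast_ne_zero_of_lt hv0 hvc) fun e => hvc' ?_
      have := congrArg ZMod.val e
      rwa [ZMod.val_natCast_of_lt hvc, ZMod.val_natCast_of_lt (by omega)] at this

theorem HasOPSolution.extend_of_matchable {m₁ m₂ r : ℕ} (hc : 0 < c)
    (h₁ : 2 ≤ m₁) (h₂ : 2 ≤ m₂)
    (hL : HasOPSolution ([m₁, m₂] ++ List.replicate r 2)) (h k f : ℕ)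
    (hf : 2 * h + k < f) (hfc : f + 1 + k < 2 * c)
    (Q₁ Q₂ : List ℕ) (hQ₁ : Q₁.length = 2 * (m₁ % 2))
    (hQ₂ : Q₂.length = 2 * (m₂ % 2)) (hQ : (Q₁ ++ Q₂).Nodup)
    (hQf : ∀ q ∈ Q₁ ++ Q₂, q < 2 * c ∧ (q = h ∨ q = f ∨ q = f + 1 ∨ f + 1 + k < q))
    (hcount : 2 * c = m₁ + m₂ + 2 * r + m₁ % 2 + m₂ % 2 + 2 * (h + k))
    {n : ℕ} {P : ℕ → Prop} (hM : Matchable c n P) (hn : n ≤ m₁ + m₂ + 2 * r - 1)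
    (hT : ∀ v : ℕ, 0 < v → v < 2 * c → P v ∨
      (v % 2 = 0 ∧ (v ≤ 2 * h ∨ 2 * c ≤ v + 2 * h)) ∨
      (v % 2 = 1 ∧ (3 ≤ v ∧ v ≤ 2 * k + 1 ∨ 3 + v ≤ 2 * c ∧ 2 * c ≤ 2 * k + 1 + v)) ∨
      ∃ a b, (Q₁ = [a, b] ∨ Q₂ = [a, b]) ∧ (b = a + v ∨ b + 2 * c = a + v)) :
    HasOPSolution ([m₁, m₂] ++ List.replicate (r + c) 2) := by
  have : NeZero (2 * c) := ⟨by omega⟩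
  obtain ⟨J, _, τ, hJ, hτ, hcov⟩ := hM
  refine hL.extend_of_nests h₁ h₂ h k f hf hfc Q₁ Q₂ hQ₁ hQ₂ hQ hQf hcount (hJ.trans hn) τ
    (fun j => (hτ j).1) (fun j => (hτ j).2) fun v x hv hvc => ?_
  rcases hT v hv hvc with hP | hP | hP | ⟨a, b, hab, hP⟩
  · exact Or.inl (hcov x v hv hvc hP)
  · exact Or.inr (Or.inl hP)
  · exact Or.inr (Or.inr (Or.inl hP))
  · refine Or.inr (Or.inr (Or.inr ⟨a, b, hab, ?_⟩))
    rw [sub_eq_iff_eq_add', ← Nat.cast_add]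
    rcases hP with rfl | hP
    · rfl
    · rw [← hP, Nat.cast_add, ZMod.natCast_self, add_zero]

theorem card_Icc_union_le {k c : ℕ} (h : 2 * k + 2 ≤ c) :
    (Finset.Icc (k + 1) (c - k - 2) ∪ {0, c - 1}).card ≤ c - 2 * k := by
  refine (Finset.card_union_le _ _).trans ?_
  have := Finset.card_le_two (a := 0) (b := c - 1)
  rw [Nat.card_Icc]
  omega

theorem HasOPSolution.extend_of_even_even {m₁ m₂ r : ℕ} (h₁ : 2 ≤ m₁) (h₂ : 2 ≤ m₂)
    (hL : HasOPSolution ([m₁, m₂] ++ List.replicate r 2)) (hs : 6 ≤ m₁ + m₂ + 2 * r)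
    (e₁ : m₁ % 2 = 0) (e₂ : m₂ % 2 = 0) (hc : m₁ + m₂ + 2 * r ≤ 2 * c) :
    HasOPSolution ([m₁, m₂] ++ List.replicate (r + c) 2) := by
  have hc0 : 0 < c := by omega
  have : NeZero (2 * c) := ⟨by omega⟩
  have key : ∀ h k : ℕ, 2 * c = m₁ + m₂ + 2 * r + 2 * (h + k) → ∀ {n : ℕ} {P : ℕ → Prop},
      Matchable c n P → n ≤ m₁ + m₂ + 2 * r - 1 →
      (∀ v : ℕ, 0 < v → v < 2 * c → P v ∨
        (v % 2 = 0 ∧ (v ≤ 2 * h ∨ 2 * c ≤ v + 2 * h)) ∨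
        (v % 2 = 1 ∧ (3 ≤ v ∧ v ≤ 2 * k + 1 ∨ 3 + v ≤ 2 * c ∧ 2 * c ≤ 2 * k + 1 + v))) →
      HasOPSolution ([m₁, m₂] ++ List.replicate (r + c) 2) := by
    intro h k hk n P hM hn hT
    refine hL.extend_of_matchable hc0 h₁ h₂ h k (2 * h + 1 + k) (by omega) (by omega) [] []
      (by simp [e₁]) (by simp [e₂]) (by simp) (by simp) (by omega) hM hn fun v hv hv' => ?_
    rcases hT v hv hv' with h | h | h <;> tauto
  let I : ℕ → Finset ℕ := fun k => Finset.Icc (k + 1) (c - k - 2) ∪ {0, c - 1}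
  have hI : ∀ k, ∀ i ∈ I k, i < c ∧ c - 1 - i ∈ I k := by
    intro k i
    simp only [I, Finset.mem_union, Finset.mem_Icc, Finset.mem_insert, Finset.mem_singleton]
    omega
  by_cases hreg : m₁ + m₂ + 2 * r ≤ c + 2 - c % 2
  · rcases Nat.mod_two_eq_zero_or_one c with e | e
    · obtain ⟨k, hk⟩ : ∃ k, k = c / 2 + 1 - (m₁ + m₂ + 2 * r) / 2 := ⟨_, rfl⟩
      have hcard := card_Icc_union_le (k := k) (c := c) (by omega)
      refine key (c / 2 - 1) k (by omega)
        (matchable_odd_half (hI k)) (by simp only [I]; omega) fun v hv hv' => ?_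
      simp only [I, Finset.mem_union, Finset.mem_Icc, Finset.mem_insert, Finset.mem_singleton]
      omega
    · obtain ⟨k, hk⟩ : ∃ k, k = c / 2 + 1 - (m₁ + m₂ + 2 * r) / 2 := ⟨_, rfl⟩
      have hcard := card_Icc_union_le (k := k) (c := c) (by omega)
      refine key (c / 2) k (by omega)
        (matchable_odd (hI k)) (by simp only [I]; omega) fun v hv hv' => ?_
      simp only [I, Finset.mem_union, Finset.mem_Icc, Finset.mem_insert, Finset.mem_singleton]
      omega
  · obtain ⟨k, hk⟩ : ∃ k, k = c - (m₁ + m₂ + 2 * r) / 2 := ⟨_, rfl⟩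
    have hcard := card_Icc_union_le (k := k) (c := c) (by omega)
    refine key 0 k (by omega)
      (matchable_even (hI k) (i₀ := 0) (by simp [I])) (by simp only [I]; omega) fun v hv hv' => ?_
    simp only [I, Finset.mem_union, Finset.mem_Icc, Finset.mem_insert, Finset.mem_singleton]
    omega

theorem HasOPSolution.extend_of_odd_odd {m₁ m₂ r : ℕ} (h₁ : 2 ≤ m₁) (h₂ : 2 ≤ m₂)
    (hL : HasOPSolution ([m₁, m₂] ++ List.replicate r 2)) (hs : 6 ≤ m₁ + m₂ + 2 * r)
    (e₁ : m₁ % 2 = 1) (e₂ : m₂ % 2 = 1) (hc : m₁ + m₂ + 2 * r + 2 ≤ 2 * c) :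
    HasOPSolution ([m₁, m₂] ++ List.replicate (r + c) 2) := by
  have hc0 : 0 < c := by omega
  have : NeZero (2 * c) := ⟨by omega⟩
  have key : ∀ h k : ℕ, 2 * c = m₁ + m₂ + 2 * r + 2 + 2 * (h + k) → ∀ {n : ℕ} {P : ℕ → Prop},
      Matchable c n P → n ≤ m₁ + m₂ + 2 * r - 1 →
      (∀ v : ℕ, 0 < v → v < 2 * c → P v ∨
        (v % 2 = 0 ∧ (v ≤ 2 * h ∨ 2 * c ≤ v + 2 * h)) ∨
        (v % 2 = 1 ∧ (v ≤ 2 * k + 1 ∨ 2 * c ≤ 2 * k + 1 + v))) →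
      HasOPSolution ([m₁, m₂] ++ List.replicate (r + c) 2) := by
    intro h k hk n P hM hn hT
    refine hL.extend_of_matchable hc0 h₁ h₂ h k (2 * h + 1 + k) (by omega) (by omega)
      [2 * h + 1 + k, 2 * h + 1 + k + 1] [2 * h + 2 * k + 4, 2 * h + 2 * k + 3]
      (by simp [e₁]) (by simp [e₂]) (by simp; omega) (by simp; omega) (by omega) hM hn
      fun v hv hv' => ?_
    by_cases hv1 : v = 1
    · exact Or.inr (Or.inr (Or.inr ⟨_, _, Or.inl rfl, by omega⟩))
    by_cases hv2 : v + 1 = 2 * c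
    · exact Or.inr (Or.inr (Or.inr ⟨_, _, Or.inr rfl, by omega⟩))
    rcases hT v hv hv' with h | h | h
    · exact Or.inl h
    · exact Or.inr (Or.inl h)
    · exact Or.inr (Or.inr (Or.inl (by omega)))
  let I : ℕ → Finset ℕ := fun k => Finset.Icc (k + 1) (c - k - 2)
  have hI : ∀ k, ∀ i ∈ I k, i < c ∧ c - 1 - i ∈ I k := by
    intro k i
    simp only [I, Finset.mem_Icc]
    omega
  by_cases hreg : m₁ + m₂ + 2 * r ≤ c - c % 2
  · rcases Nat.mod_two_eq_zero_or_one c with e | e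
    · obtain ⟨k, hk⟩ : ∃ k, k = c / 2 - (m₁ + m₂ + 2 * r) / 2 := ⟨_, rfl⟩
      refine key (c / 2 - 1) k (by omega)
        (matchable_odd_half (hI k)) (by simp only [I, Nat.card_Icc]; omega) fun v hv hv' => ?_
      simp only [I, Finset.mem_Icc]
      omega
    · obtain ⟨k, hk⟩ : ∃ k, k = c / 2 - (m₁ + m₂ + 2 * r) / 2 := ⟨_, rfl⟩
      refine key (c / 2) k (by omega)
        (matchable_odd (hI k)) (by simp only [I, Nat.card_Icc]; omega) fun v hv hv' => ?_
      simp only [I, Finset.mem_Icc]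
      omega
  · obtain ⟨k, hk⟩ : ∃ k, k = c - 1 - (m₁ + m₂ + 2 * r) / 2 := ⟨_, rfl⟩
    refine key 0 k (by omega)
      (matchable_even (hI k) (i₀ := k + 1)
        (by simp only [I, Finset.mem_Icc]; omega))
      (by simp only [I, Nat.card_Icc]; omega) fun v hv hv' => ?_
    simp only [I, Finset.mem_Icc]
    omega

theorem HasOPSolution.extend_of_odd_sum {m₁ m₂ r : ℕ} (h₁ : 2 ≤ m₁) (h₂ : 2 ≤ m₂)
    (hL : HasOPSolution ([m₁, m₂] ++ List.replicate r 2)) (hs : 6 ≤ m₁ + m₂ + 2 * r)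
    (e : m₁ % 2 + m₂ % 2 = 1) (hc : m₁ + m₂ + 2 * r + 1 ≤ 2 * c) :
    HasOPSolution ([m₁, m₂] ++ List.replicate (r + c) 2) := by
  have hc0 : 0 < c := by omega
  have : NeZero (2 * c) := ⟨by omega⟩
  have key : ∀ h k : ℕ, 2 * c = m₁ + m₂ + 2 * r + 1 + 2 * (h + k) → ∀ {n : ℕ} {P : ℕ → Prop},
      Matchable c n P → n ≤ m₁ + m₂ + 2 * r - 1 →
      (∀ v : ℕ, 0 < v → v < 2 * c → v ≠ c → P v ∨
        (v % 2 = 0 ∧ (v ≤ 2 * h ∨ 2 * c ≤ v + 2 * h)) ∨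
        (v % 2 = 1 ∧ (3 ≤ v ∧ v ≤ 2 * k + 1 ∨ 3 + v ≤ 2 * c ∧ 2 * c ≤ 2 * k + 1 + v))) →
      HasOPSolution ([m₁, m₂] ++ List.replicate (r + c) 2) := by
    intro h k hk n P hM hn hT
    have main : ∀ Q₁ Q₂ : List ℕ, Q₁ = [h, h + c] ∧ Q₂ = [] ∨ Q₁ = [] ∧ Q₂ = [h, h + c] →
        Q₁.length = 2 * (m₁ % 2) → Q₂.length = 2 * (m₂ % 2) →
        HasOPSolution ([m₁, m₂] ++ List.replicate (r + c) 2) := by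
      intro Q₁ Q₂ hQ hQ₁ hQ₂
      have hQe : Q₁ ++ Q₂ = [h, h + c] := by rcases hQ with ⟨rfl, rfl⟩ | ⟨rfl, rfl⟩ <;> rfl
      refine hL.extend_of_matchable hc0 h₁ h₂ h k (h + c) (by omega) (by omega) Q₁ Q₂ hQ₁ hQ₂
        (by rw [hQe]; simp; omega) (by rw [hQe]; simp; omega) (by omega) hM hn fun v hv hv' => ?_
      by_cases hvc : v = c
      · refine Or.inr (Or.inr (Or.inr ⟨h, h + c, ?_, Or.inl (by rw [hvc])⟩))
        tauto
      · rcases hT v hv hv' hvc with h | h | h <;> tauto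
    rcases Nat.mod_two_eq_zero_or_one m₁ with e₁ | e₁
    · exact main [] [h, h + c] (Or.inr ⟨rfl, rfl⟩) (by simp [e₁])
        (by simp [show m₂ % 2 = 1 by omega])
    · exact main [h, h + c] [] (Or.inl ⟨rfl, rfl⟩) (by simp [e₁])
        (by simp [show m₂ % 2 = 0 by omega])
  let I : ℕ → Finset ℕ := fun k => Finset.Icc (k + 1) (c - k - 2) ∪ {0, c - 1}
  have hI : ∀ k, ∀ i ∈ I k, i < c ∧ c - 1 - i ∈ I k := by
    intro k i
    simp only [I, Finset.mem_union, Finset.mem_Icc, Finset.mem_insert, Finset.mem_singleton]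
    omega
  rcases Nat.mod_two_eq_zero_or_one c with e' | e'
  · by_cases hreg : m₁ + m₂ + 2 * r ≤ c + 1
    · obtain ⟨k, hk⟩ : ∃ k, k = c / 2 - (m₁ + m₂ + 2 * r) / 2 := ⟨_, rfl⟩
      have hcard := card_Icc_union_le (k := k) (c := c) (by omega)
      refine key (c / 2 - 1) k (by omega)
        (matchable_odd (hI k)) (by simp only [I]; omega) fun v hv hv' hvc => ?_
      simp only [I, Finset.mem_union, Finset.mem_Icc, Finset.mem_insert, Finset.mem_singleton]
      omega
    · obtain ⟨k, hk⟩ : ∃ k, k = c - 1 - (m₁ + m₂ + 2 * r) / 2 := ⟨_, rfl⟩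
      have hcard := card_Icc_union_le (k := k) (c := c) (by omega)
      refine key 0 k (by omega)
        (matchable_even' (hI k) e' (i₀ := 0) (by simp [I])
          (by simp only [I, Finset.mem_union, Finset.mem_Icc]; omega))
        (by simp only [I]; omega) fun v hv hv' hvc => ?_
      simp only [I, Finset.mem_union, Finset.mem_Icc, Finset.mem_insert, Finset.mem_singleton]
      omega
  · have hI' : ∀ k, ∀ i ∈ (I k).erase (c / 2), i < c ∧ c - 1 - i ∈ (I k).erase (c / 2) := by
      intro k i hi
      rw [Finset.mem_erase] at hi ⊢
      have := hI k i hi.2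
      exact ⟨this.1, by omega, this.2⟩
    have hmem : ∀ k, 2 * k + 3 ≤ c → c / 2 ∈ I k := by
      intro k hk
      simp only [I, Finset.mem_union, Finset.mem_Icc]
      omega
    by_cases hreg : m₁ + m₂ + 2 * r ≤ c
    · obtain ⟨k, hk⟩ : ∃ k, k = c / 2 - (m₁ + m₂ + 2 * r) / 2 := ⟨_, rfl⟩
      have hcard := card_Icc_union_le (k := k) (c := c) (by omega)
      refine key (c / 2) k (by omega)
        (matchable_odd (hI' k)) ?_ fun v hv hv' hvc => ?_
      · rw [Finset.card_erase_of_mem (hmem _ (by omega))]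
        simp only [I]; omega
      simp only [I, Finset.mem_erase, Finset.mem_union, Finset.mem_Icc, Finset.mem_insert,
        Finset.mem_singleton]
      omega
    · obtain ⟨k, hk⟩ : ∃ k, k = c - 1 - (m₁ + m₂ + 2 * r) / 2 := ⟨_, rfl⟩
      have hcard := card_Icc_union_le (k := k) (c := c) (by omega)
      refine key 0 k (by omega)
        (matchable_even (hI' k) (i₀ := 0)
          (by simp [I]; omega)) ?_
          fun v hv hv' hvc => ?_
      · rw [Finset.card_erase_of_mem (hmem _ (by omega))]
        simp only [I]; omega
      simp only [I, Finset.mem_erase, Finset.mem_union, Finset.mem_Icc, Finset.mem_insert,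
        Finset.mem_singleton]
      omega

theorem HasOPSolution.extend {m₁ m₂ r : ℕ} (h₁ : 2 ≤ m₁) (h₂ : 2 ≤ m₂)
    (hL : HasOPSolution ([m₁, m₂] ++ List.replicate r 2)) (hs : 6 ≤ m₁ + m₂ + 2 * r)
    (hc : m₁ + m₂ + 2 * r + m₁ % 2 + m₂ % 2 ≤ 2 * c) :
    HasOPSolution ([m₁, m₂] ++ List.replicate (r + c) 2) := by
  rcases Nat.mod_two_eq_zero_or_one m₁ with e₁ | e₁ <;>
    rcases Nat.mod_two_eq_zero_or_one m₂ with e₂ | e₂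
  · exact hL.extend_of_even_even h₁ h₂ hs e₁ e₂ (by omega)
  · exact hL.extend_of_odd_sum h₁ h₂ hs (by omega) (by omega)
  · exact hL.extend_of_odd_sum h₁ h₂ hs (by omega) (by omega)
  · exact hL.extend_of_odd_odd h₁ h₂ hs e₁ e₂ (by omega)

end Extension

/-- A single spanning collection of cycles on `{0, …, N}` whose arcs avoiding `N` realise every
nonzero difference modulo `N` yields a solution by developing it modulo `N` with `N` fixed. -/
theorem HasOPSolution.of_starter {N : ℕ} (hN : 0 < N) (LL : List (List ℕ)) (m : List ℕ)
    (hm : LL.map List.length = m) (h2 : ∀ l ∈ LL, 2 ≤ l.length) (hs : m.sum = N + 1)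
    (hmem : ∀ x ≤ N, ∃ l ∈ LL, x ∈ l)
    (hdiff : ∀ X, 0 < X → X < N → ∃ l ∈ LL, ∃ a b, CycNext l a b ∧ a < N ∧ b < N ∧
      (b = a + X ∨ b + N = a + X)) : HasOPSolution m := by
  classical
  have : NeZero N := ⟨hN.ne'⟩
  set f : ℕ → Option (ZMod N) := fun x => if x < N then some (x : ZMod N) else none with hf
  set LV : List (List (Option (ZMod N))) := LL.map (List.map f) with hLV
  have hcard : Fintype.card (Option (ZMod N)) = N + 1 := by
    rw [Fintype.card_option, ZMod.card]
  have hlen : LV.map List.length = m := by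
    rw [hLV, List.map_map, ← hm]; congr 1; funext l; simp
  have hcov : ∀ v : Option (ZMod N), v ∈ LV.flatten := by
    have key : ∀ x ≤ N, f x ∈ LV.flatten := by
      intro x hx
      obtain ⟨l, hl, hxl⟩ := hmem x hx
      exact List.mem_flatten.2 ⟨l.map f, List.mem_map.2 ⟨l, hl, rfl⟩, List.mem_map.2 ⟨x, hxl, rfl⟩⟩
    rintro (_ | z)
    · simpa [hf] using key N le_rfl
    · have := key z.val (ZMod.val_lt z).le
      simpa [hf, ZMod.val_lt z] using this
  have hnd : LV.flatten.Nodup := by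
    have h1 : LV.flatten.length = N + 1 := by rw [List.length_flatten, hlen, hs]
    have h3 : LV.flatten.toFinset = Finset.univ := by
      ext v; simpa using hcov v
    have h4 : LV.flatten.toFinset.card = LV.flatten.length := by
      rw [h3, Finset.card_univ, hcard, h1]
    have h5 : (LV.flatten : Multiset (Option (ZMod N))).toFinset.card =
        Multiset.card (LV.flatten : Multiset (Option (ZMod N))) := h4
    exact Multiset.coe_nodup.1 (Multiset.toFinset_card_eq_card_iff_nodup.1 h5)
  obtain ⟨π, hπ, hnext⟩ := exists_perm_of_cycles LV hnd (by
    intro l hl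
    obtain ⟨l', hl', rfl⟩ := List.mem_map.1 hl
    simpa using h2 l' hl')
  rw [hlen] at hπ
  have hfix : ∀ v, π v ≠ v := by
    intro v
    have h5 : π.support.card = Fintype.card (Option (ZMod N)) := by
      rw [← Perm.sum_cycleType, hπ, hcard, ← hs]; simp
    have h6 : π.support = Finset.univ := Finset.card_eq_iff_eq_univ _ |>.1 h5
    exact Perm.mem_support.1 (h6 ▸ Finset.mem_univ v)
  let sh : ZMod N → Perm (Option (ZMod N)) := fun i => (Equiv.addRight i).optionCongr
  have hsh : ∀ i z, sh i (some z) = some (z + i) := fun _ _ => rfl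
  have hsh0 : ∀ i, sh i none = none := fun _ => rfl
  have hconj : ∀ i u v, π u = v → (sh i * π * (sh i)⁻¹) (sh i u) = sh i v := by
    rintro i u v rfl; simp
  refine HasOPSolution.of_cover (V := Option (ZMod N)) (I := ZMod N) m (by rw [hcard, hs])
    (by rw [hs, ZMod.card]; simp) (fun i => sh i * π * (sh i)⁻¹)
    (fun i => by rw [Perm.cycleType_conj, hπ]) ?_
  rintro (_ | x) (_ | y) hxy
  · exact absurd rfl hxy
  · rcases h : π none with _ | z
    · exact absurd h (hfix none)
    · refine ⟨y - z, ?_⟩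
      have := hconj (y - z) _ _ h
      rw [hsh0, hsh] at this
      rw [this]; simp
  · obtain ⟨v, hv⟩ := π.surjective none
    rcases v with _ | z
    · exact absurd hv (hfix none)
    · refine ⟨x - z, ?_⟩
      have := hconj (x - z) _ _ hv
      rw [hsh0, hsh] at this
      simpa using this
  · have hxy' : y - x ≠ 0 := fun h => hxy (by rw [sub_eq_zero.1 h])
    obtain ⟨l, hl, a, b, hab, ha, hb, hX⟩ := hdiff (y - x).val
      (Nat.pos_of_ne_zero fun h => hxy' ((ZMod.val_eq_zero _).1 h)) (ZMod.val_lt _)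
    have hπab : π (some (a : ZMod N)) = some (b : ZMod N) := by
      have := hnext _ (List.mem_map.2 ⟨l, hl, rfl⟩) _ _ (hab.map f)
      simpa [hf, ha, hb] using this
    have hd : (b : ZMod N) = a + (y - x) := by
      rcases hX with h | h
      · rw [h]; simp
      · have := congrArg (Nat.cast : ℕ → ZMod N) h
        simpa using this
    refine ⟨x - a, ?_⟩
    have := hconj (x - a) _ _ hπab
    rw [hsh, hsh] at this
    rw [hd] at this
    simp only [add_sub_cancel] at this
    rw [this]; congr 1; ring

/-- The cyclically consecutive pairs of a list. -/
def cycPairs {α : Type*} : List α → List (α × α)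
  | [] => []
  | a :: l => (a :: l).zip (l ++ [a])

theorem mem_zip_append_singleton {α : Type*} {x y z : α} (l : List α) (a : α)
    (h : (x, y) ∈ (a :: l).zip (l ++ [z])) :
    (∃ p q, a :: l = p ++ x :: y :: q) ∨ ((∃ p, a :: l = p ++ [x]) ∧ y = z) := by
  induction l generalizing a with
  | nil =>
    simp only [List.nil_append, List.zip_cons_cons, List.zip_nil_left, List.mem_singleton,
      Prod.mk.injEq] at h
    exact Or.inr ⟨⟨[], by simp [h.1]⟩, h.2⟩
  | cons b l ih =>
    rw [List.cons_append, List.zip_cons_cons, List.mem_cons] at h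
    rcases h with h | h
    · simp only [Prod.mk.injEq] at h
      exact Or.inl ⟨[], l, by simp [h.1, h.2]⟩
    · rcases ih b h with ⟨p, q, e⟩ | ⟨⟨p, e⟩, hz⟩
      · exact Or.inl ⟨a :: p, q, by rw [e]; rfl⟩
      · exact Or.inr ⟨⟨a :: p, by rw [e]; rfl⟩, hz⟩

theorem CycNext.of_mem_cycPairs {α : Type*} {x y : α} {l : List α} (hl : 2 ≤ l.length)
    (h : (x, y) ∈ cycPairs l) : CycNext l x y := by
  cases l with
  | nil => simp at hl
  | cons a l =>
    rcases mem_zip_append_singleton l a h with ⟨p, q, e⟩ | ⟨⟨p, e⟩, rfl⟩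
    · rw [e]; exact .of_append p q x y
    · cases p with
      | nil =>
        rw [e] at hl
        simp at hl
      | cons c p =>
        simp only [List.cons_append, List.cons.injEq] at e
        rw [e.1, e.2]
        exact ⟨p, by simpa using List.isRotated_append (l := c :: p) (l' := [x])⟩

theorem CycNext.mem_right {α : Type*} {l : List α} {a b : α} (h : CycNext l a b) : b ∈ l := by
  obtain ⟨t, ht⟩ := h
  exact ht.mem_iff.2 (by simp)

theorem CycNext.flatMap {α β : Type*} {l : List α} {a b : α} (f : α → List β) {p q : List β}
    {x y : β} (h : CycNext l a b) (ha : f a = p ++ [x]) (hb : f b = y :: q) :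
    CycNext (l.flatMap f) x y := by
  obtain ⟨t, n, ht⟩ := h
  have h1 : l.flatMap f ~r (l.rotate n).flatMap f := by
    rw [List.rotate_eq_drop_append_take_mod, List.flatMap_append]
    conv_lhs => rw [← List.take_append_drop (n % l.length) l, List.flatMap_append]
    exact List.isRotated_append
  refine CycNext.of_isRotated ?_ h1
  rw [ht]
  simp only [List.flatMap_cons, ha, hb]
  simpa using CycNext.of_append p (q ++ t.flatMap f) x y

theorem CycNext.flatMap_of_mem {α β : Type*} {l : List α} {a : α} (f : α → List β)
    {p q : List β} {x y : β} (h : a ∈ l) (ha : f a = p ++ x :: y :: q) :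
    CycNext (l.flatMap f) x y := by
  obtain ⟨s, t, rfl⟩ := List.append_of_mem h
  simp only [List.flatMap_append, List.flatMap_cons, ha]
  simpa using CycNext.of_append (s.flatMap f ++ p) (q ++ t.flatMap f) x y

/-- Starters for two triangles and few digons. -/
theorem HasOPSolution.of_starter_dec {N : ℕ} (LL : List (List ℕ)) (m : List ℕ)
    (h : 0 < N ∧ LL.map List.length = m ∧ (∀ l ∈ LL, 2 ≤ l.length) ∧ m.sum = N + 1 ∧
      (∀ x < N + 1, ∃ l ∈ LL, x ∈ l) ∧
      ∀ X < N, X = 0 ∨ ∃ l ∈ LL, ∃ ab ∈ cycPairs l, ab.1 < N ∧ ab.2 < N ∧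
        (ab.2 = ab.1 + X ∨ ab.2 + N = ab.1 + X)) : HasOPSolution m := by
  obtain ⟨h1, h2, h3, h4, h5, h6⟩ := h
  refine .of_starter h1 LL m h2 h3 h4 (fun x hx => h5 x (by omega)) fun X hX hXN => ?_
  obtain rfl | ⟨l, hl, ab, hab, h7⟩ := h6 X hXN
  · omega
  · exact ⟨l, hl, ab.1, ab.2, .of_mem_cycPairs (h3 l hl) hab, h7⟩

theorem hasOPSolution_three_three {b : ℕ} (hb : 1 ≤ b) :
    HasOPSolution ([3, 3] ++ List.replicate b 2) := by
  have h1 : HasOPSolution ([3, 3] ++ List.replicate 1 2) :=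
    .of_starter_dec (N := 7) [[0, 1, 3], [2, 5, 4], [6, 7]] _ (by decide +kernel)
  rcases Nat.lt_or_ge b 6 with h | h
  · interval_cases b
    · exact h1
    · exact .of_starter_dec (N := 9) [[0, 1, 3], [4, 7, 5], [2, 6], [8, 9]] _ (by decide +kernel)
    · exact .of_starter_dec (N := 11) [[0, 1, 3], [4, 7, 5], [6, 10], [8, 2], [9, 11]] _
        (by decide +kernel)
    · exact .of_starter_dec (N := 13) [[0, 1, 3], [4, 7, 5], [8, 12], [6, 11], [9, 2], [10, 13]] _
        (by decide +kernel)
    · exact .of_starter_dec (N := 15)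
        [[0, 1, 3], [4, 7, 5], [8, 12], [9, 14], [11, 2], [6, 13], [10, 15]] _ (by decide +kernel)
  · have := h1.extend (c := b - 1) (by norm_num) (by norm_num) (by norm_num) (by omega)
    rwa [show 1 + (b - 1) = b by omega] at this

noncomputable section PackedForms

/-! Linear forms `c₀ + c₁ κ₁ + c₂ κ₂ + c₃ κ₃` with small coefficients are stored as the numbers
`c₀ + 1024 c₁ + 1024² c₂ + 1024³ c₃`. -/

variable {κ : ℕ → ℕ}

/-- The value of a packed form. -/
def ev (κ : ℕ → ℕ) (n : ℕ) : ℕ :=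
  n % 1024 + n / 1024 % 1024 * κ 1 + n / 1024 / 1024 % 1024 * κ 2 + n / 1024 / 1024 / 1024 * κ 3

/-- The first three digits of `n` are at most `k`. -/
def DigitsLE (k n : ℕ) : Prop :=
  n % 1024 ≤ k ∧ n / 1024 % 1024 ≤ k ∧ n / 1024 / 1024 % 1024 ≤ k

theorem DigitsLE.mono {i j n : ℕ} (h : DigitsLE i n) (hij : i ≤ j) : DigitsLE j n :=
  ⟨h.1.trans hij, h.2.1.trans hij, h.2.2.trans hij⟩

theorem mod_div_add {a b : ℕ} (h : a % 1024 + b % 1024 < 1024) :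
    (a + b) % 1024 = a % 1024 + b % 1024 ∧ (a + b) / 1024 = a / 1024 + b / 1024 := by
  omega

theorem DigitsLE.digits_add {i j a b : ℕ} (ha : DigitsLE i a) (hb : DigitsLE j b)
    (h : i + j < 1024) :
    (a + b) % 1024 = a % 1024 + b % 1024 ∧
      (a + b) / 1024 % 1024 = a / 1024 % 1024 + b / 1024 % 1024 ∧
      (a + b) / 1024 / 1024 % 1024 = a / 1024 / 1024 % 1024 + b / 1024 / 1024 % 1024 ∧
      (a + b) / 1024 / 1024 / 1024 = a / 1024 / 1024 / 1024 + b / 1024 / 1024 / 1024 := by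
  obtain ⟨a0, a1, a2⟩ := ha
  obtain ⟨b0, b1, b2⟩ := hb
  obtain ⟨h0, h1⟩ := mod_div_add (a := a) (b := b) (by linarith)
  obtain ⟨h2, h3⟩ := mod_div_add (a := a / 1024) (b := b / 1024) (by linarith)
  obtain ⟨h4, h5⟩ := mod_div_add (a := a / 1024 / 1024) (b := b / 1024 / 1024) (by linarith)
  rw [h0, h1, h2, h3, h4, h5]
  simp

theorem DigitsLE.add {i j a b : ℕ} (ha : DigitsLE i a) (hb : DigitsLE j b) (h : i + j < 1024) :
    DigitsLE (i + j) (a + b) := by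
  obtain ⟨h0, h1, h2, h3⟩ := ha.digits_add hb h
  exact ⟨h0 ▸ add_le_add ha.1 hb.1, h1 ▸ add_le_add ha.2.1 hb.2.1, h2 ▸ add_le_add ha.2.2 hb.2.2⟩

theorem ev_add {i j a b : ℕ} (ha : DigitsLE i a) (hb : DigitsLE j b) (h : i + j < 1024) :
    ev κ (a + b) = ev κ a + ev κ b := by
  obtain ⟨h0, h1, h2, h3⟩ := ha.digits_add hb h
  simp only [ev, h0, h1, h2, h3]; ring

theorem digits_eq {a b c d n : ℕ} (hn : n = a + 1024 * (b + 1024 * (c + 1024 * d))) (ha : a < 1024)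
    (hb : b < 1024) (hc : c < 1024) :
    n % 1024 = a ∧ n / 1024 % 1024 = b ∧ n / 1024 / 1024 % 1024 = c ∧
      n / 1024 / 1024 / 1024 = d := by
  have e1 : n / 1024 = b + 1024 * (c + 1024 * d) := by omega
  have e2 : n / 1024 / 1024 = c + 1024 * d := by omega
  have e3 : n / 1024 / 1024 / 1024 = d := by omega
  refine ⟨by omega, by rw [e1]; omega, by rw [e2]; omega, e3⟩

theorem digitsLE_const {c : ℕ} (h : c < 1024) : DigitsLE c c := by
  obtain ⟨h0, h1, h2, -⟩ := digits_eq (n := c) (a := c) (b := 0) (c := 0) (d := 0) (by simp) h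
    (by norm_num) (by norm_num)
  exact ⟨h0.le, h1.trans_le (Nat.zero_le _), h2.trans_le (Nat.zero_le _)⟩

theorem ev_const {c : ℕ} (h : c < 1024) : ev κ c = c := by
  obtain ⟨h0, h1, h2, h3⟩ := digits_eq (n := c) (a := c) (b := 0) (c := 0) (d := 0) (by simp) h
    (by norm_num) (by norm_num)
  simp only [ev, h0, h1, h2, h3]; simp

theorem pow_spec {h p : ℕ} (hh : h < 1024) (hp : p ≤ 3) (h0 : p = 0 → h = 0) :
    DigitsLE h (h * 1024 ^ p) ∧ ev κ (h * 1024 ^ p) = h * κ p := by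
  have key : ∀ a b c d, h * 1024 ^ p = a + 1024 * (b + 1024 * (c + 1024 * d)) → a ≤ h → b ≤ h →
      c ≤ h → a + b * κ 1 + c * κ 2 + d * κ 3 = h * κ p →
      DigitsLE h (h * 1024 ^ p) ∧ ev κ (h * 1024 ^ p) = h * κ p := by
    intro a b c d e ha hb hc he
    obtain ⟨h0, h1, h2, h3⟩ := digits_eq e (by omega) (by omega) (by omega)
    refine ⟨⟨h0.trans_le ha, h1.trans_le hb, h2.trans_le hc⟩, ?_⟩
    rw [← he]
    simp only [ev, h0, h1, h2, h3]
  interval_cases p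
  · exact key 0 0 0 0 (by rw [h0 rfl]; simp) (by simp) (by simp) (by simp) (by rw [h0 rfl]; simp)
  · exact key 0 h 0 0 (by ring) (by simp) (by simp) (by simp) (by simp)
  · exact key 0 0 h 0 (by ring) (by simp) (by simp) (by simp) (by simp)
  · exact key 0 0 0 h (by ring) (by simp) (by simp) (by simp) (by simp)

/-! Several definitions below are written with recursors and evaluate their arguments eagerly, for
the benefit of the kernel. -/

/-- Short-circuiting conjunction. -/
def andB (a b : Bool) : Bool := Bool.rec false b a

@[simp]
theorem andB_iff {a b : Bool} : andB a b = true ↔ a = true ∧ b = true := by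
  cases a <;> simp [andB]

def force {α : Type} (n : ℕ) (f : ℕ → α) : α := Nat.rec (f 0) (fun m _ => f (Nat.succ m)) n

@[simp]
theorem force_eq {α : Type} (n : ℕ) (f : ℕ → α) : force n f = f n := by cases n <;> rfl

def forceList {α β : Type} (l : List α) (f : List α → β) : β :=
  List.rec (f []) (fun x l _ => f (x :: l)) l

@[simp]
theorem forceList_eq {α β : Type} (l : List α) (f : List α → β) : forceList l f = f l := by
  cases l <;> rfl

/-- Digitwise strict comparison of packed forms. -/
def formLT (a b : ℕ) : Bool :=
  andB (Nat.ble (Nat.succ (Nat.mod a 1024)) (Nat.mod b 1024)) <|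
    force (Nat.div a 1024) fun a => force (Nat.div b 1024) fun b =>
  andB (Nat.ble (Nat.mod a 1024) (Nat.mod b 1024)) <|
    force (Nat.div a 1024) fun a => force (Nat.div b 1024) fun b =>
  andB (Nat.ble (Nat.mod a 1024) (Nat.mod b 1024)) <| Nat.ble (Nat.div a 1024) (Nat.div b 1024)

theorem ev_lt {a b : ℕ} (h : formLT a b = true) : ev κ a < ev κ b := by
  simp only [formLT, force_eq, Nat.ble_eq, andB_iff] at h
  obtain ⟨h0, h1, h2, h3⟩ := h
  change a % 1024 < b % 1024 at h0
  change a / 1024 % 1024 ≤ b / 1024 % 1024 at h1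
  change a / 1024 / 1024 % 1024 ≤ b / 1024 / 1024 % 1024 at h2
  change a / 1024 / 1024 / 1024 ≤ b / 1024 / 1024 / 1024 at h3
  unfold ev
  have := Nat.mul_le_mul_right (κ 1) h1
  have := Nat.mul_le_mul_right (κ 2) h2
  have := Nat.mul_le_mul_right (κ 3) h3
  linarith

/-- The first three digits are below `128`. -/
def small (n : ℕ) : Bool :=
  andB (Nat.ble (Nat.mod n 1024) 127) <| force (Nat.div n 1024) fun n =>
  andB (Nat.ble (Nat.mod n 1024) 127) <| Nat.ble (Nat.mod (Nat.div n 1024) 1024) 127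

theorem DigitsLE.of_small {n : ℕ} (h : small n = true) : DigitsLE 127 n := by
  simp only [small, force_eq, Nat.ble_eq, andB_iff] at h
  exact h

/-- A run of vertices (or residues) inserted before position `cut`; it has `h * κ p` entries. -/
structure Block where
  cut : ℕ
  h : ℕ
  p : ℕ

/-- The packed size of a block. -/
def Block.size (b : Block) : ℕ := Nat.mul b.h (Nat.pow 1024 b.p)

def Block.ok (b : Block) : Bool := andB (Nat.ble 1 b.p) (Nat.ble b.p 3)

theorem Block.le_of_ok {b : Block} (h : b.ok = true) : 1 ≤ b.p ∧ b.p ≤ 3 := by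
  simpa [Block.ok] using h

def width : List Block → ℕ
  | [] => 0
  | b :: bs => b.h + width bs

def total : List Block → ℕ
  | [] => 0
  | b :: bs => b.size + total bs

/-- The position, after insertion of the blocks, of the element at position `u` before. -/
def pos (bs : List Block) (u : ℕ) : ℕ :=
  List.rec u (fun b _ ih => Bool.rec u (Nat.add b.size ih) (Nat.ble b.cut u)) bs

theorem pos_nil (u : ℕ) : pos [] u = u := rfl

theorem pos_cons (b : Block) (bs : List Block) (u : ℕ) :
    pos (b :: bs) u = if b.cut ≤ u then b.size + pos bs u else u := by
  split
  · next h => simp [pos, Nat.ble_eq_true_of_le h]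
  · next h => simp [pos, Bool.eq_false_iff.2 (mt Nat.le_of_ble_eq_true h)]

/-- Blocks with their initial positions; the field `cut` now holds a packed form. -/
def starts (bs : List Block) : ℕ → List Block :=
  List.rec (fun _ => []) (fun b _ ih acc => force (Nat.add b.cut acc) fun c =>
    forceList (ih (Nat.add acc b.size)) fun l => ⟨c, b.h, b.p⟩ :: l) bs

theorem starts_nil (acc : ℕ) : starts [] acc = [] := rfl

theorem starts_cons (b : Block) (bs : List Block) (acc : ℕ) :
    starts (b :: bs) acc = ⟨b.cut + acc, b.h, b.p⟩ :: starts bs (acc + b.size) := by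
  simp [starts]

def sortedIn (M : ℕ) : List Block → ℕ → Bool
  | [], lo => Nat.ble lo M
  | b :: bs, lo => andB (Nat.ble lo b.cut) (andB b.ok (sortedIn M bs b.cut))

theorem sortedIn_le {M : ℕ} {bs : List Block} {lo : ℕ} (h : sortedIn M bs lo = true) : lo ≤ M := by
  induction bs generalizing lo with
  | nil => simpa [sortedIn] using h
  | cons b bs ih =>
    simp only [sortedIn, andB_iff, Nat.ble_eq] at h
    exact h.1.trans (ih h.2.2)

theorem Block.digitsLE_size {b : Block} (hb : b.ok = true) (hh : b.h < 1024) :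
    DigitsLE b.h b.size :=
  have := b.le_of_ok hb
  (pow_spec (κ := 0) hh this.2 (by omega)).1

theorem Block.ev_size {b : Block} (hb : b.ok = true) (hh : b.h < 1024) :
    ev κ b.size = b.h * κ b.p :=
  have := b.le_of_ok hb
  (pow_spec hh this.2 (by omega)).2

theorem pos_spec {M lo : ℕ} {bs : List Block} (h : sortedIn M bs lo = true) {u : ℕ}
    (hu : u + width bs < 1024) : DigitsLE (u + width bs) (pos bs u) := by
  induction bs generalizing lo with
  | nil => exact digitsLE_const hu
  | cons b bs ih =>
    simp only [sortedIn, andB_iff, Nat.ble_eq] at h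
    simp only [width] at hu ⊢
    rw [pos_cons]
    split
    · exact ((b.digitsLE_size h.2.1 (by omega)).add (ih h.2.2 (by omega)) (by omega)).mono
        (by omega)
    · exact (digitsLE_const (by omega)).mono (by omega)

theorem ev_pos_cons {M lo : ℕ} {b : Block} {bs : List Block}
    (h : sortedIn M (b :: bs) lo = true) {u : ℕ}
    (hu : u + width (b :: bs) < 1024) (hbu : b.cut ≤ u) :
    ev κ (pos (b :: bs) u) = b.h * κ b.p + ev κ (pos bs u) := by
  simp only [sortedIn, andB_iff, Nat.ble_eq] at h
  simp only [width] at hu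
  rw [pos_cons, if_pos (by simpa using hbu), ev_add (b.digitsLE_size h.2.1 (by omega))
    (pos_spec h.2.2 (by omega)) (by omega), (b.ev_size h.2.1 (by omega))]

theorem total_spec {M lo : ℕ} {bs : List Block} (h : sortedIn M bs lo = true)
    (hu : width bs < 1024) : DigitsLE (width bs) (total bs) := by
  induction bs generalizing lo with
  | nil => exact digitsLE_const hu
  | cons b bs ih =>
    simp only [sortedIn, andB_iff, Nat.ble_eq] at h
    simp only [width] at hu ⊢
    rw [total]
    exact ((b.digitsLE_size h.2.1 (by omega)).add (ih h.2.2 (by omega)) (by omega))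

theorem pos_top {M lo : ℕ} {bs : List Block} (h : sortedIn M bs lo = true) :
    pos bs M = M + total bs := by
  induction bs generalizing lo with
  | nil => simp [pos_nil, total]
  | cons b bs ih =>
    simp only [sortedIn, andB_iff, Nat.ble_eq] at h
    rw [pos_cons, if_pos (by simpa using sortedIn_le h.2.2), ih h.2.2, total]; omega

/-- Every position is either the image of an old one or lies in an inserted block. -/
theorem exists_of_lt {M a : ℕ} {bs : List Block} {lo acc X : ℕ}
    (h : sortedIn M bs lo = true) (ha : DigitsLE a acc) (hM : M + width bs + a < 1024)
    (hlo : lo + ev κ acc ≤ X) (hX : X < M + ev κ acc + ev κ (total bs)) :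
    (∃ r, lo ≤ r ∧ r < M ∧ X = ev κ acc + ev κ (pos bs r)) ∨
      ∃ b ∈ starts bs acc, DigitsLE (M + width bs + a) b.cut ∧ b.h ≤ width bs ∧ b.ok = true ∧
        ∃ i < κ b.p, ∃ j < b.h, X = ev κ b.cut + b.h * i + j := by
  induction bs generalizing lo acc a with
  | nil =>
    simp only [width, total, starts_nil] at *
    rw [ev_const (by norm_num : 0 < 1024)] at hX
    refine Or.inl ⟨X - ev κ acc, by omega, by omega, ?_⟩
    rw [pos_nil, ev_const (c := X - ev κ acc) (by omega)]; omega
  | cons b bs ih =>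
    have h' := h
    simp only [sortedIn, andB_iff, Nat.ble_eq] at h
    obtain ⟨h1, h2, h3⟩ := h
    have hMc := sortedIn_le h3
    simp only [width] at hM
    have hs : DigitsLE b.h b.size ∧ ev κ b.size = b.h * κ b.p :=
      ⟨b.digitsLE_size h2 (by omega), b.ev_size h2 (by omega)⟩
    rw [total, ev_add hs.1 (total_spec h3 (by omega)) (by omega), hs.2] at hX
    have hcut : ev κ (b.cut + acc) = b.cut + ev κ acc := by
      rw [ev_add (digitsLE_const (by omega)) ha (by omega), ev_const (by omega)]
    by_cases hA : X < b.cut + ev κ acc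
    · refine Or.inl ⟨X - ev κ acc, by omega, by omega, ?_⟩
      rw [pos_cons, if_neg (by simp; omega), ev_const (c := X - ev κ acc) (by omega)]; omega
    · by_cases hB : X < b.cut + ev κ acc + b.h * κ b.p
      · refine Or.inr ⟨⟨b.cut + acc, b.h, b.p⟩, by simp [starts_cons], ?_, by simp [width], h2, ?_⟩
        · exact ((digitsLE_const (c := b.cut) (by omega)).add ha (by omega)).mono
            (by simp only [width]; omega)
        · have hpos : 0 < b.h := by
            rcases Nat.eq_zero_or_pos b.h with h0 | h0
            · rw [h0, zero_mul] at hB; omega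
            · exact h0
          refine ⟨(X - (b.cut + ev κ acc)) / b.h, ?_, (X - (b.cut + ev κ acc)) % b.h,
            Nat.mod_lt _ hpos, ?_⟩
          · change _ < κ b.p
            rw [Nat.div_lt_iff_lt_mul hpos, Nat.mul_comm]; omega
          · have := Nat.div_add_mod (X - (b.cut + ev κ acc)) b.h
            simp only [hcut]; omega
      · have hacc : ev κ (acc + b.size) = ev κ acc + b.h * κ b.p := by
          rw [ev_add ha hs.1 (by omega), hs.2]
        rcases ih h3 (ha.add hs.1 (by omega)) (by omega) (by omega) (by omega) with
          ⟨r, hr1, hr2, hr3⟩ | ⟨b', hb', hd, hw, hrest⟩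
        · refine Or.inl ⟨r, by omega, hr2, ?_⟩
          rw [ev_pos_cons h' (by simp only [width]; omega) hr1]; omega
        · exact Or.inr ⟨b', by simp [starts_cons, hb'], hd.mono (by simp only [width]; omega),
            by simp only [width]; omega, hrest⟩

end PackedForms

noncomputable section Templates

variable {κ : ℕ → ℕ}

def allB {α : Type} (l : List α) (f : α → Bool) : Bool := List.rec true (fun x _ ih => andB (f x) ih) l

def anyB {α : Type} (l : List α) (f : α → Bool) : Bool :=
  List.rec false (fun x _ ih => Bool.rec ih true (f x)) l

def allBelow (n : ℕ) (f : ℕ → Bool) : Bool := Nat.rec true (fun i ih => andB (f i) ih) n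

theorem forall_of_allB {α : Type} {l : List α} {f : α → Bool} (h : allB l f = true) :
    ∀ x ∈ l, f x = true := by
  induction l with
  | nil => simp
  | cons x l ih =>
    obtain ⟨h1, h2⟩ := andB_iff.1 h
    simpa using ⟨h1, ih h2⟩

theorem exists_of_anyB {α : Type} {l : List α} {f : α → Bool} (h : anyB l f = true) :
    ∃ x ∈ l, f x = true := by
  induction l with
  | nil => cases h
  | cons x l ih =>
    by_cases hx : f x = true
    · exact ⟨x, by simp, hx⟩
    · have h' : anyB l f = true := by
        rw [Bool.not_eq_true] at hx
        simpa [anyB, hx] using h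
      obtain ⟨y, hy, h⟩ := ih h'
      exact ⟨y, by simp [hy], h⟩

theorem forall_of_allBelow {n : ℕ} {f : ℕ → Bool} (h : allBelow n f = true) :
    ∀ i < n, f i = true := by
  induction n with
  | zero => simp
  | succ n ih =>
    obtain ⟨h1, h2⟩ := andB_iff.1 h
    intro i hi
    rcases Nat.lt_succ_iff_lt_or_eq.1 hi with hi | rfl
    exacts [ih h2 i hi, h1]

/-- The families of arcs `P + h * i → Q + h * j` with `i + j + 1 = κ p`. The arc with
`j = 0` has difference `d`. -/
structure Line where
  h : ℕ
  p : ℕ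
  P : ℕ
  Q : ℕ
  d : ℕ

def Line.size (l : Line) : ℕ := Nat.mul l.h (Nat.pow 1024 l.p)

/-- Adds a family of arcs to a list; `T` is the modulus. -/
def consLine (T h p P Q : ℕ) (ls : List Line) : List Line :=
  force (Nat.sub (Nat.add Q h) (Nat.add P (Nat.mul h (Nat.pow 1024 p)))) fun d =>
    Bool.rec (force (Nat.sub (Nat.add (Nat.add Q h) T) (Nat.add P (Nat.mul h (Nat.pow 1024 p))))
      fun d => ⟨h, p, P, Q, d⟩ :: ls) (⟨h, p, P, Q, d⟩ :: ls)
      (andB (Nat.ble (Nat.add P (Nat.mul h (Nat.pow 1024 p))) (Nat.add Q h)) (small d))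

theorem mem_consLine {T h p P Q : ℕ} {ls : List Line} {l : Line}
    (hl : l ∈ consLine T h p P Q ls) : (l.h = h ∧ l.p = p ∧ l.P = P ∧ l.Q = Q) ∨ l ∈ ls := by
  simp only [consLine, force_eq] at hl
  revert hl
  generalize andB _ _ = b
  cases b <;>
  · intro hl
    rcases List.mem_cons.1 hl with rfl | hl
    · exact Or.inl ⟨rfl, rfl, rfl, rfl⟩
    · exact Or.inr hl

/-- A vertex of a template cycle, replaced by a path with `1 + 2 * κ p` vertices which runs through
the residue class of `e` in one block and that of `a` in another one; `p = 0` for ordinary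
vertices. -/
structure Item where
  u : ℕ
  h : ℕ
  p : ℕ
  a : ℕ
  e : ℕ
  up : Bool

def Item.size (x : Item) : ℕ := Nat.mul x.h (Nat.pow 1024 x.p)

/-- The last vertex of the path replacing an item. -/
def Item.out (x : Item) : ℕ := Bool.rec (Nat.add x.e x.size) x.e x.up

/-- The first vertex of the path replacing an item. -/
def Item.inn (x : Item) : ℕ := Bool.rec x.e (Nat.add x.e x.size) x.up

/-- The families of arcs on the path replacing an item. -/
def Item.addLines (T : ℕ) (x : Item) (ls : List Line) : List Line :=
  Bool.rec (force (Nat.add x.e x.h) fun e' =>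
    Bool.rec (consLine T x.h x.p x.e x.a (consLine T x.h x.p x.a e' ls))
      (consLine T x.h x.p e' x.a (consLine T x.h x.p x.a x.e ls)) x.up) ls (Nat.beq x.p 0)

def Item.weight (x : Item) : ℕ := Bool.rec (Nat.add 1 (Nat.mul 2 (Nat.pow 1024 x.p))) 1 (Nat.beq x.p 0)

def weight (c : List Item) : ℕ := List.rec 0 (fun x _ ih => Nat.add x.weight ih) c

def addItemLines (T : ℕ) (c : List Item) (ls : List Line) : List Line :=
  List.rec ls (fun x _ ih => forceList ih (x.addLines T)) c

/-- The vertices `γ 0, α 0, γ 1, α 1, …, γ n`. -/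
def zigzag (α γ : ℕ → ℕ) : ℕ → List ℕ
  | 0 => [γ 0]
  | n + 1 => zigzag α γ n ++ [α n, γ (n + 1)]

theorem zigzag_length (α γ : ℕ → ℕ) (n : ℕ) : (zigzag α γ n).length = 1 + 2 * n := by
  induction n with
  | zero => rfl
  | succ n ih => rw [zigzag, List.length_append, ih]; simp; ring

theorem zigzag_last (α γ : ℕ → ℕ) (n : ℕ) : ∃ p, zigzag α γ n = p ++ [γ n] := by
  cases n with
  | zero => exact ⟨[], rfl⟩
  | succ n => exact ⟨zigzag α γ n ++ [α n], by simp [zigzag]⟩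

theorem zigzag_head (α γ : ℕ → ℕ) (n : ℕ) : ∃ q, zigzag α γ n = γ 0 :: q := by
  induction n with
  | zero => exact ⟨[], rfl⟩
  | succ n ih =>
    obtain ⟨q, hq⟩ := ih
    exact ⟨q ++ [α n, γ (n + 1)], by rw [zigzag, hq]; rfl⟩

theorem zigzag_up (α γ : ℕ → ℕ) {n j : ℕ} (hj : j < n) :
    ∃ p q, zigzag α γ n = p ++ γ j :: α j :: q := by
  induction n with
  | zero => omega
  | succ n ih =>
    rcases Nat.lt_succ_iff_lt_or_eq.1 hj with h | rfl
    · obtain ⟨p, q, e⟩ := ih h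
      exact ⟨p, q ++ [α n, γ (n + 1)], by rw [zigzag, e]; simp⟩
    · obtain ⟨p, e⟩ := zigzag_last α γ j
      exact ⟨p, [γ (j + 1)], by rw [zigzag, e]; simp⟩

theorem zigzag_down (α γ : ℕ → ℕ) {n j : ℕ} (hj : j < n) :
    ∃ p q, zigzag α γ n = p ++ α j :: γ (j + 1) :: q := by
  induction n with
  | zero => omega
  | succ n ih =>
    rcases Nat.lt_succ_iff_lt_or_eq.1 hj with h | rfl
    · obtain ⟨p, q, e⟩ := ih h
      exact ⟨p, q ++ [α n, γ (n + 1)], by rw [zigzag, e]; simp⟩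
    · exact ⟨zigzag α γ j, [], by rw [zigzag]⟩

/-- The path replacing an item. -/
def Item.expand (κ : ℕ → ℕ) (x : Item) : List ℕ :=
  bif x.up then
    zigzag (fun j => ev κ x.a + x.h * j) (fun j => ev κ x.e + x.h * (κ x.p - j)) (κ x.p)
  else
    zigzag (fun j => ev κ x.a + x.h * (κ x.p - 1 - j)) (fun j => ev κ x.e + x.h * j) (κ x.p)

/-- Two-cycles `P + h * i, Q + h * j` with `i + j + 1 = κ p`. -/
structure Nest where
  h : ℕ
  p : ℕ
  P : ℕ
  Q : ℕ

def nestWeight (ns : List Nest) : ℕ := List.rec 0 (fun n _ ih => Nat.add (Nat.pow 1024 n.p) ih) ns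

def nestLines (T : ℕ) (ns : List Nest) : List Line :=
  List.rec [] (fun n _ ih => forceList ih fun ls =>
    consLine T n.h n.p n.P n.Q (consLine T n.h n.p n.Q n.P ls)) ns

structure Template where
  N : ℕ
  bs : List Block
  rs : List (List Block)
  nests : List Nest
  c₁ : List Item
  c₂ : List Item
  ds : List (List Item)

def eager {α : Type} (l : List α) : List α :=
  List.rec [] (fun x _ ih => forceList ih fun l => x :: l) l

@[simp]
theorem eager_eq {α : Type} (l : List α) : eager l = l := by
  induction l with
  | nil => rfl
  | cons x l ih => simpa [eager] using ih

/-- The union of the singletons `{f a}` for `a` in the list, as a bit mask. -/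
def bitMask {α : Type} (f : α → ℕ) (l : List α) : ℕ :=
  List.rec 0 (fun a _ ih => Nat.lor (Nat.pow 2 (f a)) ih) l

theorem mem_of_bitMask {α : Type} {f : α → ℕ} {l : List α} {i : ℕ}
    (h : (bitMask f l).testBit i = true) : ∃ a ∈ l, f a = i := by
  induction l with
  | nil => simp [bitMask] at h
  | cons a l ih =>
    have h' : (2 ^ f a ||| bitMask f l).testBit i = true := h
    rw [Nat.testBit_or, Nat.testBit_two_pow] at h'
    rcases Bool.or_eq_true_iff.1 h' with h' | h'
    · exact ⟨a, by simp, of_decide_eq_true h'⟩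
    · obtain ⟨b, hb, e⟩ := ih h'
      exact ⟨b, by simp [hb], e⟩

theorem testBit_of_succ_eq {n m i : ℕ} (h : Nat.succ m = 2 ^ n) (hi : i < n) :
    m.testBit i = true := by
  rw [show m = 2 ^ n - 1 by omega, Nat.testBit_two_pow_sub_one]
  simpa using hi

namespace Template

variable (t : Template)

def cycles : List (List Item) := t.c₁ :: t.c₂ :: t.ds

def top : ℕ := pos t.bs t.N

def residueBlocks (q : ℕ) : List Block :=
  List.rec (fun _ => []) (fun b _ ih q => Nat.rec b (fun q _ => ih q) q) t.rs q

/-- The difference, after insertion of blocks, corresponding to the difference `r` before. -/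
def residue (r : ℕ) : ℕ :=
  Nat.add (Nat.mod r 4) (Nat.mul 4 (pos (t.residueBlocks (Nat.mod r 4)) (Nat.div r 4)))

def lines (T : ℕ) : List Line := addItemLines T t.c₁ (addItemLines T t.c₂ (nestLines T t.nests))

def arcs : List (Item × Item) := t.cycles.flatMap cycPairs

def items : List Item := t.c₁ ++ t.c₂ ++ t.ds.flatten

def step (u v : ℕ) : ℕ := Bool.rec (Nat.sub (Nat.add v t.N) u) (Nat.sub v u) (Nat.ble (Nat.succ u) v)

/-- The difference represented by an arc, or zero if the arc is incident with the last vertex. -/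
def arcStep (xy : Item × Item) : ℕ :=
  Bool.rec (Bool.rec (t.step xy.1.u xy.2.u) 0 (Nat.beq xy.2.u t.N)) 0 (Nat.beq xy.1.u t.N)

def checkLine (T : ℕ) (l : Line) : Bool :=
  andB (Nat.ble 1 l.p) <| andB (Nat.ble l.p 3) <| andB (Nat.ble l.h 127) <|
  andB (small l.P) <| andB (small l.Q) <|
  force (Nat.add l.P l.size) fun P' => force (Nat.add T l.h) fun T' =>
  andB (formLT P' T') <| andB (formLT (Nat.add l.Q l.size) T') <|
  force (Nat.add l.d P') fun s =>
    Bool.rec (Nat.beq s (Nat.add l.Q T')) true (Nat.beq s (Nat.add l.Q l.h))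

def checkItem (T : ℕ) (x : Item) : Bool :=
  andB (Nat.ble x.p 3) <| andB (Nat.ble x.h 127) <|
  andB (Bool.rec true (Nat.beq x.h 0) (Nat.beq x.p 0)) <| andB (small x.e) <|
  andB (Nat.beq x.inn (pos t.bs x.u)) <| Bool.rec (andB (small x.out) <| andB (small x.inn) <|
    andB (formLT x.out T) <| formLT x.inn T) true (Nat.beq x.u t.N)

def checkArc (T : ℕ) (xy : Item × Item) : Bool :=
  force (t.arcStep xy) fun r => Bool.rec (force (t.residue r) fun d => andB (small d) <|
    Nat.beq (Nat.add d xy.1.out)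
      (Bool.rec (Nat.add xy.2.inn T) xy.2.inn (Nat.ble (Nat.succ xy.1.u) xy.2.u)))
    true (Nat.beq r 0)

def checkStart (ls : List Line) (q : ℕ) (b : Block) : Bool :=
  force (Nat.mul 2 b.h) fun h => allBelow b.h fun j => force (Nat.add b.cut j) fun s =>
  andB (small s) <| force (Nat.add q (Nat.mul 4 s)) fun d =>
  anyB ls fun l => andB (Nat.beq l.d d) <| andB (Nat.beq l.p b.p) (Nat.beq l.h h)

def checkVertexStart (ls : List Line) (b : Block) : Bool :=
  allBelow b.h fun j => force (Nat.add b.cut j) fun s => andB (small s) <|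
  anyB ls fun l => andB (Bool.rec (Nat.beq l.Q s) true (Nat.beq l.P s)) <|
    andB (Nat.beq l.p b.p) (Nat.beq l.h b.h)

def checkClass (T : ℕ) (ls : List Line) (q : ℕ) : Bool :=
  forceList (t.residueBlocks q) fun rb =>
  andB (sortedIn (Nat.div (Nat.sub (Nat.add t.N 3) q) 4) rb (Bool.rec 0 1 (Nat.beq q 0))) <|
  andB (Nat.ble (width rb) 100) <| andB (Nat.beq (Nat.add (Nat.mul 4 (total rb)) t.N) T) <|
  allB (starts rb 0) (checkStart ls q)

def checkCycle (c : List Item) : Bool :=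
  andB (Nat.ble 2 c.length) <| Nat.ble c.length 63

def checkDigon (c : List Item) : Bool :=
  andB (Nat.beq c.length 2) <| allB c fun x => Nat.beq x.p 0

/-- The number of two-cycles. -/
def digons : ℕ := Nat.add t.ds.length (nestWeight t.nests)

def check : Bool :=
  andB (Nat.ble 1 t.N) <| andB (Nat.ble t.N 63) <| andB (sortedIn t.N t.bs 0) <|
  andB (Nat.ble (width t.bs) 100) <| force t.top fun T => andB (small T) <|
  forceList (t.lines T) fun ls => forceList (eager t.arcs) fun as => forceList (eager t.items) fun is =>
  andB (allB ls (checkLine T)) <| andB (allBelow 4 (t.checkClass T ls)) <|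
  andB (allB (starts t.bs 0) (checkVertexStart ls)) <|
  andB (checkCycle t.c₁) <| andB (checkCycle t.c₂) <| andB (allB t.ds checkDigon) <|
  andB (allB is (t.checkItem T)) <| andB (allB as (t.checkArc T)) <|
  andB (Nat.beq (Nat.succ (bitMask Item.u is)) (Nat.pow 2 (Nat.succ t.N))) <|
  andB (Nat.beq (Nat.succ (Nat.lor 1 (bitMask t.arcStep as))) (Nat.pow 2 t.N)) <|
  andB (Nat.ble t.nests.length 63) <| andB (Nat.ble t.ds.length 63) <|
  Nat.beq (Nat.add (Nat.add (weight t.c₁) (weight t.c₂)) (Nat.mul 2 t.digons)) (Nat.succ T)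

end Template

end Templates

noncomputable section Decoding

/-! The functions of this section evaluate their arguments eagerly, for the benefit of the kernel. -/

def consHead {α : Type} (x : α) (l : List (List α)) : List (List α) :=
  List.rec [[x]] (fun c l _ => (x :: c) :: l) l

/-- The base `65` digits of a number, the least significant one first, cut at the digits `63`. -/
def sections (k : ℕ) : ℕ → List (List ℕ) :=
  Nat.rec (fun _ => []) (fun _ ih n => Nat.rec [] (fun m _ =>
    force (Nat.mod (Nat.succ m) 65) fun d =>
      bif Nat.beq d 63 then forceList (ih (Nat.div (Nat.succ m) 65)) fun l => [] :: l
      else consHead d (ih (Nat.div (Nat.succ m) 65))) n) k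

def decodeBlocks : List ℕ → List Block
  | c :: x :: l => force (Nat.div x 4) fun h => force (Nat.mod x 4) fun p =>
      forceList (decodeBlocks l) fun bs => ⟨c, h, p⟩ :: bs
  | _ => []

def withBlock {α : Type} (bs : List Block) (i : ℕ) (f : ℕ → ℕ → ℕ → α) : α :=
  Block.rec f (bs.getD i ⟨0, 0, 0⟩)

def decodeNest (h p c c' : ℕ) (ls : List Nest) (m : ℕ) : List Nest :=
  Nat.rec ls (fun i ih => force (Nat.sub (Nat.add c h) (Nat.succ i)) fun P =>
    force (Nat.add c' i) fun Q => forceList ih fun ls => ⟨h, p, P, Q⟩ :: ls) m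

def decodeNests (st : List Block) : List ℕ → List Nest
  | l :: r :: ls => withBlock st l fun c h p => withBlock st r fun c' _ _ =>
      decodeNest h p c c' (decodeNests st ls) h
  | _ => []

def decodeItems (bs st : List Block) : List ℕ → List Item
  | 64 :: u :: i :: x :: l => withBlock st i fun c h p => force (Nat.add c (Nat.div x 2)) fun a =>
      force (Nat.sub (pos bs u) (Nat.mul (Nat.mod x 2) (Nat.mul h (Nat.pow 1024 p)))) fun e =>
        forceList (decodeItems bs st l) fun is =>
          bif Nat.beq (Nat.mod x 2) 1 then ⟨u, h, p, a, e, true⟩ :: is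
          else ⟨u, h, p, a, e, false⟩ :: is
  | u :: l => force (pos bs u) fun e => forceList (decodeItems bs st l) fun is =>
      ⟨u, 0, 0, 0, e, false⟩ :: is
  | [] => []

def pairUp {α : Type} : List α → List (List α)
  | x :: y :: l => forceList (pairUp l) fun ls => [x, y] :: ls
  | _ => []

/-- The template with a given code is passed on to `f`. -/
def withTemplate {α : Type} (n : ℕ) (f : Template → α) (z : α) : α :=
  match sections 400 n with
  | [[N], b, r₀, r₁, r₂, r₃, n, c₁, c₂, d] =>
    forceList (decodeBlocks b) fun bs => forceList (starts bs 0) fun st =>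
    forceList (decodeBlocks r₀) fun r₀ => forceList (decodeBlocks r₁) fun r₁ =>
    forceList (decodeBlocks r₂) fun r₂ => forceList (decodeBlocks r₃) fun r₃ =>
    forceList (decodeNests st n) fun ns => forceList (decodeItems bs st c₁) fun c₁ =>
    forceList (decodeItems bs st c₂) fun c₂ => forceList (pairUp (decodeItems bs st d)) fun ds =>
      f ⟨N, bs, [r₀, r₁, r₂, r₃], ns, c₁, c₂, ds⟩
  | _ => z

end Decoding

section Soundness

variable {κ : ℕ → ℕ}

/-- The arcs of the family `l` belong to the cycles in `LL`. -/
def Line.Good (κ : ℕ → ℕ) (LL : List (List ℕ)) (l : Line) : Prop :=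
  ∀ i j, i + j + 1 = κ l.p → ∃ c ∈ LL, CycNext c (ev κ l.P + l.h * i) (ev κ l.Q + l.h * j)

theorem good_consLine {LL : List (List ℕ)} {T h p P Q : ℕ} {ls : List Line}
    (h₁ : ∀ i j, i + j + 1 = κ p → ∃ c ∈ LL, CycNext c (ev κ P + h * i) (ev κ Q + h * j))
    (h₂ : ∀ l ∈ ls, l.Good κ LL) : ∀ l ∈ consLine T h p P Q ls, l.Good κ LL := by
  intro l hl
  rcases mem_consLine hl with ⟨rfl, rfl, rfl, rfl⟩ | hl
  exacts [h₁, h₂ l hl]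

theorem good_addLines {LL : List (List ℕ)} {T : ℕ} {x : Item} {c : List Item} {ls : List Line}
    (hc : c.flatMap (Item.expand κ) ∈ LL) (hx : x ∈ c) (hh : x.h ≤ 127) (he : small x.e = true)
    (hls : ∀ l ∈ ls, l.Good κ LL) : ∀ l ∈ x.addLines T ls, l.Good κ LL := by
  have hadd : ev κ (x.e + x.h) = ev κ x.e + x.h := by
    rw [ev_add (.of_small he) (digitsLE_const (by omega)) (by omega), ev_const (c := x.h) (by omega)]
  unfold Item.addLines
  rw [force_eq]
  cases Nat.beq x.p 0
  · cases hup : x.up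
    · have hex : x.expand κ = zigzag (fun j => ev κ x.a + x.h * (κ x.p - 1 - j))
          (fun j => ev κ x.e + x.h * j) (κ x.p) := by simp [Item.expand, hup]
      refine good_consLine (fun i j hij => ⟨_, hc, ?_⟩) (good_consLine (fun j i hij => ⟨_, hc, ?_⟩) hls)
      · obtain ⟨p, q, e⟩ := zigzag_up (fun j => ev κ x.a + x.h * (κ x.p - 1 - j))
          (fun j => ev κ x.e + x.h * j) (n := κ x.p) (j := i) (by omega)
        refine CycNext.flatMap_of_mem _ (p := p) (q := q) hx ?_
        rw [hex, e, show κ x.p - 1 - i = j by omega]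
      · obtain ⟨p, q, e⟩ := zigzag_down (fun j => ev κ x.a + x.h * (κ x.p - 1 - j))
          (fun j => ev κ x.e + x.h * j) (n := κ x.p) (j := i) (by omega)
        refine CycNext.flatMap_of_mem _ (p := p) (q := q) hx ?_
        rw [hex, e, show κ x.p - 1 - i = j by omega]
        change _ = p ++ (_ + x.h * j) :: (ev κ (x.e + x.h) + x.h * i) :: q
        rw [hadd, Nat.mul_add, Nat.mul_one, add_assoc, add_comm x.h]
    · have hex : x.expand κ = zigzag (fun j => ev κ x.a + x.h * j)
          (fun j => ev κ x.e + x.h * (κ x.p - j)) (κ x.p) := by simp [Item.expand, hup]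
      refine good_consLine (fun i j hij => ⟨_, hc, ?_⟩) (good_consLine (fun i j hij => ⟨_, hc, ?_⟩) hls)
      · obtain ⟨p, q, e⟩ := zigzag_up (fun j => ev κ x.a + x.h * j)
          (fun j => ev κ x.e + x.h * (κ x.p - j)) (n := κ x.p) (j := j) (by omega)
        refine CycNext.flatMap_of_mem _ (p := p) (q := q) hx ?_
        rw [hex, e, show κ x.p - j = i + 1 by omega]
        change _ = p ++ (ev κ (x.e + x.h) + x.h * i) :: _ :: q
        rw [hadd, Nat.mul_add, Nat.mul_one, add_assoc, add_comm x.h]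
      · obtain ⟨p, q, e⟩ := zigzag_down (fun j => ev κ x.a + x.h * j)
          (fun j => ev κ x.e + x.h * (κ x.p - j)) (n := κ x.p) (j := i) (by omega)
        refine CycNext.flatMap_of_mem _ (p := p) (q := q) hx ?_
        rw [hex, e, show κ x.p - (i + 1) = j by omega]
  · exact hls

theorem good_addItemLines {LL : List (List ℕ)} {T : ℕ} {c : List Item} {ls : List Line}
    (hc : c.flatMap (Item.expand κ) ∈ LL) (hx : ∀ x ∈ c, x.h ≤ 127 ∧ small x.e = true)
    (hls : ∀ l ∈ ls, l.Good κ LL) : ∀ l ∈ addItemLines T c ls, l.Good κ LL := by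
  suffices H : ∀ c' ⊆ c, ∀ l ∈ addItemLines T c' ls, l.Good κ LL from H c (List.Subset.refl c)
  intro c'
  induction c' with
  | nil => exact fun _ => hls
  | cons x c' ih =>
    intro hsub
    obtain ⟨h1, h2⟩ := List.cons_subset.1 hsub
    change ∀ l ∈ forceList (addItemLines T c' ls) (x.addLines T), _
    rw [forceList_eq]
    exact good_addLines hc h1 (hx x h1).1 (hx x h1).2 (ih h2)

/-- The two-cycles of a nest. -/
def Nest.cycles (κ : ℕ → ℕ) (n : Nest) : List (List ℕ) :=
  (List.range (κ n.p)).map fun i => [ev κ n.P + n.h * i, ev κ n.Q + n.h * (κ n.p - 1 - i)]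

theorem good_nestLines {LL : List (List ℕ)} {T : ℕ} {ns : List Nest}
    (hns : ∀ n ∈ ns, ∀ c ∈ n.cycles κ, c ∈ LL) : ∀ l ∈ nestLines T ns, l.Good κ LL := by
  induction ns with
  | nil => intro l hl; cases hl
  | cons n ns ih =>
    have e : nestLines T (n :: ns) = consLine T n.h n.p n.P n.Q
        (consLine T n.h n.p n.Q n.P (nestLines T ns)) :=
      forceList_eq (nestLines T ns) fun ls =>
        consLine T n.h n.p n.P n.Q (consLine T n.h n.p n.Q n.P ls)
    rw [e]
    have key : ∀ i j, i + j + 1 = κ n.p → [ev κ n.P + n.h * i, ev κ n.Q + n.h * j] ∈ LL := by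
      intro i j hij
      refine hns n (by simp) _ (List.mem_map.2 ⟨i, List.mem_range.2 (by omega), ?_⟩)
      rw [show κ n.p - 1 - i = j by omega]
    refine good_consLine (fun i j hij => ⟨_, key i j hij, .of_mem_cycPairs (by simp) (by simp [cycPairs])⟩)
      (good_consLine (fun i j hij => ⟨_, key j i (by omega), .of_mem_cycPairs (by simp) (by simp [cycPairs])⟩)
        (ih fun m hm => hns m (by simp [hm])))

theorem Item.weight_spec {x : Item} (h0 : κ 0 = 0) (hp : x.p ≤ 3) :
    DigitsLE 2 x.weight ∧ ev κ x.weight = (x.expand κ).length := by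
  have hl : (x.expand κ).length = 1 + 2 * κ x.p := by
    unfold Item.expand
    cases x.up <;> exact zigzag_length _ _ _
  rw [hl]
  unfold Item.weight
  by_cases h : x.p = 0
  · rw [h, h0]
    exact ⟨(digitsLE_const (c := 1) (by norm_num)).mono (by norm_num), ev_const (by norm_num)⟩
  · have hb : Nat.beq x.p 0 = false := by rw [Bool.eq_false_iff]; simpa using h
    rw [hb]
    change DigitsLE 2 (1 + 2 * 1024 ^ x.p) ∧ ev κ (1 + 2 * 1024 ^ x.p) = _
    obtain ⟨h1, h2⟩ := pow_spec (κ := κ) (h := 2) (by norm_num) hp (by omega)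
    rw [ev_add (digitsLE_const (by norm_num)) h1 (by norm_num), ev_const (by norm_num), h2]
    refine ⟨?_, rfl⟩
    clear h2 hl hb
    interval_cases hx : x.p
    · omega
    all_goals norm_num [DigitsLE]

theorem weight_spec {c : List Item} (h0 : κ 0 = 0) (hp : ∀ x ∈ c, x.p ≤ 3) (hc : c.length ≤ 63) :
    DigitsLE (2 * c.length) (weight c) ∧
      ev κ (weight c) = (c.flatMap (Item.expand κ)).length := by
  induction c with
  | nil => exact ⟨digitsLE_const (c := 0) (by norm_num), ev_const (c := 0) (by norm_num)⟩
  | cons x c ih =>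
    rw [List.length_cons] at hc
    obtain ⟨h1, h2⟩ := x.weight_spec h0 (hp x (by simp))
    obtain ⟨h3, h4⟩ := ih (fun y hy => hp y (by simp [hy])) (by omega)
    change DigitsLE _ (x.weight + weight c) ∧ ev κ (x.weight + weight c) = _
    rw [ev_add h1 h3 (by omega), h2, h4]
    exact ⟨(h1.add h3 (by omega)).mono (by simp; omega), by simp⟩

theorem nestWeight_spec {ns : List Nest} (hp : ∀ n ∈ ns, 1 ≤ n.p ∧ n.p ≤ 3) (hc : ns.length ≤ 63) :
    DigitsLE ns.length (nestWeight ns) ∧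
      ev κ (nestWeight ns) = (ns.flatMap (Nest.cycles κ)).length := by
  induction ns with
  | nil => exact ⟨digitsLE_const (c := 0) (by norm_num), ev_const (c := 0) (by norm_num)⟩
  | cons n ns ih =>
    rw [List.length_cons] at hc
    obtain ⟨h1, h2⟩ := pow_spec (κ := κ) (h := 1) (by norm_num) (hp n (by simp)).2
      (by have := (hp n (by simp)).1; omega)
    rw [one_mul] at h1 h2
    obtain ⟨h3, h4⟩ := ih (fun y hy => hp y (by simp [hy])) (by omega)
    change DigitsLE _ (1024 ^ n.p + nestWeight ns) ∧ ev κ (1024 ^ n.p + nestWeight ns) = _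
    rw [ev_add h1 h3 (by omega), h2, h4]
    exact ⟨(h1.add h3 (by omega)).mono (by simp; omega), by simp [Nest.cycles]⟩

theorem ev_four {k a : ℕ} (ha : DigitsLE k a) (hk : 4 * k < 1024) :
    DigitsLE (4 * k) (4 * a) ∧ ev κ (4 * a) = 4 * ev κ a := by
  have h2 := ha.add ha (by omega)
  have h4 := h2.add h2 (by omega)
  have e : 4 * a = a + a + (a + a) := by ring
  rw [e, ev_add h2 h2 (by omega), ev_add ha ha (by omega)]
  exact ⟨h4.mono (by omega), by ring⟩

theorem ev_zero : ev κ 0 = 0 := ev_const (by norm_num)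

/-- The vertices of an item are `inn, …, out`. -/
theorem Item.expand_ends {x : Item} (hp : x.p ≤ 3) (hh : x.h ≤ 127) (hz : x.p = 0 → x.h = 0)
    (he : small x.e = true) :
    (∃ q, x.expand κ = ev κ x.inn :: q) ∧ ∃ p, x.expand κ = p ++ [ev κ x.out] := by
  obtain ⟨h1, h2⟩ := pow_spec (κ := κ) (h := x.h) (by omega) hp hz
  have hadd : ev κ (x.e + x.size) = ev κ x.e + x.h * κ x.p := by
    change ev κ (x.e + x.h * 1024 ^ x.p) = _
    rw [ev_add (.of_small he) h1 (by omega), h2]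
  cases hup : x.up
  · have e1 : x.inn = x.e := by simp [Item.inn, hup]
    have e2 : x.out = x.e + x.size := by simp [Item.out, hup]
    rw [e1, e2, hadd]
    simp only [Item.expand, hup, cond_false]
    refine ⟨?_, zigzag_last _ (fun j => ev κ x.e + x.h * j) _⟩
    simpa using zigzag_head (fun j => ev κ x.a + x.h * (κ x.p - 1 - j))
      (fun j => ev κ x.e + x.h * j) (κ x.p)
  · have e1 : x.inn = x.e + x.size := by simp [Item.inn, hup]
    have e2 : x.out = x.e := by simp [Item.out, hup]
    rw [e1, e2, hadd]
    simp only [Item.expand, hup, cond_true]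
    refine ⟨zigzag_head _ (fun j => ev κ x.e + x.h * (κ x.p - j)) _, ?_⟩
    simpa using zigzag_last (fun j => ev κ x.a + x.h * j)
      (fun j => ev κ x.e + x.h * (κ x.p - j)) (κ x.p)

theorem Line.bounds {T : ℕ} {l : Line} (hT : small T = true)
    (h : Template.checkLine T l = true) :
    (∀ i < κ l.p, ev κ l.P + l.h * i < ev κ T ∧ ev κ l.Q + l.h * i < ev κ T) ∧
      (DigitsLE 511 l.d → ev κ l.d + ev κ l.P + l.h * κ l.p = ev κ l.Q + l.h ∨
        ev κ l.d + ev κ l.P + l.h * κ l.p = ev κ l.Q + l.h + ev κ T) ∧ l.p ≤ 3 := by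
  simp only [Template.checkLine, andB_iff, Nat.ble_eq, force_eq] at h
  obtain ⟨p1, p3, hh, hP, hQ, fP, fQ, hd⟩ := h
  obtain ⟨h1, h2⟩ := pow_spec (κ := κ) (h := l.h) (by omega) p3 (by omega)
  have hc : ev κ l.h = l.h := ev_const (by omega)
  have hT' : ev κ (T + l.h) = ev κ T + l.h := by
    rw [ev_add (.of_small hT) (digitsLE_const (by omega)) (by omega), hc]
  have hP' : ev κ (l.P + l.size) = ev κ l.P + l.h * κ l.p := by
    change ev κ (l.P + l.h * 1024 ^ l.p) = _
    rw [ev_add (.of_small hP) h1 (by omega), h2]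
  have hQ' : ev κ (l.Q + l.size) = ev κ l.Q + l.h * κ l.p := by
    change ev κ (l.Q + l.h * 1024 ^ l.p) = _
    rw [ev_add (.of_small hQ) h1 (by omega), h2]
  have fP' := ev_lt (κ := κ) fP
  have fQ' := ev_lt (κ := κ) fQ
  change ev κ (l.P + l.size) < ev κ (T + l.h) at fP'
  change ev κ (l.Q + l.size) < ev κ (T + l.h) at fQ'
  rw [hP', hT'] at fP'
  rw [hQ', hT'] at fQ'
  refine ⟨fun i hi => ?_, fun hs => ?_, p3⟩
  · have := Nat.mul_le_mul_left l.h hi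
    rw [Nat.mul_succ] at this
    omega
  · have hPd : DigitsLE 254 (l.P + l.size) :=
      ((DigitsLE.of_small hP).add h1 (by omega)).mono (by omega)
    have e1 : ev κ (l.d + (l.P + l.size)) = ev κ l.d + ev κ l.P + l.h * κ l.p := by
      rw [ev_add hs hPd (by norm_num), hP']; ring
    have hd' : l.d + (l.P + l.size) = l.Q + l.h ∨ l.d + (l.P + l.size) = l.Q + (T + l.h) := by
      cases hb : Nat.beq (Nat.add l.d (Nat.add l.P l.size)) (Nat.add l.Q l.h) with
      | true => exact Or.inl (Nat.eq_of_beq_eq_true hb)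
      | false =>
        rw [hb] at hd
        exact Or.inr (Nat.eq_of_beq_eq_true hd)
    rw [← e1]
    rcases hd' with e | e <;> rw [e]
    · rw [ev_add (.of_small hQ) (digitsLE_const (by omega)) (by omega), hc]; exact Or.inl rfl
    · rw [ev_add (j := 254) (.of_small hQ) (((DigitsLE.of_small hT).add (digitsLE_const (c := l.h)
        (by omega)) (by omega)).mono (by omega)) (by omega), hT']
      right; ring

namespace Template

/-- The cycles obtained from a template. -/
def cycleList (κ : ℕ → ℕ) (t : Template) : List (List ℕ) :=
  t.cycles.map (fun c => c.flatMap (Item.expand κ)) ++ t.nests.flatMap (Nest.cycles κ)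

theorem good_lines {t : Template} {T : ℕ} (hi : ∀ x ∈ t.items, t.checkItem T x = true) :
    ∀ l ∈ t.lines T, l.Good κ (t.cycleList κ) := by
  have key : ∀ x ∈ t.items, x.h ≤ 127 ∧ small x.e = true := by
    intro x hx
    have := hi x hx
    simp only [checkItem, andB_iff, Nat.ble_eq] at this
    exact ⟨this.2.1, this.2.2.2.1⟩
  refine good_addItemLines ?_ (fun x hx => key x (by simp [items, hx]))
    (good_addItemLines ?_ (fun x hx => key x (by simp [items, hx])) (good_nestLines ?_))
  · simp [cycleList, cycles]
  · simp [cycleList, cycles]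
  · intro n hn c hc
    exact List.mem_append_right _ (List.mem_flatMap.2 ⟨n, hn, hc⟩)

end Template

namespace Template

theorem mem_items {t : Template} {x : Item} : x ∈ t.items ↔ ∃ c ∈ t.cycles, x ∈ c := by
  simp [items, cycles]

theorem expand_mem {t : Template} {c : List Item} (hc : c ∈ t.cycles) :
    c.flatMap (Item.expand κ) ∈ t.cycleList κ :=
  List.mem_append_left _ (List.mem_map.2 ⟨c, hc, rfl⟩)

theorem checkItem_spec {t : Template} {T : ℕ} {x : Item} (h : t.checkItem T x = true) :
    x.p ≤ 3 ∧ small x.e = true ∧ x.inn = pos t.bs x.u ∧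
      ((∃ q, x.expand κ = ev κ x.inn :: q) ∧ ∃ p, x.expand κ = p ++ [ev κ x.out]) ∧
      (x.u ≠ t.N → small x.out = true ∧ small x.inn = true ∧ ev κ x.out < ev κ T ∧
        ev κ x.inn < ev κ T) := by
  simp only [checkItem, andB_iff, Nat.ble_eq] at h
  obtain ⟨h1, h2, h3, h4, h5, h6⟩ := h
  refine ⟨h1, h4, Nat.eq_of_beq_eq_true h5, Item.expand_ends h1 h2 (fun h0 => ?_) h4, fun hu => ?_⟩
  · rw [h0] at h3
    exact Nat.eq_of_beq_eq_true h3
  · have : Nat.beq x.u t.N = false := by rw [Bool.eq_false_iff]; simpa using hu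
    rw [this] at h6
    simp only [andB_iff] at h6
    exact ⟨h6.1, h6.2.1, ev_lt h6.2.2.1, ev_lt h6.2.2.2⟩

theorem arcStep_spec {t : Template} {xy : Item × Item} {r : ℕ} (h : t.arcStep xy = r) (hr : 0 < r) :
    xy.1.u ≠ t.N ∧ xy.2.u ≠ t.N := by
  refine ⟨fun e => ?_, fun e => ?_⟩
  · simp [arcStep, e] at h; omega
  · unfold arcStep at h
    rw [e] at h
    simp only [Nat.beq_refl] at h
    revert h
    cases Nat.beq xy.1.u t.N <;> intro h <;> simp at h <;> omega

theorem checkArc_spec {t : Template} {T : ℕ} {xy : Item × Item} (hT : small T = true)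
    (h : t.checkArc T xy = true) (hr : 0 < t.arcStep xy) (h1 : small xy.1.out = true)
    (h2 : small xy.2.inn = true) :
    ev κ xy.2.inn = ev κ xy.1.out + ev κ (t.residue (t.arcStep xy)) ∨
      ev κ xy.2.inn + ev κ T = ev κ xy.1.out + ev κ (t.residue (t.arcStep xy)) := by
  have hb : Nat.beq (t.arcStep xy) 0 = false := by rw [Bool.eq_false_iff]; simp; omega
  simp only [checkArc, force_eq, hb, andB_iff] at h
  obtain ⟨h3, h4⟩ := h
  have h4 := Nat.eq_of_beq_eq_true h4
  have e : ev κ xy.1.out + ev κ (t.residue (t.arcStep xy)) =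
      ev κ (t.residue (t.arcStep xy) + xy.1.out) := by
    rw [ev_add (.of_small h3) (.of_small h1) (by norm_num), add_comm]
  rw [e]
  change t.residue (t.arcStep xy) + xy.1.out = _ at h4
  rw [h4]
  cases Nat.ble (Nat.succ xy.1.u) xy.2.u
  · right
    exact (ev_add (.of_small h2) (.of_small hT) (by norm_num)).symm
  · left; rfl

theorem exists_mem {t : Template} (hN : t.N ≤ 63)
    (hs : sortedIn t.N t.bs 0 = true) (hw : width t.bs ≤ 100)
    (hi : ∀ x ∈ t.items, t.checkItem t.top x = true)
    (hv : ∀ b ∈ starts t.bs 0, checkVertexStart (t.lines t.top) b = true)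
    (hm : ∀ u ≤ t.N, ∃ x ∈ t.items, x.u = u) {X : ℕ} (hX : X ≤ ev κ t.top) :
    ∃ c ∈ t.cycleList κ, X ∈ c := by
  have item : ∀ u ≤ t.N, ∃ c ∈ t.cycleList κ, ev κ (pos t.bs u) ∈ c := by
    intro u hu
    obtain ⟨x, hx, rfl⟩ := hm u hu
    obtain ⟨c, hc, hxc⟩ := mem_items.1 hx
    obtain ⟨-, -, h1, ⟨⟨q, h2⟩, -⟩, -⟩ := checkItem_spec (κ := κ) (hi x hx)
    refine ⟨_, expand_mem hc, List.mem_flatMap.2 ⟨x, hxc, ?_⟩⟩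
    rw [h2, h1]
    exact List.mem_cons_self
  rcases hX.eq_or_lt with rfl | hX
  · exact item t.N le_rfl
  have htop : ev κ t.top = t.N + ev κ (total t.bs) := by
    rw [top, pos_top hs, ev_add (digitsLE_const (by omega)) (total_spec hs (by omega)) (by omega),
      ev_const (by omega)]
  rcases exists_of_lt (κ := κ) (a := 0) (acc := 0) (X := X) hs (digitsLE_const (by norm_num))
    (by omega) (by simp [ev_zero]) (by rw [ev_zero]; omega) with
    ⟨r, -, hr, e⟩ | ⟨b, hb, hd, hh, hok, i, hi', j, hj, e⟩
  · rw [e, ev_zero, Nat.zero_add]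
    exact item r hr.le
  · have h := forall_of_allBelow (hv b hb) j hj
    simp only [force_eq, andB_iff] at h
    obtain ⟨l, hl1, h⟩ := exists_of_anyB h.2
    simp only [andB_iff] at h
    obtain ⟨h1, h2, h3⟩ := h
    have h2 := Nat.eq_of_beq_eq_true h2
    have h3 := Nat.eq_of_beq_eq_true h3
    rw [← h2] at hi'
    have es : ev κ (b.cut + j) = ev κ b.cut + j := by
      rw [ev_add hd (digitsLE_const (c := j) (by omega)) (by omega), ev_const (c := j) (by omega)]
    rw [show X = ev κ (b.cut + j) + l.h * i by rw [es, h3, e]; ring]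
    have hg := good_lines (κ := κ) hi l hl1
    obtain ⟨c, hc, h⟩ := hg i (κ l.p - 1 - i) (by omega)
    obtain ⟨c', hc', h'⟩ := hg (κ l.p - 1 - i) i (by omega)
    cases hP : Nat.beq l.P (Nat.add b.cut j) with
    | true =>
      refine ⟨c, hc, ?_⟩
      rw [show b.cut + j = l.P from (Nat.eq_of_beq_eq_true hP).symm]
      exact h.mem_left
    | false =>
      rw [hP] at h1
      refine ⟨c', hc', ?_⟩
      rw [show b.cut + j = l.Q from (Nat.eq_of_beq_eq_true h1).symm]
      exact h'.mem_right

theorem exists_arc {t : Template} (hT : small t.top = true) (hN : t.N ≤ 63) (hN0 : 1 ≤ t.N)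
    (hi : ∀ x ∈ t.items, t.checkItem t.top x = true)
    (hl : ∀ l ∈ t.lines t.top, checkLine t.top l = true)
    (hc : ∀ q < 4, t.checkClass t.top (t.lines t.top) q = true)
    (ha : ∀ xy ∈ t.arcs, t.checkArc t.top xy = true)
    (hcyc : ∀ c ∈ t.cycles, 2 ≤ c.length)
    (hm : ∀ r, 0 < r → r < t.N → ∃ xy ∈ t.arcs, t.arcStep xy = r) {X : ℕ} (h0 : 0 < X)
    (hX : X < ev κ t.top) : ∃ l ∈ t.cycleList κ, ∃ a b, CycNext l a b ∧ a < ev κ t.top ∧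
      b < ev κ t.top ∧ (b = a + X ∨ b + ev κ t.top = a + X) := by
  obtain ⟨q, hq, Y, rfl⟩ : ∃ q < 4, ∃ Y, X = q + 4 * Y :=
    ⟨X % 4, Nat.mod_lt _ (by norm_num), X / 4, (Nat.mod_add_div X 4).symm⟩
  have h := hc q hq
  simp only [checkClass, forceList_eq, andB_iff, Nat.ble_eq] at h
  obtain ⟨hs, hw, ht, hst⟩ := h
  set rb := t.residueBlocks q
  have ht : 4 * total rb + t.N = t.top := Nat.eq_of_beq_eq_true ht
  change sortedIn ((t.N + 3 - q) / 4) rb _ = true at hs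
  have ht4 := ev_four (κ := κ) (total_spec hs (by omega)) (by omega)
  have htop : ev κ t.top = 4 * ev κ (total rb) + t.N := by
    rw [← ht, ev_add ht4.1 (digitsLE_const (c := t.N) (by omega)) (by omega), ht4.2,
      ev_const (c := t.N) (by omega)]
  have hlo : (Bool.rec 0 1 (Nat.beq q 0) : ℕ) ≤ Y := by
    cases hq0 : Nat.beq q 0
    · exact Nat.zero_le _
    · have := Nat.eq_of_beq_eq_true hq0
      change 1 ≤ Y
      omega
  rcases exists_of_lt (κ := κ) (a := 0) (acc := 0) (X := Y) hs (digitsLE_const (by norm_num))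
    (by omega) (by rw [ev_zero]; exact hlo) (by rw [ev_zero]; omega) with
    ⟨r, hr0, hr, e⟩ | ⟨b, hb, hd, hh, hok, i, hi', j, hj, e⟩
  · rw [ev_zero, Nat.zero_add] at e
    have hpos : 0 < q + 4 * r := by
      rcases Nat.eq_zero_or_pos q with rfl | hq0
      · change 1 ≤ r at hr0; omega
      · omega
    obtain ⟨⟨x, y⟩, hxy, hr'⟩ := hm (q + 4 * r) hpos (by omega)
    obtain ⟨c, hcc, hxyc⟩ := List.mem_flatMap.1 hxy
    have hnext := CycNext.of_mem_cycPairs (hcyc c hcc) hxyc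
    have hx := checkItem_spec (κ := κ) (hi x (mem_items.2 ⟨c, hcc, hnext.mem_left⟩))
    have hy := checkItem_spec (κ := κ) (hi y (mem_items.2 ⟨c, hcc, hnext.mem_right⟩))
    obtain ⟨hu, hv⟩ := arcStep_spec hr' hpos
    obtain ⟨p, hp⟩ := hx.2.2.2.1.2
    obtain ⟨s, hs'⟩ := hy.2.2.2.1.1
    have hxo := hx.2.2.2.2 hu
    have hyo := hy.2.2.2.2 hv
    have harc := checkArc_spec (κ := κ) hT (ha _ hxy) (by rw [hr']; exact hpos) hxo.1 hyo.2.1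
    have hres : ev κ (t.residue (t.arcStep (x, y))) = q + 4 * Y := by
      have e1 : t.residue (q + 4 * r) = q + 4 * pos rb r := by
        change (q + 4 * r) % 4 + 4 * pos (t.residueBlocks ((q + 4 * r) % 4)) ((q + 4 * r) / 4) = _
        rw [show (q + 4 * r) % 4 = q by omega, show (q + 4 * r) / 4 = r by omega]
      have h4 := ev_four (κ := κ) (pos_spec hs (u := r) (by omega)) (by omega)
      rw [hr', e1, ev_add (digitsLE_const (c := q) (by omega)) h4.1 (by omega), h4.2,
        ev_const (c := q) (by omega), e]
    rw [hres] at harc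
    exact ⟨_, expand_mem hcc, _, _, hnext.flatMap _ hp hs', hxo.2.2.1, hyo.2.2.2, harc⟩
  · have h := forall_of_allB hst b hb
    simp only [checkStart, force_eq] at h
    have h := forall_of_allBelow h j hj
    simp only [andB_iff] at h
    obtain ⟨hsm, h⟩ := h
    obtain ⟨l, hl1, h⟩ := exists_of_anyB h
    simp only [andB_iff] at h
    obtain ⟨h1, h2, h3⟩ := h
    have h1 := Nat.eq_of_beq_eq_true h1
    have h2 := Nat.eq_of_beq_eq_true h2
    have h3 := Nat.eq_of_beq_eq_true h3
    change l.d = q + 4 * (b.cut + j) at h1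
    change l.h = 2 * b.h at h3
    change small (b.cut + j) = true at hsm
    rw [← h2] at hi'
    obtain ⟨hlt, hd', -⟩ := Line.bounds (κ := κ) hT (hl l hl1)
    have h4 := ev_four (κ := κ) (.of_small hsm) (by norm_num)
    have hq' := digitsLE_const (c := q) (by omega)
    have hev : ev κ l.d = q + 4 * (ev κ b.cut + j) := by
      rw [h1, ev_add hq' h4.1 (by omega), h4.2, ev_const (c := q) (by omega),
        ev_add hd (digitsLE_const (c := j) (by omega)) (by omega), ev_const (c := j) (by omega)]
    have hd' := hd' (by rw [h1]; exact (hq'.add h4.1 (by omega)).mono (by omega))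
    obtain ⟨c, hc, hn⟩ := good_lines (κ := κ) hi l hl1 (κ l.p - 1 - i) i (by omega)
    refine ⟨c, hc, _, _, hn, (hlt _ (by omega)).1, (hlt i hi').2, ?_⟩
    obtain ⟨n, hn⟩ : ∃ n, κ l.p = n + i + 1 := ⟨κ l.p - 1 - i, by omega⟩
    have hsub : κ l.p - 1 - i = n := by omega
    rw [hsub, e]
    rw [hn, hev, h3] at hd'
    rw [h3]
    refine hd'.imp (fun h => ?_) fun h => ?_ <;> linarith

end Template

theorem exists_mem_consLine (T h p P Q : ℕ) (ls : List Line) :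
    (∃ l ∈ consLine T h p P Q ls, l.p = p) ∧ ls ⊆ consLine T h p P Q ls := by
  simp only [consLine, force_eq]
  generalize andB _ _ = b
  cases b <;> exact ⟨⟨_, List.mem_cons_self, rfl⟩, List.subset_cons_self _ _⟩

theorem subset_addLines (T : ℕ) (x : Item) (ls : List Line) : ls ⊆ x.addLines T ls := by
  unfold Item.addLines
  rw [force_eq]
  cases Nat.beq x.p 0
  · cases x.up <;>
      exact List.Subset.trans (exists_mem_consLine _ _ _ _ _ _).2
        (exists_mem_consLine _ _ _ _ _ _).2
  · exact List.Subset.refl _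

theorem subset_addItemLines (T : ℕ) (c : List Item) (ls : List Line) :
    ls ⊆ addItemLines T c ls := by
  induction c with
  | nil => exact List.Subset.refl _
  | cons x c ih =>
    change ls ⊆ forceList (addItemLines T c ls) (x.addLines T)
    rw [forceList_eq]
    exact List.Subset.trans ih (subset_addLines T x _)

theorem exists_mem_nestLines (T : ℕ) {ns : List Nest} {n : Nest} (hn : n ∈ ns) :
    ∃ l ∈ nestLines T ns, l.p = n.p := by
  induction ns with
  | nil => cases hn
  | cons m ns ih =>
    have e : nestLines T (m :: ns) = consLine T m.h m.p m.P m.Q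
        (consLine T m.h m.p m.Q m.P (nestLines T ns)) :=
      forceList_eq (nestLines T ns) fun ls =>
        consLine T m.h m.p m.P m.Q (consLine T m.h m.p m.Q m.P ls)
    rw [e]
    obtain ⟨h1, h2⟩ := exists_mem_consLine T m.h m.p m.P m.Q
      (consLine T m.h m.p m.Q m.P (nestLines T ns))
    rcases List.mem_cons.1 hn with rfl | hn
    · exact h1
    · obtain ⟨l, hl, e⟩ := ih hn
      exact ⟨l, h2 ((exists_mem_consLine T m.h m.p m.Q m.P _).2 hl), e⟩

theorem length_le_length_flatMap_expand (c : List Item) :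
    c.length ≤ (c.flatMap (Item.expand κ)).length := by
  induction c with
  | nil => simp
  | cons x c ih =>
    have : (x.expand κ).length = 1 + 2 * κ x.p := by
      unfold Item.expand
      cases x.up <;> exact zigzag_length _ _ _
    rw [List.flatMap_cons, List.length_append, List.length_cons]
    omega

theorem length_flatMap_expand (h0 : κ 0 = 0) {c : List Item} (hc : ∀ x ∈ c, x.p = 0) :
    (c.flatMap (Item.expand κ)).length = c.length := by
  induction c with
  | nil => simp
  | cons x c ih =>
    have : (x.expand κ).length = 1 + 2 * κ x.p := by
      unfold Item.expand
      cases x.up <;> exact zigzag_length _ _ _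
    rw [List.flatMap_cons, List.length_append, List.length_cons, ih fun y hy => hc y (by simp [hy]),
      this, hc x (by simp), h0]
    omega

theorem HasOPSolution.of_check {t : Template} (h0 : κ 0 = 0) (h : t.check = true) :
    HasOPSolution ([ev κ (weight t.c₁), ev κ (weight t.c₂)] ++
      List.replicate (ev κ t.digons) 2) := by
  simp only [Template.check, andB_iff, force_eq, forceList_eq, eager_eq, Nat.ble_eq] at h
  obtain ⟨hN0, hN, hs, hw, hT, hl, hc, hv, hc₁, hc₂, hd, hi, ha, hmu, hmr, hn63, hd63, hsum⟩ := h
  have hl := forall_of_allB hl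
  have hi := forall_of_allB hi
  simp only [Template.checkCycle, andB_iff, Nat.ble_eq] at hc₁ hc₂
  have hd : ∀ c ∈ t.ds, c.length = 2 ∧ ∀ x ∈ c, x.p = 0 := by
    intro c hc
    have := forall_of_allB hd c hc
    simp only [Template.checkDigon, andB_iff] at this
    exact ⟨Nat.eq_of_beq_eq_true this.1, fun x hx =>
      Nat.eq_of_beq_eq_true (forall_of_allB this.2 x hx)⟩
  have hp : ∀ c ∈ t.cycles, ∀ x ∈ c, x.p ≤ 3 := fun c hc x hx =>
    (Template.checkItem_spec (κ := κ) (hi x (Template.mem_items.2 ⟨c, hc, hx⟩))).1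
  have hnp : ∀ n ∈ t.nests, 1 ≤ n.p ∧ n.p ≤ 3 := by
    intro n hn
    obtain ⟨l, hl1, e⟩ := exists_mem_nestLines t.top hn
    have := hl l (subset_addItemLines _ _ _ (subset_addItemLines _ _ _ hl1))
    simp only [Template.checkLine, andB_iff, Nat.ble_eq] at this
    rw [← e]
    exact ⟨this.1, this.2.1⟩
  obtain ⟨w1, w1'⟩ := weight_spec h0 (hp t.c₁ (by simp [Template.cycles])) hc₁.2
  obtain ⟨w2, w2'⟩ := weight_spec h0 (hp t.c₂ (by simp [Template.cycles])) hc₂.2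
  obtain ⟨w3, w3'⟩ := nestWeight_spec (κ := κ) hnp hn63
  have hdl := digitsLE_const (c := t.ds.length) (by omega)
  have hdig : ev κ t.digons = t.ds.length + (t.nests.flatMap (Nest.cycles κ)).length := by
    change ev κ (t.ds.length + nestWeight t.nests) = _
    rw [ev_add hdl w3 (by omega), ev_const (c := t.ds.length) (by omega), w3']
  have hddig : DigitsLE (t.ds.length + t.nests.length) t.digons := hdl.add w3 (by omega)
  have hds2 : ∀ c ∈ t.ds, (c.flatMap (Item.expand κ)).length = 2 := fun c hc => by
    rw [length_flatMap_expand h0 (hd c hc).2, (hd c hc).1]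
  have hns2 : ∀ c ∈ t.nests.flatMap (Nest.cycles κ), c.length = 2 := by
    intro c hc
    obtain ⟨n, -, hc⟩ := List.mem_flatMap.1 hc
    obtain ⟨i, -, rfl⟩ := List.mem_map.1 hc
    rfl
  have hsum' : ev κ (weight t.c₁) + ev κ (weight t.c₂) + 2 * ev κ t.digons = ev κ t.top + 1 := by
    have h : weight t.c₁ + weight t.c₂ + (t.digons + t.digons) = t.top + 1 := by
      rw [← two_mul]; exact Nat.eq_of_beq_eq_true hsum
    have h := congrArg (ev κ) h
    rwa [ev_add (w1.add w2 (by omega)) (hddig.add hddig (by omega)) (by omega),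
      ev_add w1 w2 (by omega), ev_add hddig hddig (by omega), ← two_mul,
      ev_add (.of_small hT) (digitsLE_const (c := 1) (by norm_num)) (by norm_num),
      ev_const (c := 1) (by norm_num)] at h
  have hle₁ := length_le_length_flatMap_expand (κ := κ) t.c₁
  have hle₂ := length_le_length_flatMap_expand (κ := κ) t.c₂
  have hmu' : ∀ u ≤ t.N, ∃ x ∈ t.items, x.u = u := fun u hu =>
    mem_of_bitMask (testBit_of_succ_eq (Nat.eq_of_beq_eq_true hmu) (Nat.lt_succ_of_le hu))
  have hmr' : ∀ r, 0 < r → r < t.N → ∃ xy ∈ t.arcs, t.arcStep xy = r := by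
    intro r hr0 hr
    have h : (1 ||| bitMask t.arcStep t.arcs).testBit r = true :=
      testBit_of_succ_eq (Nat.eq_of_beq_eq_true hmr) hr
    rw [Nat.testBit_or, Bool.eq_false_iff.2
      (Nat.testBit_one_eq_true_iff_self_eq_zero.not.2 hr0.ne')] at h
    exact mem_of_bitMask (by simpa using h)
  refine .of_starter (N := ev κ t.top) (by omega) (t.cycleList κ) _ ?_ ?_ ?_ ?_ ?_
  · rw [w1', w2', hdig, Template.cycleList, Template.cycles]
    simp only [List.map_cons, List.map_append, List.cons_append, List.nil_append, List.map_map]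
    rw [List.replicate_add]
    congr 3
    · exact List.eq_replicate_iff.2 ⟨by simp, by simpa using hds2⟩
    · exact List.eq_replicate_iff.2 ⟨by simp, fun b hb => by
        obtain ⟨c, hc, rfl⟩ := List.mem_map.1 hb; exact hns2 c hc⟩
  · intro c hc
    rcases List.mem_append.1 hc with hc | hc
    · obtain ⟨c, hc', rfl⟩ := List.mem_map.1 hc
      simp only [Template.cycles, List.mem_cons] at hc'
      rcases hc' with rfl | rfl | hc'
      · omega
      · omega
      · exact (hds2 _ hc').ge
    · exact (hns2 c hc).ge
  · simp
    omega
  · exact fun x hx => Template.exists_mem hN hs hw hi (forall_of_allB hv) hmu' hx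
  · intro X hX0 hX
    refine Template.exists_arc hT hN hN0 hi hl (forall_of_allBelow hc) (forall_of_allB ha) ?_ hmr'
      hX0 hX
    intro c hc
    simp only [Template.cycles, List.mem_cons] at hc
    rcases hc with rfl | rfl | hc
    · exact hc₁.1
    · exact hc₂.1
    · exact (hd c hc).1.ge

end Soundness

noncomputable section Families

/-- The code of a template, together with the arithmetic progressions of parameters
`p + sp * i`, `k + sk * i`, `u + su * i` for which it yields a solution. -/
structure Entry where
  code : ℕ
  p : ℕ
  k : ℕ
  u : ℕ
  sp : ℕ
  sk : ℕ
  su : ℕ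

/-- The packed form `a + b κ₁ + c κ₂ + d κ₃`, provided that the coefficients are small. -/
def isForm (n a b c d : ℕ) : Bool :=
  andB (Nat.ble a 1023) <| andB (Nat.ble b 1023) <| andB (Nat.ble c 1023) <|
  Nat.beq n (Nat.add a (Nat.mul 1024 (Nat.add b (Nat.mul 1024 (Nat.add c (Nat.mul 1024 d))))))

theorem ev_of_isForm {κ : ℕ → ℕ} {n a b c d : ℕ} (h : isForm n a b c d = true) :
    ev κ n = a + b * κ 1 + c * κ 2 + d * κ 3 := by
  simp only [isForm, andB_iff, Nat.ble_eq] at h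
  obtain ⟨ha, hb, hc, h⟩ := h
  obtain ⟨h0, h1, h2, h3⟩ := digits_eq (Nat.eq_of_beq_eq_true h) (by omega) (by omega) (by omega)
  rw [ev, h0, h1, h2, h3]

/-- Whether an entry is valid, for cycle lengths `2 * p + d` and `2 * (p + k + u) + e` and
`k + f` two-cycles. -/
def Entry.valid (d e f : ℕ) (x : Entry) : Bool :=
  withTemplate x.code (fun t => andB t.check <|
    andB (isForm (weight t.c₁) (Nat.add (Nat.mul 2 x.p) d) 0 (Nat.mul 2 x.sp) 0) <|
    andB (isForm (weight t.c₂) (Nat.add (Nat.mul 2 (Nat.add (Nat.add x.p x.k) x.u)) e)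
      (Nat.mul 2 x.sk) (Nat.mul 2 x.sp) (Nat.mul 2 x.su)) <|
    isForm t.digons (Nat.add x.k f) x.sk 0 0) false

theorem exists_of_withTemplate {n : ℕ} {f : Template → Bool} (h : withTemplate n f false = true) :
    ∃ t, f t = true := by
  unfold withTemplate at h
  split at h
  · simp only [forceList_eq] at h
    exact ⟨_, h⟩
  · cases h

theorem Entry.hasOPSolution {d e f : ℕ} {x : Entry} (h : x.valid d e f = true) (i j l : ℕ) :
    HasOPSolution ([2 * (x.p + x.sp * i) + d,
      2 * (x.p + x.sp * i + (x.k + x.sk * j) + (x.u + x.su * l)) + e] ++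
      List.replicate (x.k + x.sk * j + f) 2) := by
  obtain ⟨t, h⟩ := exists_of_withTemplate h
  simp only [andB_iff] at h
  obtain ⟨h, h1, h2, h3⟩ := h
  have := HasOPSolution.of_check (κ := fun n => [0, j, i, l].getD n 0) rfl h
  rw [ev_of_isForm h1, ev_of_isForm h2, ev_of_isForm h3] at this
  convert this using 3
  · change _ = 2 * x.p + d + 0 * j + 2 * x.sp * i + 0 * l; ring
  · congr 1
    change _ = 2 * (x.p + x.k + x.u) + e + 2 * x.sk * j + 2 * x.sp * i + 2 * x.su * l; ring
  · change _ = x.k + f + x.sk * j + 0 * i + 0 * l; ring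

/-- Whether `x₀ + s * i` can be any number which is reduced to `x` by subtracting
multiples of `m` as long as the result is at least `X - m`. -/
def axis (X m x₀ s x : ℕ) : Bool :=
  andB (Nat.ble x₀ x) <| Bool.rec
    (andB (Nat.beq (Nat.mod (Nat.sub x x₀) s) 0) (Nat.beq (Nat.mod m s) 0))
    (andB (Nat.beq x x₀) (Nat.ble (Nat.add (Nat.succ x) m) X)) (Nat.beq s 0)

def reduce (X m x : ℕ) : ℕ := if x < X then x else X - m + (x - X) % m

theorem reduce_lt {X m x : ℕ} (hm : 0 < m) (hX : m ≤ X) : reduce X m x < X := by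
  have := Nat.mod_lt (x - X) hm
  unfold reduce
  split <;> omega

theorem exists_of_axis {X m x₀ s x : ℕ} (hm : 0 < m) (hX : m ≤ X)
    (h : axis X m x₀ s (reduce X m x) = true) : ∃ i, x = x₀ + s * i := by
  simp only [axis, andB_iff, Nat.ble_eq] at h
  obtain ⟨h1, h⟩ := h
  cases hs : Nat.beq s 0
  · rw [hs] at h
    obtain ⟨h2, h3⟩ := andB_iff.1 h
    have h2 : (reduce X m x - x₀) % s = 0 := Nat.eq_of_beq_eq_true h2
    have h3 : s ∣ m := Nat.dvd_of_mod_eq_zero (Nat.eq_of_beq_eq_true h3)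
    have h4 : ∃ j, x = reduce X m x + m * j := by
      unfold reduce
      split
      · exact ⟨0, by simp⟩
      · have := Nat.mod_add_div (x - X) m
        exact ⟨(x - X) / m + 1, by rw [Nat.mul_add]; omega⟩
    obtain ⟨j, hj⟩ := h4
    obtain ⟨c, hc⟩ := Nat.dvd_of_mod_eq_zero h2
    obtain ⟨c', rfl⟩ := h3
    refine ⟨c + c' * j, ?_⟩
    rw [Nat.mul_add, ← hc, ← Nat.mul_assoc]
    omega
  · rw [hs] at h
    obtain ⟨h2, h3⟩ := andB_iff.1 h
    have h2 := Nat.eq_of_beq_eq_true h2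
    have h3 : reduce X m x + 1 + m ≤ X := Nat.le_of_ble_eq_true h3
    refine ⟨0, ?_⟩
    rw [Nat.mul_zero, Nat.add_zero, ← h2]
    unfold reduce at h3 ⊢
    split
    · rfl
    · rw [if_neg (by assumption)] at h3
      omega

def filterB {α : Type} (f : α → Bool) (l : List α) : List α :=
  List.rec [] (fun x _ ih => forceList ih fun l => Bool.rec l (x :: l) (f x)) l

theorem mem_filterB {α : Type} {f : α → Bool} {l : List α} {x : α} (h : x ∈ filterB f l) :
    x ∈ l ∧ f x = true := by
  induction l with
  | nil => cases h
  | cons y l ih =>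
    have e : filterB f (y :: l) = Bool.rec (filterB f l) (y :: filterB f l) (f y) :=
      forceList_eq (filterB f l) fun l =>
        Bool.rec (motive := fun _ => List α) l (y :: l) (f y)
    rw [e] at h
    cases hy : f y with
    | false =>
      rw [hy] at h
      exact ⟨List.mem_cons_of_mem _ (ih h).1, (ih h).2⟩
    | true =>
      rw [hy] at h
      rcases List.mem_cons.1 h with rfl | h
      · exact ⟨List.mem_cons_self, hy⟩
      · exact ⟨List.mem_cons_of_mem _ (ih h).1, (ih h).2⟩

/-- Whether the entries cover all parameters `p ≥ a`, `k ≥ b`, `u ≥ 0`. -/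
def covers (a b : ℕ) (L : List Entry) : Bool :=
  allBelow 14 fun p => Bool.rec true
    (forceList (filterB (fun x => axis 14 2 x.p x.sp p) L) fun L => allBelow 16 fun k => Bool.rec true
      (forceList (filterB (fun x => axis 16 4 x.k x.sk k) L) fun L => allBelow 20 fun u =>
        anyB L fun x => axis 20 4 x.u x.su u) (Nat.ble b k)) (Nat.ble a p)

theorem hasOPSolution_of_covers {a b d e f p k u : ℕ} {L : List Entry} (ha : a ≤ 12) (hb : b ≤ 12)
    (hL : allB L (Entry.valid d e f) = true) (hc : covers a b L = true) (hp : a ≤ p) (hk : b ≤ k) :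
    HasOPSolution ([2 * p + d, 2 * (p + k + u) + e] ++ List.replicate (k + f) 2) := by
  have hp' : a ≤ reduce 14 2 p := by unfold reduce; split <;> omega
  have hk' : b ≤ reduce 16 4 k := by unfold reduce; split <;> omega
  have h := forall_of_allBelow hc (reduce 14 2 p) (reduce_lt (by norm_num) (by norm_num))
  simp only [forceList_eq, Nat.ble_eq_true_of_le hp'] at h
  have h := forall_of_allBelow h (reduce 16 4 k) (reduce_lt (by norm_num) (by norm_num))
  simp only [Nat.ble_eq_true_of_le hk'] at h
  have h := forall_of_allBelow h (reduce 20 4 u) (reduce_lt (by norm_num) (by norm_num))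
  obtain ⟨x, hx, h3⟩ := exists_of_anyB h
  obtain ⟨hx₂, h2⟩ := mem_filterB hx
  obtain ⟨hx₁, h1⟩ := mem_filterB hx₂
  obtain ⟨i, rfl⟩ := exists_of_axis (by norm_num) (by norm_num) h1
  obtain ⟨j, rfl⟩ := exists_of_axis (by norm_num) (by norm_num) h2
  obtain ⟨l, rfl⟩ := exists_of_axis (by norm_num) (by norm_num) h3
  exact Entry.hasOPSolution (forall_of_allB hL x hx₁) i j l

end Families

/-- Entries for two even cycles. -/
def evenEvenEntries : List Entry := [
  ⟨4987061183072718832763199586347153680303990336242349051124221646343124022765442587281970183640350581, 2, 0, 0, 0, 2, 0⟩,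
  ⟨21080122658586106414194465279274041467829663406796952346477061998554991650720397272193598337155950192158, 2, 0, 1, 0, 2, 0⟩,
  ⟨89107879134950654326626502526772401142742150439982923402034515299130028550275796323199827206043343487687935, 2, 0, 2, 0, 2, 0⟩,
  ⟨89109952133242410314535778432955578594389155930841053175024681475015342162043326950748521816639046612687935, 2, 1, 0, 0, 2, 0⟩,
  ⟨89107545833184310126309207098491542293807239270784699476388165396016440708835530026932317745594124737687935, 3, 0, 0, 0, 2, 0⟩,
  ⟨376668213502725890462195860522953596387707424434737040787243753823657960310551958956383189445290751380250654512, 2, 0, 3, 0, 2, 0⟩,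
  ⟨376567162196719734344464784571311231476382919062087790096215825940061677742097282755151411777291483802125654512, 2, 1, 1, 0, 2, 0⟩,
  ⟨376656942224535256462861552563023850803119334338586350419251992003170151868273246709741672759804911536500654512, 3, 0, 1, 0, 2, 0⟩,
  ⟨1592203184009681253887053260691025150959957209991948834413960573945058679746134246560906448747408821860553855460439, 2, 0, 4, 0, 2, 0⟩,
  ⟨1592169088017465058501521000813218758234230173713745249493255160970057560903930429979449824775946572104694480460439, 2, 1, 2, 0, 2, 0⟩,
  ⟨1592161505380973669229885828568403543388452600485507960049203344695935274202002087313921579505694344321491355460439, 3, 0, 2, 0, 2, 0⟩,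
  ⟨1590603484793840741190404862304166955329171510468115512148802229172541804222023964318577179099810555258991355460439, 3, 1, 0, 0, 2, 0⟩,
  ⟨1592197205986857055815326078191269900303444096377276772894665640960509250145493579956692706691051139047685470807639, 4, 0, 0, 0, 2, 0⟩,
  ⟨93406993655009594660586288243207998373900143025597917557810023292695767835048728446459318648970773076721174256373507301019203716486874471384947107383366966332059025676502618440599283707992219791, 2, 0, 5, 2, 4, 0⟩,
  ⟨93321229401080573381623416748788326380024665927851474662375611609767901115720479834647480061689399182401417445382750378717742435145709289342886388771524725854587093140511545785875162614242219791, 2, 1, 3, 2, 4, 0⟩,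
  ⟨93406992897330565839005001119551205159778447285266140809594616151825196450166437021285886979893598013580109406067814646943510925186126185575706862819866444852377032889566156515092691911117219791, 3, 0, 3, 2, 4, 0⟩,
  ⟨93340082504416197322512753868521579973193174210716039759497495237687571051085635075868205947277972100825820225880397630805666395147577565617049535281376582630983977189596141396378865802237668691, 3, 1, 1, 2, 4, 0⟩,
  ⟨93412578344814082425073889674596082237241477573691762509870152341229550848997316067000324971851192964936448514592649383076273237175272081890275623150824479521159391408056265615232129389194608541, 4, 0, 1, 2, 4, 0⟩,
  ⟨394856954148478495848033781719499091295982442875340332062843428594547477892319696049060735318603934881438646193671263344940290661812464459918643360632647174761356723814640106087426657615963866056668, 2, 0, 6, 2, 4, 0⟩,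
  ⟨394864696112491009237198803964655604479094308525693767904034338261487358612769578534806587102343446112174818415085822854772934129790814241035369300900175535588854814471812830692033286033932616056668, 2, 1, 4, 2, 4, 0⟩,
  ⟨394848103416398006575239181868344855391156356796870731008846705386315682676824242000375876953629081148793995786727882780828576563384081271095625717179677158967533046728601591121382920010405523619168, 3, 0, 4, 2, 4, 0⟩,
  ⟨394856023685728040034327588112350518764202229440906636541157022370499399019431542584763157835616275981752496092978488472794307200327571157291312243662891654687197729566503228079505173428374273619168, 3, 1, 2, 2, 4, 0⟩,
  ⟨394851054179202159087633095904708713369592684187043634084464854965911989554698553645563186157974090658284764075232898937019799572593348574491551785048997195521634180431051072775927727305765346494468, 4, 0, 2, 2, 4, 0⟩,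
  ⟨394849965206702482526162421740079947210019750662243930546793801570682126894881313647694161702194784647117777386616630994986669860491229247739250158595515886401370548946346980630961601817484096494468, 4, 1, 0, 2, 4, 0⟩,
  ⟨394851059759457347197904842151620305492191756216272036593518715694846311198103626747385666369605638186000523182209864875893009271691229520129037836696647959884030283455417384504882042491312221494468, 5, 0, 0, 2, 4, 0⟩,
  ⟨1669068367234880088706804012758589615468592850977410411231763248387335113001081073477102538419873314944185585794908951696478593011512328988426946374537629466335977087231658152052804385087421016600313545, 2, 0, 7, 2, 4, 0⟩,
  ⟨1668248288110774516030535987257898935940661181166337257841206053942477185872537641515411613914645653586425276959760867087265104254512880396707627085796357581056883264358038650573834334275653438475313545, 2, 1, 5, 2, 4, 0⟩,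
  ⟨1669143155282843530286073198662287942627559488115189651192721849984692075130884501153908849735118754478877928642774363518306223241175016108159749145428440286428452895228037596428438578507831172850313545, 3, 0, 5, 2, 4, 0⟩,
  ⟨1669058193013426168757902471390212831344052664000694244831642647177785328799180303185941360635724285128305527438537027978146097620784751865452723249654139606800298042065623667770668421647479610350313545, 3, 1, 3, 2, 4, 0⟩,
  ⟨1669143171009781143112775862112208158832866151159403394982135488860569593634656887384487601656909806922076056468120507705988542168369480759567348115529599594472200737248858422720476542375018672850313545, 4, 0, 3, 2, 4, 0⟩,
  ⟨1668591060009357682720569136198256971713274684219649144931326366106735441209977980924658198377799812235847902547505740124199582469261164241175866867117538385975185962428003768184825335404803829100313545, 4, 1, 1, 2, 4, 0⟩,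
  ⟨1668993598068057966498418086945971012254175060263961288172163397520558734243576591102290666180142097149780404346567626461626060045460401718915667983348062903777988326913618584843024168870380000975313545, 5, 0, 1, 2, 4, 0⟩,
  ⟨7055394831206409851414366520519878884869813252605520610813265938816544388255888394476860694938564960518143946305811783967665790643315088520063166599003180476302579093586510958432414865255704996501492400422, 2, 0, 8, 2, 4, 0⟩,
  ⟨7055194739164230264882004576758402032809363476149689915194542590365836956246892317573411811095126019231119748726702215066735082053249381951955815090179582418492945072588364660789453720808378336345242400422, 2, 1, 6, 2, 4, 0⟩,
  ⟨7055078857840326935035383379269316140982211340481010100186484260409522558111854523237848155871186556914254715318724584016751740032200874262003649799322855903528197684951275101213910913229337809001492400422, 3, 0, 6, 2, 4, 0⟩,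
  ⟨7024309526750720963079249183547028043712873381166297340535038607431407021692767031764192020535942515503041572483964550033881784293566440200573079241682393131733066460045657828034096693754545328532742400422, 3, 1, 4, 2, 4, 0⟩,
  ⟨7055210608205705084063737748857062628712381823935011960897037961401451533554322523440188717761638612360224125933644213650702812492407327816421523595241413979593350069566250845839464401960722086345242400422, 4, 0, 4, 2, 4, 0⟩,
  ⟨7039950270695483938181214595003160742105302851343168528982326998500078535259602567850507846577069549103261489927971654244232615442315348770574345767634149066035555963596872339423940813303342935954617400422, 4, 1, 2, 2, 4, 0⟩,
  ⟨7055131526387250587013839442414486874724524300432001541416384606997353527213459296082396250048358923747026825330459103277585408336668251502223696894973928084774774638079899255701535677671781656657742400422, 5, 0, 2, 2, 4, 0⟩,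
  ⟨7053642449892410314603814660344677767349779856466025459129424101212044434939829165526042110100452745608896324895328510919307706401204606486204487208665662322585712095959744425074392294645658609782742400422, 5, 1, 0, 2, 4, 0⟩,
  ⟨7055236850836715075162860887525264340530822346306439279437345019246198070664882343024282796714815616853618638659703148130600135419746924669783708199967012921029448877650737656102591151813967923677017633222, 6, 0, 0, 2, 4, 0⟩,
  ⟨29821503023017509311846536889471931580837912321893432876573633283741179950829147302054357880974134130854826317422343853121991612222359706050653468827409425914192448261735752854594623245924548823226327413003099, 2, 0, 9, 2, 4, 0⟩,
  ⟨29814658612190511880267361284498902161260673485636173268690463669718058284323372409163020686033677803737960261635677424926068029797229892226870351373458535116953850943327570863704907283812598902572030538003099, 2, 1, 7, 2, 4, 0⟩,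
  ⟨29787733006869623386982808526719501340614894262570573107113844374448158679219094405246164588625083366242663470892933791785946572916864029269247011825039783043767717776456511788939836010962562281478280538003099, 2, 2, 5, 2, 4, 0⟩,
  ⟨29787731347208465725608270451226508496083767136931439494980611220488282926424326163921768773090749693726869561538636992790428552121499590491396138480497709275096267591836825037109677255779342371810311788003099, 2, 3, 3, 2, 4, 0⟩,
  ⟨29821614562002626662685439836769426424452534609413969615573579563714732433785240796344362765174326473584904814323577476837129548129283225078295898024307346543286264075883669253318815068036155421126718038003099, 3, 0, 7, 2, 4, 0⟩,
  ⟨29807316207341141055497368580607131963627324904563504125340907460329353088060854027971149800419228787428015725296431154864918518469911444934236125906969775868054433145831656535239901900917129237044686788003099, 3, 1, 5, 2, 4, 0⟩,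
  ⟨29800304165219679843576936767035818399045795004069149719879523187613677886130450487037677994319179940620195942281308260874434504312111295446380219524348272348533782729890124816240288824468688685286874288003099, 3, 2, 3, 2, 4, 0⟩,
  ⟨29822879170794208313601321257410133516071901020899364772639733064986648880481146113101403106224989801337766979881339571898150892700483594076416723946862168337431580910288129771590088641773522210140844739657299, 3, 3, 1, 2, 4, 0⟩,
  ⟨29822885959346490305588244862884779744448787904275840081843286489808591119776839575800805934948217749866378807942595812176797291698603551420348481308273520100369105311419513682569000086318314385433813489657299, 4, 2, 1, 2, 4, 0⟩,
  ⟨126070586301092040419138131293390172441203999727150639175466238346467310153861085210245422599990530820625276422396372778331000413163829752892992735229832539096567848418514582300254340446648810979895320094499453876, 2, 0, 10, 2, 4, 0⟩,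
  ⟨126068777384225099035536544193114001433634822868473667524321083665531345507721148055500066902876088625768739739799777728980587016932994276115519791521174241538255728403247605109250224125666235563330378688249453876, 2, 1, 8, 2, 4, 0⟩,
  ⟨126070331651544880006249814259525607514777353230213116763328997272418001694305378834114033145604415300335427234562328420470975606457582067458889580840929814004796766907054287167689261189756606695227351344499453876, 2, 2, 6, 2, 4, 0⟩,
  ⟨126068777308491536473635350040558666846572248493815268184812795637531469811606668404861469057379872460557619977511072911512708042329965782465536798390550966698716116807618540087510489905347739336065974391374453876, 2, 3, 4, 2, 4, 0⟩,
  ⟨126064944117967390354840068263071964779942880202689831992592677661298727228188424238338266521256047430411752295502714024978961977556377020196825462069677046573344141306802071846682673134004388925604548610124453876, 3, 0, 8, 2, 4, 0⟩,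
  ⟨125728643825014569175788280467085161200154052227132331544889513831706877799266340414643895944424043310393485045203846189753566145791210129661581265400254765306507445205938381229493978247141157266669001735124453876, 3, 1, 6, 2, 4, 0⟩,
  ⟨125697607424829178851242708453456736972494270301517724842559239555768655180138181119392195738285525067127922536964825273536073329260844233337374849238416544005278945609724153677866859873851452943854060328874453876, 3, 2, 4, 2, 4, 0⟩,
  ⟨126039803642414521962883802102225528767169367854876704277369982545829370866875017146182540284322551286601285792042637500726176816026500404276006060070290163622457831698621333241203679079982171723030203650123101976, 3, 3, 2, 2, 4, 0⟩,
  ⟨126069768661655188866069278564947555452973528354241919761668161575138072595147438703676192562360870608223086983815927477221578602810951359106942249529623878203991901064703540138975945609482656189582938025123101976, 4, 2, 2, 2, 4, 0⟩,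
  ⟨126070288637575578680819378919078703476752512371349420557812345908397921963676390185649030784649782261752249800414195057378776397237113150132183083094936829389790802470074015853538362733880708881996268103248101976, 4, 3, 0, 2, 4, 0⟩,
  ⟨126070780025913957834784764684583044905684395747230436595957329056181415555109091131755340819149850073758057273626974370104251275636526264761065193144431616217549668436889376191243350348296294876716727087623101976, 5, 2, 0, 2, 4, 0⟩,
  ⟨532896453672911058827111612363829404097678429848229071761608301794075869763536833116984195235246417333064087980150510774256934294782049960504888095120419190360056351468622331891586850946912750195604929405628208596853, 2, 0, 11, 2, 4, 0⟩,
  ⟨532879588865849860293392194914584822431501539590492827345101051538935634030002931326034594833350819837840561022139046414987630476097996864625755224342106685807705537562370762062378003651536278020483622032581333596853, 2, 1, 9, 2, 4, 0⟩,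
  ⟨532899266299470833934627609973986240798203121978381594330276696864122192696651143830976204655159374311230635066109120034417783384420079057807806705004592980845284835623586555476314129595555573295694956261096958596853, 2, 2, 7, 2, 4, 0⟩,
  ⟨531070008341008643839411131278670144158232602437723415009400681964277773451844200341424661561846140494638104943474554070901059853300791072845439228085805015695720576985390887015845306127010121535402903038440708596853, 2, 3, 5, 2, 4, 0⟩,
  ⟨532900430939013671306109315176879577913743942411288599610695183444357324592101370721312930242259332257578825273745972638332055337924055425182168037422075452188957987661251463974329977322047784518343576866565708596853, 3, 0, 9, 2, 4, 0⟩,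
  ⟨98011823868517036113073708474371189698275720777605284611638396008479370345544198790634449878911785951005705690404679941396573514629775597984639097300014591504713866647257717632804494257868356548417841206484623037470510306331193104731924915653008398992487451341483276375666956992303, 3, 1, 7, 2, 4, 4⟩,
  ⟨228473801012841118445334628085573483243655299415332113028658921486557249130202416101542782987526174988781731411275392811964700563146172863736193095877603856660412279089081431791370187509942535540363901242715950040265049394619054644770136901118166053, 3, 2, 5, 2, 4, 2⟩,
  ⟨227710496754804094017877377552906382512617338451455066223874184547812582047753901773505787063026878814079786916137129143800616357868292310674305655386519339001325054023323957039341130590364763307316690490405675767051540972132570594019404479243166053, 3, 3, 3, 2, 4, 2⟩,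
  ⟨228473801012841094761013487808317504356697058126687931586510305243640179834585796121549104767492159645514906711860046161377353529197367455215262684083926256790990978357226918357307148544731352527066428401930198837790264590110964625544062682368166053, 4, 2, 3, 2, 4, 2⟩,
  ⟨227710496754804094012271621070000523109330484429848286535958883100181122386382158195727762269849297317280848388012853625986376713112963746013930623730233375490885391572958609999911670171339723099524745721871766384738400304157621710962763854243166053, 4, 3, 1, 2, 4, 2⟩,
  ⟨228609911716146966169518318384901417944378411400161639636668464391486461236476838884945883026490220765271905827756961960300832735992275946813985990644266924894181377801687398488373300037914452638474486080267053963723221807632656159056898308400041503, 5, 2, 1, 2, 4, 2⟩,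
  ⟨2252536334634157431525365001834270358906455670441777603866286306891495825804612370140184282456731436484002548016378973645235522276682472690027943293295713307722772334990945009587569429400837533087992154581363897248172630, 2, 0, 12, 2, 4, 0⟩,
  ⟨414535379345039944836400643722960372580983835800435872586557870266949305721881936875232561731392877210400850248295941499271972401274041088967663818449687243175276295077158023477809234515740850257103216081865961885161447978687558581431644753651960878914038997382619622203557665062047930, 2, 1, 10, 2, 4, 4⟩,
  ⟨414520932866006392936659493756247493146846666716037370817903485513878372026426345217418544402876550422817864534400320922926676030323671303201587406844664021765820718711417281258895292770649426239046196250431882745994471945015489077747762172494367173657380274736085179301946336937047930, 2, 2, 8, 2, 4, 4⟩,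
  ⟨966115440679932777084029539149617793809621020699014416322785163963865402782660141655306874893352499626765119820893847132754809012833385735757886546030988799935492504349032441815294022643308393283563725799375783069989035236691935037697545771822249103855, 2, 3, 6, 2, 4, 2⟩,
  ⟨966354541163476416421469845162041376289528448060213286213829196344961715322176838586773758373045023099518440770218997293151418762132353722025714815924369066796736069037557510938117683603386763656686412136843657651782183602203212976592780306193752445705, 3, 0, 10, 2, 4, 2⟩,
  ⟨966352638831145666573117879119863336836167164596235379484232472869914162916131736288531683805099779678012135584631382576063130602516409010780248793667943098180385232527609163528809590520442296692002306204381536171895465013089187741416693880412502445705, 3, 1, 8, 2, 4, 2⟩,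
  ⟨966349338988087123404581460277889699620414516270995189189459192679202882842563070881691399519936074917008852324215614781100112493274024984406347154987334476563806607440311159796752702251450159460305008822010315232686986444211443935955755000337874103855, 3, 2, 6, 2, 4, 2⟩,
  ⟨966345738655309899442296352480950043908191579799052232762369301021379652437900575942136868003387542974436231112894801891935873022865348756031491593847787155560053345612545846401115842632032862677692131614043131642288978280309466694916478877290999103855, 3, 3, 4, 2, 4, 2⟩,
  ⟨966349338988087127277953395713826127486701483655108575588262359506880234336432964918676719653914034705304720245653511022148000661294981968623431179271859739023276161991879387138095114718708679345749312174730345695733890667539361156683901953003396023855, 4, 2, 4, 2, 4, 2⟩,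
  ⟨966115440679932777061438403407692705743368758158508411245617068221388965640221726511776624392299619012290867704511709849503438332765756413744292699395136326339046929435470835938662240614513989455645983726505805680856897512781704999667147802612771023855, 4, 3, 2, 2, 4, 2⟩,
  ⟨966349338988087027957032950644392624056874908428724611432385248447876508663516806049412361310776981478034720359654261902624048753257413864977421618759047721748181741430352110808970020310746162582131629334937201939310002987254682220679263281128396023855, 5, 2, 2, 2, 4, 2⟩,
  ⟨966345738655309899419705216739024955842969440246770203816745915367578679881645631551577108283802423670340537668235437042555271969450633713781466539340366343874703055275878942555114857581910246346723994759883276298579235432767580486994723486206521023855, 5, 3, 0, 2, 4, 2⟩,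
  ⟨966294559967681702452160047194427796758747921800053927877175838754000486434174798866015400588438166237281820667226839926237879145861357211043728194246986418428451396406470749446349789566985681086497211544734059352609055871356387693903940749549633403530, 6, 2, 0, 2, 4, 2⟩,
  ⟨9521538914405632015524748371183204913874137490579375716326688703039206488684132634014470734327721099636363435712784771479197114876086992473947567699594524219493133354701650171762836601829483203210965539055237578862091804507, 2, 0, 13, 2, 4, 0⟩,
  ⟨9521828952875739925427882928005099833897428276153004073725945932289886624621232582271154762413497408164800629342546544296613661200193103051097131777377365521726549136365536403471629841477031237765312934952149199955841804507, 2, 1, 11, 2, 4, 0⟩,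
  ⟨4084833754919620898566585219953079174594692006307755559230604127577710635180605867683454955126013985996002995649636221857506448114347341076385158846230383057575528507293009090405011234863191908309625824644167429096078950314334970459064260689994843506393857, 2, 2, 9, 2, 4, 2⟩,
  ⟨4084818543459140974422502286906490752572224725785101832578747736364133894511267747944773705798052877288610168396269254346329172836412371407014878482765805442170095060026849875718964919736744210266083333997301913416148169934898642383238092629692109131393857, 2, 3, 7, 2, 4, 2⟩,
  ⟨1752099986360110363011369658002406081287959059990967510106900642674396895055285171447058497418642549813832022333421042514638079573867101955192549314559898123586068061825897862587909997790408296728339913429920473950163040138430796831042170539944196599549306242751566229019301726355191208707, 3, 0, 11, 2, 4, 4⟩,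
  ⟨1752324481881552156989831992764434183171345941947444770007883163131480696858296596979762050884504494067924238289334608100078048549806212704328665115836814418739656387605088527810679516111226325059934294269053046398867149463647013785294006313797837131687648920832810459289687468542691208707, 3, 1, 9, 2, 4, 4⟩,
  ⟨7406729196666949746326349981764444143287552073913644021485362824849799025026106273811591334231557729238531872819161366330979493844285675931521275722789013343154573479157064307663123989477666931163800584539705854662344099441185704108495265126491206459956301567543954363533572902720193396704184, 2, 0, 14, 2, 4, 4⟩,
  ⟨7406690795095123518786854478909148834271108549347677909862795882175315798810418329132733582745621235609461725443030335129234619290602536060399163160315697417140057799810422744497102640846005285162780638161706208529300977890390972105831687783043387358659898335062274484404639949839334021704184, 2, 1, 12, 2, 4, 4⟩,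
  ⟨7406441899634227991918444403161192179591687089366103904526562450126544882475241847056058109494666980974692674210897249006207712148180694300054441037196611392529402366133703006441969618924992595493741324113389580383778839089041649751321634899801845837195840839157420916923598995249490271704184, 2, 2, 10, 2, 4, 4⟩,
  ⟨170124249445284969458184348474322712950154459220366817447268274349831530093734872523294256988136561760251544028647791564318118097466266073376743885826705120950543510099452792275291944272700931252785965975593799285063879537381262161, 2, 0, 15, 2, 4, 0⟩,
  ⟨31308638214439875184851196843243050537426817065292550836798940466396910321882900049820966960419855116967853708457764087058935821767049615613300418608770981122012336051540272078360023596673688636507959330871229503958114862785450827577460400934127030726178466939472496990468916614540590693894751061, 2, 1, 13, 2, 4, 4⟩,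
  ⟨31308685768373146895711369558311103980019808841753386231552903456874412654900403941441360652210638598744166761467320372897581886026087313366628403612656849741512086608865403977060507535813239513334739806348031491959990006260871058177378982906760175995103437078796201633643922527321352412644751061, 3, 0, 13, 2, 4, 4⟩,
  ⟨132348567028540273532703473431127006121580187766194104855676563492690523918635707138824977737342546819107578536870356327520556996409613659000769501477141442318298949419128783211046783221731685721566490206355151874523637538761040532301565289032133191804960936401435129092447457927778637820598650610438, 2, 0, 16, 2, 4, 4⟩,
  ⟨3039896538805070312057868217209527414208575053551933984904766848809912578477762431045467992754335878665308390521661129184961468423688707302296403266723576785207942590108267973202971597126378460422439074437153417092906173117473635052172515, 2, 0, 17, 2, 4, 0⟩,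
  ⟨559421426987106245045173325875915112645821825876897999760520252693715841607563131790997151874840093412384486879386192626057134664019776975741557224687127148316442365474469925751655553950538646072589642561014418819720638541953002924487236675479537945758317028864760725006387911894285068547286335551782315, 2, 1, 15, 2, 4, 4⟩,
  ⟨54314664386115307299370713581979502892094001726493003134841320920604545420325948035446961317086496093654938951816931733045682845022468115678143559233471112989404068601288042683896713638272918841587198214462254021685205148467486790254953174420469, 2, 0, 19, 2, 4, 0⟩,
  ⟨559467879549233465859596834702504912563002352061236265463747136410979979063828523056999792562796802845799250319034200487714407890326706537111542394860378761892675061193420863744556459776929760401010784694083596060528319295205716524257947422813373419075190218860116669174230500534622139442886391168355615, 2, 0, 17, 2, 4, 4⟩,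
  ⟨9996647340378488158013849179682712484879756424038667673840136915547847911483899800475131122704043784656649700731994523099743849097121558501997890799518583373926058236409048929759887323276177255739606977342180336587571082268757345708315015029471786714183271661377396259550900911544089284028289838243947104293119, 2, 0, 19, 2, 4, 4⟩]

theorem valid_evenEvenEntries : allB evenEvenEntries (Entry.valid 0 2 1) = true := by
  decide +kernel

theorem covers_evenEvenEntries : covers 2 0 evenEvenEntries = true := by
  decide +kernel

/-- Entries for two odd cycles. -/
def oddOddEntries : List Entry := [
  ⟨4986949103584494347923907184378941813933684749902833314224089899186797131842359758760241668015350581, 1, 0, 0, 0, 2, 0⟩,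
  ⟨21080280586995449054491968368818469677967633273061431568553195261691943604977009824468676725612046272158, 1, 0, 1, 0, 2, 0⟩,
  ⟨89110214629349794134389799210564652527463090452110207543057531804987102293065351328929025661853890362687935, 1, 0, 2, 0, 2, 0⟩,
  ⟨89021913036734033611665057037809858358860523796838648284815474673801200554009596712072450649646859112687935, 1, 1, 0, 0, 2, 0⟩,
  ⟨89109213295096813860555090043044933466900589042421724101776638851217598268951108909328538906482796612687935, 2, 0, 0, 0, 2, 0⟩,
  ⟨376656939192294493616157731704963226646959820814243101089579309019145861336858168316725406999757567570721734512, 1, 0, 3, 0, 2, 0⟩,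
  ⟨376666999401619323508316006727962420193993284078507830291232833459818561417965731685813281889131346867596734512, 1, 1, 1, 0, 2, 0⟩,
  ⟨376661169192734639933966387164267157669350882304368962960180281819386097023446528303045544977357665226971734512, 2, 0, 1, 0, 2, 0⟩,
  ⟨1592191274871547468022406602497390991512432479846818541616804517486664830380456193672889412726653054038288230460439, 1, 0, 4, 0, 2, 0⟩,
  ⟨1592169088018839720762263693213054613722009656289129296695283847906047129583822238455742390240920021811725730460439, 1, 1, 2, 0, 2, 0⟩,
  ⟨1592191252434001468053239908063646796830925746765385010750026188343453767797789507504265212799799874106647605460439, 2, 0, 2, 0, 2, 0⟩,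
  ⟨1590984534273545678994188682520442354228209846180372840807274343710994459202447456628176250840914681235553855460439, 2, 1, 0, 0, 2, 0⟩,
  ⟨1592155549902530820978328804229171005101100099983780706933405033316433972671384662369358108724844887534381980460439, 3, 0, 0, 0, 2, 0⟩,
  ⟨93412230439102770586049138826851991112466570925089811471642416998856796627520737435319378207168865620928244369829135202095112078153193362992201355944039416065223381347880686651044091164238404941, 1, 0, 5, 2, 4, 0⟩,
  ⟨93409194684871580562853850124022605510316395012581626192983719205628335727854315964351554844633337150665461147516191929238697373937810062889171571802114876795035683517711057177926636666092363041, 1, 1, 3, 2, 4, 0⟩,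
  ⟨93411182712360231859653669552124730183753972672079548984400405095913129982292035138155241941959381104780986283684356935129166552802048514710993380700741980951311574518116011134530640572342363041, 2, 0, 3, 2, 4, 0⟩,
  ⟨93340082421840156314149709876906088095331735318739507769485811317514832794439223607744098275322993486084706429296112121248066227360237081206841490710516226505892859041126265040780640572342363041, 2, 1, 1, 2, 4, 0⟩,
  ⟨93409435985600637569865328155197774781272593323343891480832959449568181816860560912445384419592607951017459114611685262142883023150057578963996075940058269629167056610243215075875855416092363041, 3, 0, 1, 2, 4, 0⟩,
  ⟨394855479512385300388171577896299720951731749432290035091587173558149349940407853816163956281265447112425749139491160410822127191860659120894196939387071253608094935039785388221135581551388668953868, 1, 0, 6, 2, 4, 0⟩,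
  ⟨394858883072754758639713483155397684259055426345561228719617579320269777607036190552555671890307767049028245239756034064865034024397858704924813481406891200392672251494122451196232353653996835918968, 1, 1, 4, 2, 4, 0⟩,
  ⟨394859906403688848570466352078754565174736663546160082564603779867372813539331703182300870576700362530946265800776187833879562290631825392636006975168566988304641133820741219471016441788762460918968, 2, 0, 4, 2, 4, 0⟩,
  ⟨394754266503422913685550713213647549309757236549557819940596583380675839834244915927968596510162566487717409177609137883597310010485824502020654914273390188245238212059820784280815636124699960918968, 2, 1, 2, 2, 4, 0⟩,
  ⟨394851055919011619723325835064630687071724383295848189130660811861928072031702132272667413003601447551191061438518271924662354698631161242372059895323392973082243477276978796372929130997746835918968, 3, 0, 2, 2, 4, 0⟩,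
  ⟨394850099969972610460069936254666567940863991123370298010183011779290426613656962454349808182737228742358655574046887478247379798056552678275252744224642707166006109785275315890827690568059335918968, 3, 1, 0, 2, 4, 0⟩,
  ⟨394840728269819811660910659175150158630925434688961501246114503458045936146510660030818742345946588996643799943763047338728509718162793299026362878453795419925264857395422427008667503800481210918968, 4, 0, 0, 2, 4, 0⟩,
  ⟨1669062133550489820259711588232998669246903865309932231184654087053704652816061567958135854109329352313899032687233571705217717459276846886339833397846487486186142356211891779769093701373105515563936195, 1, 0, 7, 2, 4, 0⟩,
  ⟨1669076891141334723652432275727680737461890503290575358498036564836668274810677989590493492035091848438964935162450133592324985056132458871895389881330095442442699742641422240596915500954813037200456795, 1, 1, 5, 2, 4, 0⟩,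
  ⟨1669080837023907413358124140744647697790193828597807857550728220818935692759613328931684679093741553770445696773567656264996611119938081018050216152751188179544387673231255071771050709084695849700456795, 2, 0, 5, 2, 4, 0⟩,
  ⟨1667799570016189145112909704045140223309534613251106635173929797789316651681342589316001348287231863416066159778865012464335775223414523348117910725594805525047762977592070861321593540505594287200456795, 2, 1, 3, 2, 4, 0⟩,
  ⟨1669080816372776499824147477868210826573154655212087930810866747341966559561573948898533411358507442319304442274168949311413001906811778530632579201130213845767928398017544573706294315652078662200456795, 3, 0, 3, 2, 4, 0⟩,
  ⟨1669027033412991303683153504589836627221505372040267293850244063780576800225827656825759298164652514278040039271365136421336051803124949185049246550188154519787668299740913831230903881386941943450456795, 3, 1, 1, 2, 4, 0⟩,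
  ⟨1668993591964545245551602992921587507909476216362596313482235383333397985873306100399042063937999211936728480162405183898896228561502250859940660549554876324208100861951321754206622856454080615325456795, 4, 0, 1, 2, 4, 0⟩,
  ⟨7055105251283823417327317918701563464771198305077433601473574543765374479955528863661510804509240749763424445606762328402181004629175896127814691866436847378734079573747786305903437736500901563054447610122, 1, 0, 8, 2, 4, 0⟩,
  ⟨7055062248510491302572988410586631050290572026908220355780687068994570403815673830496769682905936641069991381046704623529114449762599254103794976660106494109124444237337086801666831527801214079545929700222, 1, 1, 6, 2, 4, 0⟩,
  ⟨7055605549523219423801468293966093619248209127152389110390718738616705984558298400801670391614387666498112018319220988963753627756616028788431970553565697800951685981842359237738950108142553190874054700222, 2, 0, 6, 2, 4, 0⟩,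
  ⟨7046401325033413206482990946883319741714127554126388255706468441220782644044820964547036470321481825458088889296718753634553862970227028687891869197568630577638206792314206891127927158923803190874054700222, 2, 1, 4, 2, 4, 0⟩,
  ⟨7054920896160014644727481406657960888881283742501685389431062647885103343493638246935874943677727027451571361794014815756372252117170802992502093816195334324325918463684586808917177771182714323686554700222, 3, 0, 4, 2, 4, 0⟩,
  ⟨7055564234827459630525422001626725867233505332265267237776040624833748572554122701998230008003186753685991001353117879462433157142755393265298443925315177434642310850889173875579675589652715544389679700222, 3, 1, 2, 2, 4, 0⟩,
  ⟨7055289531753778047169628329669056956268619737869181707439058185057814777548055418891568111424388395085732590140195835540119842940103822541068733235859003591996518879382932195689594303222356657670929700222, 4, 0, 2, 2, 4, 0⟩,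
  ⟨7055009187413660976276645128422483604793890425365437151412776080257367536514822705431156530391459154063474518109046006579164531438528664331182882889978508906170506788170853892474500392528234343217804700222, 4, 1, 0, 2, 4, 0⟩,
  ⟨7055579155136675586262303384456015323857070250301936952165634310022027174814469189506769963595409765352757777087690766668638700309434135137970472100186084811709328038766979813316071139747204211692145057722, 5, 0, 0, 2, 4, 0⟩,
  ⟨29824507376333376330067722159768766787078296865245582655840540395385183858112708251349835349263173705603379602689210870120362445572580823679954074104589502519683792994226432788681909273908179992813821206791049, 1, 0, 9, 2, 4, 0⟩,
  ⟨29817106615827632951609615832498286439243868504650590511291963266776172975802608933880856910073177927751096255936224379749080872803914142712515871450990930457735739481045765237840446475491565460343118081791049, 1, 1, 7, 2, 4, 0⟩,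
  ⟨29823218052240286862999690628897089056812549945224253527053702374124477400832108578819629197333656933977001342800905774009554924235028940246125797171001985623530589328947535401491863630878960628862050927800549, 1, 2, 5, 2, 4, 0⟩,
  ⟨29816098119054602416955925814824444731785403502504002291189257127599025306887836071723762391726523375116124011024141303508124425675726351015057991938278641430498812612384960099186814367938076992387441552800549, 1, 3, 3, 2, 4, 0⟩,
  ⟨29822504637927046320819374912550301852425634323815481244413465246611711935615294432996977833528020599835646156837520191250016682481455372362777829090508798279984194519831037802303936333945913559710599714800549, 2, 0, 7, 2, 4, 0⟩,
  ⟨29793076314671224939541771609881880789005928141347503352371651990384433083633038840844988734604614287025699743254161504268509062197149218141294134527552184709081333265456310606622165070465727097308255964800549, 2, 1, 5, 2, 4, 0⟩,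
  ⟨29822213410846972750324661507528581757441280953006098466335041953574287171763601884257724466164047187619721121464201096431362546407398098037021262161027697737229647297440566796011435800782366043841459089800549, 2, 2, 3, 2, 4, 0⟩,
  ⟨29677711289843236316679500176787431843850137062472042034772035213083349750629008687924623855826287896152054187548953974125595580886683698281623140593341351722883122608675494654106469826391859299456693464800549, 2, 3, 1, 2, 4, 0⟩,
  ⟨29793071271552681410899415717834289583347608048170742278057655012047409249188381704113239068152156229336887025106723517145152172822419575859145424620592831413858945311489707670715316200247926956927396589800549, 3, 2, 1, 2, 4, 0⟩,
  ⟨126064944465468363557596889157595792652095505257330769364833932175851638979883608819412681658952727063196637160680725948094428088848764685929775204964425176721924880838590437569969090456023408214856665765144788576, 1, 0, 10, 2, 4, 0⟩,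
  ⟨126064510207970190466586987229377402331398028372291659097572343649708608987003177105831228581586113928431917322331697941363474702293953108049046975023573398251587697873657228363931445111400975029279273187019788576, 1, 1, 8, 2, 4, 0⟩,
  ⟨126059499268843956510372402062565529674986166737336570421968872322739710788847323260268671362056834285797226655509291662604441397669960677973142499604894796640640555792955790709721392134761815239789037983485168976, 1, 2, 6, 2, 4, 0⟩,
  ⟨126070772791346391853125574905142375275146384075907664125631566104635187404545135788026840856816734860913851116062623900988248639904005779427155627279029348967627431478166577877710502592472737004162817280360168976, 1, 3, 4, 2, 4, 0⟩,
  ⟨126067297336305379198685702418595819169142300412006656412184292398630074951316206891696196491877509830829091146821681492501047208145249385768961854120481737699753468494133020808995977003708311376679847469772168976, 2, 0, 8, 2, 4, 0⟩,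
  ⟨126060373971785929635281060608277293340542270427833201759593324182882567698658974117267131349017931560534535537493566712362652394789204983301322857505121183325935983980570572808184121796555336908352369560373367576, 2, 1, 6, 2, 4, 0⟩,
  ⟨126063736854563954541204073997137172396333115614157739769411566333566522329439725831707022114754967702408183985626113324017620632235228325851561067626745361066742659909741061167616178109935935930263990654123367576, 2, 2, 4, 2, 4, 0⟩,
  ⟨125636012431065830989155296198037596175463565670578339480894590076736772411243998254025213155612919087782683007856675889077307057413032108673978903178917322648460403199917397924374424447930869058620924247873367576, 2, 3, 2, 2, 4, 0⟩,
  ⟨126063722916030856525513847916667264122405450534195884722977341895989586172505547971245751138299542005353016921947744990709916642516645467630749410207831087179724694696710060097140055560200926260006422294748367576, 3, 2, 2, 2, 4, 0⟩,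
  ⟨125387838260076734975144448370786068401918437775797203507591922352808208418836360009227783086824050213102982655214326071506152495995999988102040644766083366649796921924762479531474352526172515348446363700998367576, 3, 3, 0, 2, 4, 0⟩,
  ⟨125387346657720492640672018559513983572152305383838288154064230838456384841994914756902605442308832277954524052775858632296712052814667009214744481344027145017974144058945725814120348487674709753048414482248367576, 4, 2, 0, 2, 4, 0⟩,
  ⟨532894479554183477607069215960685927970462808706276849748519867761302550098329289481624730601085078429456923103530827923729253729477540209305294507208971012848222106257653735174284833848798224816082810390302196020903, 1, 0, 11, 2, 4, 0⟩,
  ⟨532908953322061950558260092229835458759768747010504205474335052002397947109320155144610936118649019717364394118402869608720306795234129647155305109898263354593000845294186146340576301301336424538849686611005321020903, 1, 1, 9, 2, 4, 0⟩,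
  ⟨532867613281941627170876555739291241208851605144100343255948301892719945165611362524001959914684582313736005013012313483384314526138773028528147488933537894277587257023879886062866876736597768097461650812836098394303, 1, 2, 7, 2, 4, 0⟩,
  ⟨532897401232787108250108781360781261463671675346634989883658459495030299550912172263427248248919357406789712146648245579974796849819073220390512190282868998580529681871754699905318989758461392551006267512054848394303, 1, 3, 5, 2, 4, 0⟩,
  ⟨532896451591862837120654659521102559492551810437695012064305815925137844668752527483595336499262549476500829641394935245386333354924566706845692912348716982196823957230350664766025234540051438674023900350231784195703, 2, 0, 9, 2, 4, 0⟩,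
  ⟨532085303202453267492707200415984389272143818462777118868854550892446858217948559473059052736057452281652084783817585710419740777464580313783663105522652177623960731981733062351811300514440641566804204305309909195703, 2, 1, 7, 2, 4, 0⟩,
  ⟨228596307367996999584789123693467165080630271438837313440810732807877990619652240490679369673771894552849833217792953396088739943593868052506355496351191126731266280970710064972020035887308656742056955000763234146389513611239173442709330882676050553, 2, 2, 5, 2, 4, 2⟩,
  ⟨228597275215699733845161826456027230474215052146207634199437025645209516948149171053271661891754896326492459420573561590043762111504843108167097159381509930105728743693016405392296680145029857938538275679484893561719914721564921284011059064746894303, 2, 3, 3, 2, 4, 2⟩,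
  ⟨228596423313424000999164709962474290459596910990271345482392337767416761981897790486742402511148353339176629871199880747894754259014141549441973721742454773084900022959736283921209416453865186757057956638194532491069154055097671890547924299121894303, 3, 2, 3, 2, 4, 2⟩,
  ⟨228596410405791103239104833731809004597943604717704039046504924176340476146314431217610058410826141613610291179090240887262621822680132659491935413505533890245803467393976222609161475743827542222191936333785647935200145873481007957747631330371894303, 3, 3, 1, 2, 4, 2⟩,
  ⟨228596410405814125425116744138957951220790791255443031487324099171322883383420108090545094320046720600360004087674845040525340886237704050591188386210316940762210033594593520624572120907062840992823056910565163764657668941894146347335033674121894303, 4, 2, 1, 2, 4, 2⟩,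
  ⟨5251164854796199990968591137000049339137181352715429050489529231054523341924704338801949171328764836636390747168630835611478667078653127548397804126999579850924290327912565571684794550730, 1, 0, 12, 0, 4, 2⟩,
  ⟨5251154503649219264740957239921902408115312441935338833533589327104649743766892419569054100378449223072788582087211064691847709411608860403880049247952746257176711766606565815825419550730, 1, 1, 10, 0, 4, 2⟩,
  ⟨2252582251705747807649665215186351675386248504974368347703936727524938023312155086191020470242912364920122828040281540091640754423947594749851879667820618132273886068613839363325027692882767227876660489598313147520887730, 1, 2, 8, 2, 4, 0⟩,
  ⟨2252590773076267487271064292847206870724885531170604608964728300021481854246157831481981509737729978788892550296541347932984917039877656820462531766504369254028122919946541640056217931361797415162787240448081331872086330, 1, 3, 6, 2, 4, 0⟩,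
  ⟨2252595060203165511889308671200584150918850332275403677026687796942773648735232442036548458756873051634191021034278501244406883450588445001615055609952597336575226290551303941366448941027383003826603692474448519372086330, 2, 0, 10, 2, 4, 0⟩,
  ⟨2252590648944423312881107210926423967777373703935495445207017071298885669807194872419477259658444213054117063403108950750067454859315344543895521113312745878305295710711323407969978222228573319013581078949057894372086330, 2, 1, 8, 2, 4, 0⟩,
  ⟨2252649373888490550749553306595789260352735427778604344361838203066744250576443401847971587253341003415007476162643601592405060957367886466515148957281334682863248591972231213506209274429974543329057359257736975645887730, 2, 2, 6, 2, 4, 0⟩,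
  ⟨966295161423421771642477231351636912308328607952391931520574798579304957379942170155359737510224264732787285898707280765107901497931961487737194627892971010510974223729286064121127698764552382215784221948264087605833744345106749152296440978811381686655, 2, 3, 4, 2, 4, 2⟩,
  ⟨966295161423609238628396058331224481742008369441918689651477838662351023432354312993119898313879378571739110119436174994596457939844599100618609412951040321562244650452407034043813724330450236011109398374513479298213930559102079187982933898733256686655, 3, 2, 4, 2, 4, 2⟩,
  ⟨966295106888770095042211815544167802935394785599563268847088274465114260909320636092506344372355396714007697187046313906158996709397867900061935605100096695217564184148442216859334469094254066192834054537230747813152881388775637661569970031545756686655, 3, 3, 2, 2, 4, 2⟩,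
  ⟨966295106888957461240398137815122525865926181018013911463253162392392889910055836677876974705067661349695599476377772785772114289085491756989798365842902210424240914767074746596771392096871308897216033047354655079813007358568353866690056701467631686655, 4, 2, 2, 2, 4, 2⟩,
  ⟨966298214628154360915427963236351308463432710909197944096512841054573525629826489127790723388748278969964900214109612107097879187105505091374964880657206814996511789521227242156985759568857772081616752929778982499027555719847622932068809648943666606655, 4, 3, 0, 2, 4, 2⟩,
  ⟨966298325007659100404840106530921215808483982116807165945561556148757663049320914307971290071645588999251378064741726849104123523573871111656500904531134073503866598231176645698449338921653896040706076612742828239828490156113002122513755938006166606655, 5, 2, 0, 2, 4, 2⟩,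
  ⟨9521432664050477892278081821682111230427791677186399486866175360600827617277984462998033452927341951254004637466263884148648669448309399730695622199183060213895397819365398416047165497926467863199719783117121092725828302157, 1, 0, 13, 2, 4, 0⟩,
  ⟨9521839449101597616387402192096177557496825651949136047575648591214191090270805567050213193764133736907269460691581865885116743544238413314540019668896136201950629462460680908417189450259226062390440698911493651319578302157, 1, 1, 11, 2, 4, 0⟩,
  ⟨9522160507517851903142995063679149519885076457018171242879247448033461715284810507065997512883424378420870844902388257953180371210706942322982523131466662282151964616718361485168504437528097079843826557842135959422050238057, 1, 2, 9, 2, 4, 0⟩,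
  ⟨9521592259381037499953674516054669591073148454733812916176043779087593604828762552292141703439976983374970811538005661403116466581364347039883965561816927746188088818601591580013494258995703896284647251811862521922050238057, 1, 3, 7, 2, 4, 0⟩,
  ⟨9521928705180600149467271041498271783068746907974010960473035762150221973679179156982720227233601653988322806297726649265634218456354462135602172087430894836502203734208571578013927556657577057472156902720301487237766947757, 2, 0, 11, 2, 4, 0⟩,
  ⟨1752284905198357721310048351572326491987572523183397528084604656782162060099292843749204758613921218385351145587764387848806196260498163956262097688203624206519020707247340432064294771506093041880574732784243611698646775715442673464406887940459723671771353171977718086348673530578257467907, 2, 1, 9, 2, 4, 4⟩,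
  ⟨40197134528000303565990802614399482198045333642680401099822940001398556685179330094818124051749744704035415988789440062253816790010230187904978935620029530587147316181040359349937813516150427826570613802655021806606181244492584, 1, 2, 10, 2, 4, 0⟩,
  ⟨40246704498500177665833379732293387213831233014750763979926289754080138068145467628718971599558559899426658759142718628584405437997400146585530864962035494811445375300442425462226173930919829905414666604140173705445239371396084, 1, 3, 8, 2, 4, 0⟩,
  ⟨40249619656565052056694739166021202949576126932721486051754187057673007042855363891764538867487835592258603848001579626233870594261564686797054264148891106283626145312902175732589785873082363163913634167297165056117899994492584, 2, 0, 12, 2, 4, 0⟩,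
  ⟨40177823113375371643427626124810048805048867674667270758155351157991535868322322320446508186094825694092921060308628905645048953569164215531753589762639391151922009475686265471892370171823657496926408753974716325649149994492584, 2, 1, 10, 2, 4, 0⟩,
  ⟨17265733934850228531077444010332134630843198509301418586408428553426414417482378540464732382673786632193963612961780253409933948252570538227888908652538068665912602214262873834092372618115453723217973244032231285180580107204263838737808568052807236480818101959, 2, 2, 8, 2, 4, 2⟩,
  ⟨170136904545695704351928157038110378720856302757287471483407524742572941210187510610366699507064812440335347083010468790526324035631084131834263666167479133219866934709605818051057444089012767292052144663062395680450595358403833411, 1, 0, 15, 2, 4, 0⟩,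
  ⟨170135348673934631583541011733445707268392447064230996816605966558987320421876851675781951923315404648900468786871937404287105075435221327579480715346281977135277467346110426927803224600609562329173554795448186028503573874028833411, 1, 1, 13, 2, 4, 0⟩,
  ⟨170143610617786877766601176785830135880353898862765305858166798144222320929681965859994350734065604561418262123120528001851163212112179168762574835640337342832387592407195579641558547213657016376493296902405894749453686574408331811, 1, 2, 11, 2, 4, 0⟩,
  ⟨170143534082209532518242298007589783487191394441165391438621557261736143748010466293884588938461330579857528804625248224241887029531330788900718462701729814702449188669125439826880591846484437061355160167219913952639721730658331811, 1, 3, 9, 2, 4, 0⟩,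
  ⟨31307753751266075913101037431958872501154312406939454701636672853159887908496317325731172944325469833423625881017490567386535391422060930087492434683803417943315103779012114463525313226434106934821106252886050864685135356044829415591869605450719230391034816994110305000170153749633046044133249161, 2, 0, 13, 2, 4, 4⟩,
  ⟨31307665634759105731561546950476190399040378662298601700326365892950149064485685193810414860335594751534485892842391868608872948420667311024938638642726624523054451828575789554374755129311084689638821880042635095464189162862944027166889285766377962227782458346868669519274515283751698387883249161, 2, 1, 11, 2, 4, 4⟩,
  ⟨718076130364455331166827457815494832311714568059832178330879663818718268262726049135513837824873424248196536814851819108452516824369940133874848106216706890832714945413747681600929749088020747013252822762864804047779803680605265177338, 1, 2, 12, 2, 4, 0⟩,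
  ⟨718076130345087927704489676025706596571756976213375334770629539788554325458024298347370873786419674125415938045806718123365417454760514079505087749990533678366360575744771992113640902021704103205315597188586531359390979217714640177338, 1, 3, 10, 2, 4, 0⟩,
  ⟨308505330289927785468525532408501895035623457395236338392433061668403609914214600049688743336897352168213987470319240394515359299102488247874423608762487620826746773755769700222050009441365251905219481597690022312982066215061607319734574878488263446836685330069664463, 2, 0, 14, 2, 4, 2⟩,
  ⟨308504698569962770511866109111172193566819742514856735181466715214612557419448302555242173655045143285417693615888810262656098281382705394409327790700388014442177520739848353883612591081508811693030862875574581233678968874170358585383181810278972942381118923819664463, 2, 1, 12, 2, 4, 2⟩,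
  ⟨132348076781994381180136192529574085079466432775243478421111580743087547507003535463423451886223309591197221879170786945620115858523003415592152961670661571319972624732127715475247198735130355007221942224705562065686142874239506843176092237760090864180211481121961173260616223804856669051432850887738, 3, 0, 12, 2, 4, 4⟩,
  ⟨308506564820105821739463846456163228966801571149374700580674288582554936630057122589886860211124258031180628979497194264108109204358716491836886651171988634059362228736554803905425488739317878933813550450953723555736511963625652661616476184059926457622107367115561663, 3, 1, 10, 2, 4, 2⟩,
  ⟨3039896586911924271966614132856573354647369602838613036611887468252952893493345913588583237474628000106703836702061079352358452197238610639945385290831342078574400991940414165399237058053386684786929250237386827386880761828745934631177165, 1, 0, 17, 2, 4, 0⟩,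
  ⟨3040027060747177473282272074895481617782621285430736299276626185143913776109909155463531504727171389500779232828562227563106250745311716158866252507304818232987754781076584301263765622321628224245799443139782329119706994738902184631177165, 1, 1, 15, 2, 4, 0⟩,
  ⟨3040023747329068190577640306670746740332727060568032126460909236871676191140350032354071977133205751424177137869643939130755383776324786200649330412406362626194126326130822105473358169489851302647871178266592710308695680346812340881177165, 1, 2, 13, 2, 4, 0⟩,
  ⟨3039880735440899889545568394073841067251902726410197527445023903433546526210775429762865173124776952509334360749625420582338595442877105240695642177613916463687626866921228623237144004597859220192037752890584673661656161594567024273659665, 1, 3, 11, 2, 4, 0⟩,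
  ⟨559409657904253171905800790190193744234719717084760146200757142748199723571178141598815089373957957409168542171871875912720135892571510631781669575612059641724531953251904781686844501177570554878614082198604090761888119180352030458735696453791229625458338734146458439934597645281154514231785183579624165, 2, 0, 15, 2, 4, 4⟩,
  ⟨2364811285848966020679436120548641866667358635199708508114030571387185252495975059174000764579741651395880847107853837666278832589638044439546417631965480961330339306501867833430656866997556521545176677874547279962296570055816307735069645776318619270398714225443629784499216463552984020536947280965135626642, 1, 2, 14, 2, 4, 4⟩,
  ⟨2363565133918291643059018104936300716740445980905297253090994924234389402184350632040900233872320655416619221295999978848477051747520383132967470218572375065128965002340339780538211806327961190205567153481979245590040833907520977239201328201897833202123201864175298554974596833597133478945302993855760626642, 1, 3, 12, 2, 4, 4⟩,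
  ⟨2364603689673536792880612241215085031138394273646031283065559057960273662948850454908128750054471268456490990572838627665522218750736728420378908283408909448315500199613053025569163413684556281529844452472125651631603401254503822848467882233386437854738674602465701609125653328044536135023641616902635626642, 3, 0, 14, 2, 4, 4⟩,
  ⟨54317285433314937174682892903359004165748055548646380892325251042123984363024236503008359376052741348880701450298330995665225628726569354541770715499142865849953142481035034150787394120854723836080497561243698316124660953933443776961636058142019, 1, 0, 19, 0, 4, 4⟩,
  ⟨126455435146362939645751162912390661717744705721220473303010555349734158568656997601342904782398377592124442669574297394524892633078730507461934908943923640338398028550675655696942364172621637869243951986213439344, 1, 1, 17, 0, 4, 2⟩,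
  ⟨54321661524271470574001046897856474210583129033814400661118137619145808124991639580755071248538548781522238142094371801487492465874406979929562186163768655836106159110573249386662218878758855673302122147722644979394211547826075060833786669679219, 1, 2, 15, 2, 4, 0⟩,
  ⟨54318423041042122329831815033477909737678858882903867810054291704324094848212516251362803779446446004253848147888098658927829256451861671493213423237872509851469720149642798134416555875875258075459245375959677270988008762906687951853817671719519, 1, 3, 13, 2, 4, 0⟩,
  ⟨42252562301559407894049614917448625610183877696475118162305064605095545470003045891244257515417985647906276329948907144022750312720499944740034066398855175889992133216776908240647304390232621248137600693298413061188852043467067386534686311833442109049392856676509720686342208525717861413822372907438201501066376646, 1, 2, 16, 2, 4, 4⟩,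
  ⟨42256487334542188960050331951106022144591708204962516215137443908781489166087285376794586670296201147259190797084173404829935063947590946440674348409384022219757283826907819798898261377215475187804593398926695562129044402363954570969018211363067583733010762336953900596882038828413779776410063260831756188566376646, 1, 3, 14, 2, 4, 4⟩,
  ⟨970525098460520710761476448523754233542133493100082137030339766322802759313664198163679412470061896511028950928533387642433628427205066339594222393811721388489985505791334794293442220686215012051874912102481456570681826902995381215080674719172488534673, 1, 2, 17, 2, 4, 0⟩,
  ⟨967750504522270951285006745913910243459015395909552716834621571193483394892333509047770381724545016643726971854344692591580709565733523942702317660329482294240035286966626168747481988101371025289814232843761481223939814459117818714456016158696341000773, 1, 3, 15, 2, 4, 0⟩,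
  ⟨40428870358345764857408924962616344603421785774072658211238967391186589603366556548826370196073735590583159622204614306801928733805926063600694685580247088744933490129237408606388233704816311545501652108985670370488577174966852, 1, 2, 19, 0, 4, 2⟩,
  ⟨17342150213234450084006035897381167569164440405350943445271425941170432470333198694193572356941043264807920778552121223351503569140420674472568075421938423918676259906281840097628871894603677438543162348666147418136816917166223268167891714611897345413498213127, 1, 3, 17, 2, 4, 0⟩,
  ⟨3191007834654513178383976487507002265258000699338791965507528363432587923212758160508470930991036474341295220196268908787600124094498051234704914710226863510472060147071404464123884103999214998635866881528214433981158442044484490268404524037314050596658534848285808340478248236850035602737619664282651289154509275284722782477, 3, 0, 19, 2, 4, 4⟩,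
  ⟨3191170768363465636081286496385630655353809507107404826176162023781846392475741200791131540011270991906215877109594446888430990475997723936610106446495979920607394601684102524740440133431778809771680605244686753125988527492489436515259986402689331803920428189062661806342432285797396275081240199967400773216704099503472782477, 3, 1, 17, 2, 4, 4⟩,
  ⟨309869879664213381945884618801982975674170916966768297818422256714930961066510423823958823484141517132421024042430845152480627011298789844914558541739242542574764739910815273082211441404721878800867526221576020390274265532406781231896274693925809825663529414906147981, 1, 3, 19, 2, 4, 0⟩,
  ⟨57025631823127658693435939942481963406593414968296736601907376244484328397229035382459648705370790152597052266266730708720606696917296234085989332725042629568045918023825319977954676177773905431201810564786277055556463784570002041096090834840127752448196487128259266083803943864793292652859006433763254017982959117923145641889825431, 3, 1, 19, 2, 4, 4⟩,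
  ⟨3039670686470209066830984455463426658339156193098530370601045985083939059685464132991027744330621751337144532611276126907343239667940580733542164098301593498316163352962841420319835043596164100331891087392232363234521277355045631673589815, 1, 0, 17, 0, 4, 4⟩,
  ⟨178597885815995497122485719556512863440422497911398777552135219042906030480421441779379646072412565787735354308522809175141115420928883230306812998838863688536071665502589545315488355565155900686911204116800254030831655485027867725073321970904766755258241595088716556527472005033703562411405626001803218865958089339123, 1, 2, 17, 2, 4, 4⟩,
  ⟨416344150632493289986376786047060262538046816483497671486018507934371185894079285670127503722565710141987079462530032062181912725335377946546556123407893128712988097593590287601748647252634793822208257778090363829508224640604113359563689115616230752478863884230091897975980925383070723, 3, 0, 17, 2, 4, 2⟩,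
  ⟨3173614140477113122522520952742966204004120085554400385838261119540556393590916760741477733187979335462908795727920172193624506035812146850159264934457385981086395968832821373889717503427502819119881988293461460357122873753422855818158559424888085052776319958416927952789706371514878216877414716442702238705620683892640120377, 1, 3, 17, 2, 4, 4⟩,
  ⟨56732477789298356486350974773337931561936547959630893780954458492440147063499663370349297132160988128543983949645434940639462342595274215807559448379282427861026335316855834806174907763870535710049249317259549137298642571638566982078356289079646882865738051624023316699403282495416850222547460542697581982140372709854271080917083331, 1, 3, 19, 2, 4, 4⟩]

theorem valid_oddOddEntries : allB oddOddEntries (Entry.valid 1 5 1) = true := by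
  decide +kernel

theorem covers_oddOddEntries : covers 1 0 oddOddEntries = true := by
  decide +kernel

/-- Entries for an even and a longer odd cycle. -/
def evenOddEntries : List Entry := [
  ⟨323910001892124219250951338868873479325366562687140621973854669324578261636281647563256473481593574032, 2, 1, 0, 0, 2, 0⟩,
  ⟨1368545416303059523176675710043491103451162436017194898850308200868680589148955146672310715742169095368559, 2, 1, 1, 0, 2, 0⟩,
  ⟨5789215405527353431089308202959027598079709731812348115104961605159298202717514648416565787457953140917837786, 2, 1, 2, 0, 2, 0⟩,
  ⟨5780653088737629492548342589282666044378168930555407750727510134924656335753744269439505469464789078417837786, 2, 2, 0, 0, 2, 0⟩,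
  ⟨5784814344745211109309204589455344110305670935996398656512455846698367591250422537715660464429388687792837786, 3, 1, 0, 0, 2, 0⟩,
  ⟨24476838880549745988285699083290450225794487697734779740310008967043947868420873694668312520152827172947437323263, 2, 1, 3, 0, 2, 0⟩,
  ⟨24458816423941607802047656931856861054217644215943045214236575876154267173240828680852225673550156334803998865913, 2, 2, 1, 0, 2, 0⟩,
  ⟨24470793512451128461605268629397199638681060835850597130360241494866222574699261448899171430005303726955372757313, 3, 1, 1, 0, 2, 0⟩,
  ⟨103439025391395470779490242910014617277620500931919807568177702150069497798961056964917731854864686315767064540199340, 2, 1, 4, 0, 2, 0⟩,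
  ⟨103413982911540291711640553368129878841062471337461739743918546088198229066798942174000745687433808630220189540199340, 2, 2, 2, 0, 2, 0⟩,
  ⟨103439025391395470769549488875928239078718413865764570018704507683673672492566025093174955557831853216401830165199340, 3, 1, 2, 0, 2, 0⟩,
  ⟨103364833482407089838717281258971843513024865189583661751141384124341655427180395051657512161680787389985814540199340, 3, 2, 0, 0, 2, 0⟩,
  ⟨103414257986966421993633846255877069399342877680109986365461404103551664796601751579259741835753712352511987414426540, 4, 1, 0, 0, 2, 0⟩,
  ⟨6070024795810949860504059031998508522889962097075759788027319743046516379347893358923889224413999717882866024193150483436037053760289831923242735737143694810878367129102016313601053741195505342442, 2, 1, 5, 2, 4, 0⟩,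
  ⟨6065856873773378791375912983721581731970778603219709571821720510647755839779642870955762113871391422544368563420194594637259892413585213312503006259768646349992957688722426517534769561508005342442, 2, 2, 3, 2, 4, 0⟩,
  ⟨6070024844236049025029112451800280237492069641597022628575493542015079905045801483635400446524901495754002433162777477909285715503705466184277869014140650486620041114714595003653086211898630342442, 3, 1, 3, 2, 4, 0⟩,
  ⟨6067353316016929466591838050564435585259141370156913009811341104909178215720043216176963012112522117647132567796198958462045393295496906585009531922163338227914062294497753007936991241195505342442, 3, 2, 1, 2, 4, 0⟩,
  ⟨6070024840265673632174925238416875652687685727855707553616650252027979234511740374902567417926860221818884847441103894032243756612455167256791543558499791769587625744374135954905069854476755342442, 4, 1, 1, 2, 4, 0⟩,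
  ⟨25640964937977968229990068784901920884382036974338090256819487590440624718532520454474399750293335109593411095643802858772261991512703798632737034518922992839379050184155970875692774721270530267724319, 2, 1, 6, 2, 4, 0⟩,
  ⟨25640902937076886586680012610948448700995768226251540166517459056355838559648489375258012374804617109204332939995449151460829096195570351892662081075515403757297606563092016678822447725420920892724319, 2, 2, 4, 2, 4, 0⟩,
  ⟨25552563490074981491200065232693414376596776483710877264405534411103709771062211165064368378403137137972788956518706841383574185752602307104001281409150056275042318548961815488112379976397483392724319, 3, 1, 4, 2, 4, 0⟩,
  ⟨25645792829861055524730111228420839834985465341091108131085564541619830085976287199067937648863276892226366916869158553815134794898186628882499594348864889426903091890430118021142889925127952142724319, 3, 2, 2, 2, 4, 0⟩,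
  ⟨25651991597602334596786312616523841118999148898706261654148106358076281391018612528649303494321000236620182933785626844987126277569991229196629135008703695227499709136331261199486662813311545892724319, 4, 1, 2, 2, 4, 0⟩,
  ⟨25651930618280263121520623589518454473660806372727245952661918463366765101298983753847505532584877583527022074514380055129914181303834428596942377565332160457128652825353241589439322420245139642724319, 4, 2, 0, 2, 4, 0⟩,
  ⟨25658223816086451317377053913896116238274761250995772945783936587279307335443050041537342575760812714464406238007720822606941319202071083262910224505101109914804934548207901114358361901824616180201819, 5, 1, 0, 2, 4, 0⟩,
  ⟨108459063127210872454183210649479121245633387167907040463635073332159009387127091659819881267453170706186138205404955118960346280119966107905141708602991322098254138928485055302161608647764127071747561196, 2, 1, 7, 2, 4, 0⟩,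
  ⟨108276114205787678834696585467675103074742405575071832216531577061116409523440170669008009103854554422094976735935359694960766547886618970445205339188503667104956489431276942466233120732821341309271362596, 2, 2, 5, 2, 4, 0⟩,
  ⟨108381283056010148787825036643757414929278860564920592296438405577466363834707798694229444226297159858449962899544166526770123813773733976167979890537654644197704383379675938610766278081454153809271362596, 3, 1, 5, 2, 4, 0⟩,
  ⟨108386187897128553804744090607546922595450572381339499226309239241643697291559247645501149155708979817724716317591385241672475156558457678385809769710003696455311155211564120233837710195101614746771362596, 3, 2, 3, 2, 4, 0⟩,
  ⟨108432324907454371274205389090957267377875693974282244956248045199591020480577247339079355087828089761729687064743651340416618232465104993642621827925346178661869094362134866512227998548067923340521362596, 4, 1, 3, 2, 4, 0⟩,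
  ⟨108332827373582438297212922762516945460768935266082550541691245404217776944226259298298969110177574723136623049464334316072727867793851974442064237830892695658990392338171524440717147164858694824896362596, 4, 2, 1, 2, 4, 0⟩,
  ⟨108380878664408621019805379476729028834155689268347913659753377320060825304031895395639965667038323276813608225790806927168037992416327838437576529061116574154274976371869207921285377316988821778021362596, 5, 1, 1, 2, 4, 0⟩,
  ⟨457685008461308193729270437058211517368674386703381876036577761451349538352826348678159167383237120323013621375978005759096189285104902526593283328597282693888585743413256475654955990732396741260720435420573, 2, 1, 8, 2, 4, 0⟩,
  ⟨458043474538460925787101291023800465104969085517195029666821199007814721140662363130347421663292178652974215889610705212165023523797363195524819686121700153407367013824381681665139310181821484913064185420573, 2, 2, 6, 2, 4, 0⟩,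
  ⟨458239541718783707431282108004191115822600212017251603240955380243010037056309570432251556881883443793694352837034108332069728587101439151510260796008633592422569914004083509830119125664914746631814185420573, 3, 1, 6, 2, 4, 0⟩,
  ⟨457818839755348124353050815999236974850977239434907832140975820816773250905512816423511225725006513887382003675246924053667766143761366470396016416548028444555618062261271868741781488180841107715798560420573, 3, 2, 4, 2, 4, 0⟩,
  ⟨458239536047466880302014060669119204016133788550948061956804376617866792647747987554997707348652887673972605005299147611371770700369928749276596650087129819715279597802305441113597750783647199024392310420573, 4, 1, 4, 2, 4, 0⟩,
  ⟨458476407470030360255458707740825785795307031197211033599704989853395523466703453946216254930959781406416371856894960798800901856547617192442637075858913056004965003730956548501447811842645306934548560420573, 4, 2, 2, 2, 4, 0⟩,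
  ⟨457910920500700168882784428567206956988399304268527619290531333180284474250704859666769853088655700703595735521904175094234184226887437028820597216022665393825324960396995218438272401810372968067361060420573, 5, 1, 2, 2, 4, 0⟩,
  ⟨458585944905105453573214737657990064359126758021864568211693326195907654050411772758115317478229348463004248595653813332813100691612470154246470341191169621694609457873338394896885417521680493702126685420573, 5, 2, 0, 2, 4, 0⟩,
  ⟨458239541718783707431282102841368829191957051523005484624179219331959558171467028575911280711656283354015896633112417279609337053256758229631910963605561013126665702032892520768976807714189191211892310420573, 6, 1, 0, 2, 4, 0⟩,
  ⟨1937464921947974458089960892583329425821176590375966679208201661205653439728693271725442634915391269110124708226342512721749379106411257700823196886758604704646448416019760610152196606926254586637745251919831350, 2, 1, 9, 2, 4, 0⟩,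
  ⟨1928573745767238216006688134572590691048061363377213232124472600522924303205224947903087435494375172461684914093988968768747236676640029275419851990654412386678687871136356260149376469038061456144581189419831350, 2, 2, 7, 2, 4, 0⟩,
  ⟨1935725519159550071542175567832459449192564820513126316016086990418667644421597707087423986904732026277158710856221049377598212215789130797907342743189157056883226672031389550466236544146768407285938611294831350, 2, 3, 5, 2, 4, 0⟩,
  ⟨1935717933666124394220672993126167160447361186276857186376869176597792457185146457452458266973631064466428405375722614808853129883061344451140943864635883962311005027396717725538373049968915449809322405459416050, 2, 4, 3, 2, 4, 0⟩,
  ⟨1937457683583170635643890354249686442027926146509000699532976787445635604443741138600520704436513796722981944436483996039821177083468158497085329347528612131545887722854218015642153621340232359599361467959416050, 3, 1, 7, 2, 4, 0⟩,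
  ⟨1936535167770304676124941217081694247800757873032651268812422173582980832824834106741051059049168630518066949360867494372813405548755078740785369636815289425139232033474670135661916863793569075297603655459416050, 3, 2, 5, 2, 4, 0⟩,
  ⟨1936535166811346119170406607270928074627375060026802077118546941318043081452109369494033196767510250731192307345424815065177455100620303307517701519737420738516285453996026621667887373516397940348873186709416050, 3, 3, 3, 2, 4, 0⟩,
  ⟨1935717604922972246176512286291209612021642832234675795786336621221772489202499570574403240754867539185547999167427994520780517491536919090722063621264139429768765220728891619597686873742469049190056755122188850, 3, 4, 1, 2, 4, 0⟩,
  ⟨1933758065969431121346840308720133019869698039276375415144234324046612826571867217702356680631839675396317079451975371293066088255737945354741782143337014153042479383906920911340683817237250165403614392544831350, 4, 3, 1, 2, 4, 0⟩,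
  ⟨8187805521129763526831875406274861989339473802862940283522916331170285548863409992594455266571847340424137346508480774761179359147872114247768491174032657338099081167155066596966381886430696137985537488239004451827, 2, 1, 10, 2, 4, 0⟩,
  ⟨8185833750629661615645151764575687482039712595252028036353090168687554255266934527883204185624967232182456431486697271850799394897461007399397411735546054230999295295922713885371636719269949207461797179826271684027, 2, 2, 8, 2, 4, 0⟩,
  ⟨8146207671276987842815464137441509989729231024498015476906552763254986313073782772513446972978810318079926799213299288316667966643765955440342566485426702919085229902375056850726410415432687113440953673966896684027, 2, 3, 6, 2, 4, 0⟩,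
  ⟨8182442040294176836905369385447044198533194349629375004522422416508007059994941092397612259619821863839563096476688492996587641038149893491667238947324367392123350191502896008298863092846508333838902892716896684027, 2, 4, 4, 2, 4, 0⟩,
  ⟨8187805581971097474561756272771667698632694159513357286532052193644864667763122543668577823629423775234588055267990240784878807621542579173942724349905783888028356748695821777009715780421771594127963025348379451827, 3, 1, 8, 2, 4, 0⟩,
  ⟨8185833750672371188382100445817068579195402113218480974109326459099220045464250238060664667260056315719651816273068768250307536023402281608497478815413057228290937223412194475568172278058986375487767638810646684027, 3, 2, 6, 2, 4, 0⟩,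
  ⟨8146207671276987431968389910325028698023529423518721098205712435245542053793606715595408718365714273444772125275162955238380699089459571290068169413369847503935344336109248560827823679488423476375066222795021684027, 3, 3, 4, 2, 4, 0⟩,
  ⟨8183877972287304998556875345570745346728624903845157970580672317238764334463505064639370570776563685438306410617848429545589540682886098937697486377950060556495429013234211575987943218848007927096806945451271684027, 3, 4, 2, 2, 4, 0⟩,
  ⟨8162338992391278269244882399694469581501820769637175855198677740133716034078983292271356310329811849703595034985966679593959005057363899810058595394595066077790119944073966303787061191456663618243657531388771684027, 4, 3, 2, 2, 4, 0⟩,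
  ⟨8185833746842742285254090838058715845008275357860217070837909389492067620045255990425167554918693723484160353779137240943483530441930989652508208466545841555996585165140267689164589468333210060752355041154396684027, 4, 4, 0, 2, 4, 0⟩,
  ⟨8194572565267668940421454803829417878926014954380296715645241740692728445078080426042823310482694303571003352212825423925268971932794081169169413651875133423661961176864068388878103743974078594666945466995550014327, 5, 3, 0, 2, 4, 0⟩,
  ⟨34601997955177004261100076291981324439528436045124542634198687321427181801322845017218962013200881603853603272963332682612471846428106307768365735699521508698799403149241480827717111789048524952920598866322629106572304, 2, 1, 11, 2, 4, 0⟩,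
  ⟨6370791951641705783626713259182181564197272246902273859841227974125391923264037140722760197545392781587639653726134298744078899177395066733881091797566256092271326361099139733336248910485885187650447246962676643461276275965053053908011732551476656124845800871817835594051779993188554, 2, 2, 9, 2, 4, 4⟩,
  ⟨6370791949005149006611893684189414289713063172074515840318231550140134958665019841484953001803772163302578910054968910669957139507837569297757117350049927586222619525348045700452282892956868125894167078796909761180613661104767315404553359124130538601361519607572325492733420618188554, 2, 3, 7, 2, 4, 4⟩,
  ⟨6370791949005486875118446184952480882509955567920075147918587456207854539638355214486470955958470843327056589936777777474680337248924694344817080016546998806169209416521658308841951250825730593450872165114192739631892670056959243810513943649089072904002575154273279929989279993188554, 2, 4, 5, 2, 4, 4⟩,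
  ⟨6372323550791767424525227964446799730696789360882878612050341637779346816253114270819259505419933771162246381446133385581222778649550750867921744356903865618461019709123783858440206211059249084343461025530229223990300688544992527566066055864348159173727805676727064872616233118188554, 3, 1, 9, 2, 4, 4⟩,
  ⟨6372306007569765492108515829216580963518904740240549993275981928791339099353587198007773437229870869973941579483364401122842128137449921870920743304633941978826909172931652809141352861754306638273293188020034391462671606464088058896425962272215657674946311811773546958797873743188554, 3, 2, 7, 2, 4, 4⟩,
  ⟨6360102479813456772829731973650333511423490546384655133484218236888111661142138055983730879660884792076791452160136535157279466971327233015522023231406301599788890729813151518981133036951125194749775769405242974039294362260290587147783407835680350148617786394836565528934746831188554, 3, 3, 5, 2, 4, 4⟩,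
  ⟨6374139145163093238250684797610135211397038562429153124023404962335300451770177301764355080286952611134045501029839358335242019935949384394656973064912110200386547999050169664110990278022032971456174432787565332458556246062444910141787747933799800649353292634381414126783139628427454, 3, 4, 3, 2, 4, 4⟩,
  ⟨6360078714023087479729046718747891350309247951356288333100217708609501704730713015983082317120371699022135321488839730750106168477963807445144463706662612020559114456540955331398375394073427062142804501513639840105523120881439635088211770749416239824199456585241914462476499003427454, 4, 3, 3, 2, 4, 4⟩,
  ⟨6372636777561472785488297807028536376056268180904329161801211990333678918208124316216228406194097310929785726014737007617651509057083899083413579240146499197499051590404411686213210736542607715574444035760429595578391320667805548242417279932885997597457670273940632479220053258114954, 4, 4, 1, 2, 4, 4⟩,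
  ⟨34601932090776349780926959160070671841731210834777949701319130701630011269016618960516073422454291051503591222752841871468099019482442645778059101169610878995656338373480419980458179817311341322454137684682004106572304, 5, 3, 1, 2, 4, 0⟩,
  ⟨26858735196245393890215943347167462532896611847297553320758685904673086571283681711332261128569038083546668031873511740626359258074815062388564644510264564197757060892389063540418076225669740673409970553329535402977301453482998079112794043919132453191888907642182138572457736799515200231, 2, 1, 12, 2, 4, 4⟩,
  ⟨26871306336241910554174871821962746124434778494831551736822073914821357027639466910834621095747211893851057078673814953981375348402130040874129504213363667351988224451086491591952802761352063853653075323350841888104805121481061173951308986913073771157422216583109610655240219825681970081, 2, 2, 10, 2, 4, 4⟩,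
  ⟨26886082803203144358775677885409781125688250410518609240042405447501055542744512116387249936904443292912401951072454280621747621533878829878008570264705566305068022262300271171887021209805282955122756080061919356897395552352730051443054123509093254625418674380506637479110270830831233831, 2, 3, 8, 2, 4, 4⟩,
  ⟨26846310143979527807079886414361983269135014375717490285101041159278058679561443026809771124127734028557461112342809151020847007430494716913607363281956387479151164951730906653599889292861936399171588486252936830989147327078514322829386584249491430483409814206675022934187561260085921331, 2, 4, 6, 2, 4, 4⟩,
  ⟨26897273859177194822978080286477384207646354564637487691217748790276180343769784171859172707759592027767183875862997956695465909848270738144883092376557250866882419785522160150682949354077809139506902281956297810105866598011915807292214448991680939920677902500211411096982163185056970081, 3, 1, 10, 2, 4, 4⟩,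
  ⟨26922920312288170800586047440556322223576998085924047967122308938570225875456291939209634041853674439583659508158419514145374528148938403320558333011473693795136799260029229873476574152844440553400218902170650365404242137240247374206657189450231328468432842946803858324623981022126360731, 3, 2, 8, 2, 4, 4⟩,
  ⟨26910070896272248972717941088848484222404767777552253750874268026807191089463206907086927890969952732819837752016587269378505993875111798235644619932276983354758400690710383863077198317077059304568193739847213618938684620096664955033731673587251729969445178886667221878279358135085921331, 3, 3, 6, 2, 4, 4⟩,
  ⟨26891201276660577721519635321754005528007878655664960247209224416764121276992111005454731167335927035097067817087777369804181806718101161796785492853742921954386314150566618813227952704290567990824558814109101860160053883447912702588614910086852759093041342003994017933119446025710921331, 3, 4, 4, 2, 4, 4⟩,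
  ⟨26910070891155922542683110863910154525960717336153293421797804648671444991420022869257066039887765640006786858735586570856233495907541964339175297356060269317968826175871224610096654040864347740542242368131312633019269207501182965612393481202215837640530181835197240207899719463210921331, 4, 3, 4, 2, 4, 4⟩,
  ⟨26944163313065392652923434903441747872487154779200523553770887572495187854257138471111668855223202859426965645029782825259530413827699930815112447974681355450940474221065317997522735002266832839627259322699410474741655934963329794751485106878887719346700279294304877613295227275710921331, 4, 4, 2, 2, 4, 4⟩,
  ⟨26891201276663035677004624885139311630921419887785456568167568987378719716555842904809790248676898446284498496935686091393104303056568415210508042710273111790268031409085620046169788299941843747103097909319194093282113254460726777327332309788134899349394501206256777141798645244460921331, 5, 3, 2, 2, 4, 4⟩,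
  ⟨26891168899090399917911773667483360499716055452112402643574325292415680101938106494097235337556580174333414500270300640010946935312237870063313164178235764967492161021102414344586401775945596835775967144334564029859737719922778760831397852879745012529362312653825014923323303447585921331, 5, 4, 0, 2, 4, 4⟩,
  ⟨146098756923217984675175452406075549785533986882011274358116860509776588218081151033331706135763190718155800662405560234092629447173592021981925062452255689507023372711725889630735217601852232800720016960812288933882380581, 6, 3, 0, 2, 4, 0⟩,
  ⟨618266380576740722550144327895518678853849272074352676526785258739871497613479853502240714175054693929104613937628238460139338352142924341871038055441488815411043506528774880430490123732926566538706793316310669176767067541058, 2, 1, 13, 2, 4, 0⟩,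
  ⟨113832892079427963320053486725547959892473220933655568971864930011168291924548299770019342542069676399406904533389771447739153301817469859208338514598197731972122664651394196434107943274545471787752416199906610330003941979976122120708050668739233333512018527354333915980534376710100402282308, 2, 2, 11, 2, 4, 4⟩,
  ⟨113670481971262745432387409718225891465918152826495330293035947892042328435352987750704999754669130068749923534795062007602001123032591432130642407265479617253063550046253794598750847694678788396454577630841272065263226968675427339208546490310755392813192140120767423184590162842912902282308, 2, 3, 9, 2, 4, 4⟩,
  ⟨113649674070409290845535807688352632388426552153400338519524544856610142763222153278681687231914595755451074808966353682223996821962823019974699416812193679374983583036276826491518024144882917759752287922050860335324393285909410337435124096253117984919512702500318543286995710938616027282308, 2, 4, 7, 2, 4, 4⟩,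
  ⟨113860206071231744790552386532278273188570509499987136505122043307067405744703687500210846871014220510820111253551852711933967438598636472159470687429996271842812580446794465825825138201606731911961693641854145981218674604211989383580067712983486914265697061519707919331269087403459777282308, 3, 1, 11, 2, 4, 4⟩,
  ⟨113732396874378868770108311990530483238267756463495341035233471850683522563105817134835578697718574272914343868987572117227083842441383121338831749580812324163847733637402436914149117887708197322053857467018237671896979434912732642691278520320442677967932406200665415497498335450334777282308, 3, 2, 9, 2, 4, 4⟩,
  ⟨113732396803393248179809293302309828131756604556415918132111146548080697830377731810256628833809779096997682181958868454602014112552002502998635420045856594757617428600934328665037651271912034719185206631210830027222625201944223465767491717025158668804763858016334840329365553467912902282308, 3, 3, 7, 2, 4, 4⟩,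
  ⟨113704339768355196260684057220438772999948504233880289270230175583532221512259648398101625264296682102167745177859097260312717784400747780378452216503447212641719305835947649952001217973219250081939599952379238753750420403415293021156134326601931460375291415785967562778171518259665074521208, 3, 4, 5, 2, 4, 4⟩,
  ⟨480029256622381660050510485938728074920724033765574654975192570084972027392697349627636208939064037566263835204779669944639046645178974161025456538310793219520791679311151542346882186705967457095067066366089029418279448518807882828563936843315127772279940405500275787257751092428436824386806685, 2, 1, 14, 2, 4, 4⟩,
  ⟨480028552281795668758906217410924154641541160876507042319062125820730145021336673595039722190706770853125953507217058396726239189229993657085171895872014852898532269375316952963933794569301253327999246696913413769130763237251884794198142959973440267373448382162570610002776250356903621261806685, 2, 2, 12, 2, 4, 4⟩,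
  ⟨480028497408843521864085442541735298345948437127751146121638354902553027946182294329808419215912731531811210420097580052090491534088203304642817885566113501380724433452350896803188387065788104221151429406502645459049126187637351114537015612567430599888088000628960557573636636251679011886806685, 2, 3, 10, 2, 4, 4⟩,
  ⟨480027783759217181254276934025190264080724154230819092160288771301204701824196946966166836033556180934640670969675589796356256208996705159323188353240417243643415008664395395951803806464607870559763963729396583828232644056024904137280088970412450140754774232042400970759359757785263455775579485, 2, 4, 8, 2, 4, 4⟩,
  ⟨481170459389171404315748725087105034723680708758473638693637143309509093808278776344416979956850552323859562667361616643580684655067891420739998569454067874843739353671158685571256355657855492385682090207871035237549090350475151255724512833675832497093019430625537765504022702688446590011806685, 3, 1, 12, 2, 4, 4⟩,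
  ⟨480028524718316619614128055256121453542064277574891572618450540348569007361058270589535745170876952021361628251305040814807434825489581684922497910215129972971437593688737035252924545263777515934045504473778335426545004412858493979609890376040901513896848009031892277936009328250351346400579485, 3, 2, 10, 2, 4, 4⟩,
  ⟨481321737547158429970006486274567245053939640568813181819944871463697030648356049556701876746885589926968086978573076068608860859159198515622437099556953388239696488511041773651623383762359368132316946394939193243652926033369125170517399345892893697705090496007251775527862470035019315150579485, 3, 3, 8, 2, 4, 4⟩,
  ⟨480028280123281315054453113645020414824747354115633440850697358200698054266233873678874053584666531187635047633180152372781252958646265388413924595374869700103442654101923789121335123908057193640112313851097694654694473654003285717637192983281842704077753105017400801817444722537460721400579485, 3, 4, 6, 2, 4, 4⟩,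
  ⟨11049849842685403581741849807863466145253425725014108698261007189621300188548107030495029513921268352782434209068340854018823133005015953450507387328205865464388188445212899978509862082172573336771567879332778330885492911904638270912, 2, 1, 15, 2, 4, 0⟩,
  ⟨197436156353986013419313485771061055197189396584612884468779259513635233101642341924843987252259463649725455423658390897629294459996752383549022500774569429462093018437390115981944630115073333247806666799203385810952097571826529875354091216, 2, 1, 17, 0, 4, 4⟩,
  ⟨3526115106828948144181295725446087541296745569056255672132019011601801664299830680041102059555563849167189851271420026538651155257607485852235194211762747343185262715053137298371374277352216304749217748824960198458766432628554297375295568223480620, 2, 1, 19, 2, 4, 0⟩,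
  ⟨11599920133034950698381194499631718910605770026744409692565187359843952319714257731116873642718149980642403214269142742742769060582002454657426224298974477183482486681307898171447095319752203178421429451574333885609573894377369826576315084705092666596288864120319119383309297040754434413759830777265490231099351154543424, 4, 1, 17, 2, 4, 4⟩,
  ⟨649046436777809135398169487121533705509572744865751354802679629530303594299320018025023546078029732407115835757497846788290549890678221691266768379043754017926489116731066566601287778428330518186123655440214783316751833610630072690094128719601688538522052717074910349815228269574827466278272230764085382096958720, 2, 1, 19, 2, 4, 4⟩]

theorem valid_evenOddEntries : allB evenOddEntries (Entry.valid 0 1 0) = true := by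
  decide +kernel

theorem covers_evenOddEntries : covers 2 1 evenOddEntries = true := by
  decide +kernel

/-- Entries for an odd and a longer even cycle. -/
def oddEvenEntries : List Entry := [
  ⟨76646403880439954564907211094002798035990978058063396902877810777986003436416394854969944836031205, 1, 1, 0, 0, 2, 0⟩,
  ⟨324073960472881032301203706224548777045581362659632109102245062428951558971573723338391412133852600582, 1, 1, 1, 0, 2, 0⟩,
  ⟨1369874445065801406413652305097265941689690982177322072728565561030670239747616150194096444762136638891059, 1, 1, 2, 0, 2, 0⟩,
  ⟨1370239707179518857088440179447205178630299019614489456462914846682551860815609673531014453635883457169959, 1, 2, 0, 0, 2, 0⟩,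
  ⟨1367185597904111641141898848383061366396470124391082117054014702427823585521328354747254382835102207169959, 2, 1, 0, 0, 2, 0⟩,
  ⟨5791968829986342101705327118133495215647028369166593754131634654542469861082353263550554560442939949509381836, 1, 1, 3, 0, 2, 0⟩,
  ⟨5786250224087160252501327298934650639866026001624118991923420278903990691364757958852802561541572762009381836, 1, 2, 1, 0, 2, 0⟩,
  ⟨5777833413581778977523401863164316020309643804205164905375667029290869559618642861896311091204658699509381836, 2, 1, 1, 0, 2, 0⟩,
  ⟨24464748081908998207488283213416077548434829005767804896752410067904553716850095784143011529419649315533036638713, 1, 1, 4, 0, 2, 0⟩,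
  ⟨24435365837654882918499232569412256265665597055962854649088671679322267166772531950844887156460512352642411638713, 1, 2, 2, 0, 2, 0⟩,
  ⟨24464747732389516018047976584363422262693972893113422503906829801154214031903536815096947808239687157329911638713, 2, 1, 2, 0, 2, 0⟩,
  ⟨24435365837654882918547132898671709819524979275865846873890009233977827258518646995167459804985750389751786638713, 2, 2, 0, 0, 2, 0⟩,
  ⟨24476563930181382745840614733026781065664907916407418806177809115118319868437181229083678471356746698870171299963, 3, 1, 0, 0, 2, 0⟩,
  ⟨103112395445595478292426323102754359567076868041272478993363849197225793104123775106220389942007411350125473271199340, 1, 1, 5, 0, 2, 0⟩,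
  ⟨103341185240523137195923435993482013190279890733694387509279307548075666925916304060006994309203971256131332646199340, 1, 2, 3, 0, 2, 0⟩,
  ⟨103413870625886628537529079288726839035675678534157236784549297599284366552957622084999866152482379306668442021199340, 2, 1, 3, 0, 2, 0⟩,
  ⟨103290481111083839553247194241611766225585970225971374839488932741744866217813999892873639690058577884549301396199340, 2, 2, 1, 0, 2, 0⟩,
  ⟨103488948539782055889982120395425017099473698381800732909643651751149626947736282806160892436581004489773910771199340, 3, 1, 1, 0, 2, 0⟩,
  ⟨6065735725849108860660679868136348022415555716168041041301562022145158478470447203430494699118031549243274914421103853267120369471263408217118320039049113064853472223079636813437145015739060081792, 1, 1, 6, 2, 4, 0⟩,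
  ⟨6071733810437720617190191059263384935894342355524010016140974307771827825803997944665940471290193452552120884042579918422073048948383003267810412442449374441315157581539609289578343964546933883192, 1, 2, 4, 2, 4, 0⟩,
  ⟨6067097322523605968389761932499666969635380056611355151851489474354942912051167772316671007136299517648122664291537555245595540923447140970560387434709203773001817806926340616158391571968808883192, 2, 1, 4, 2, 4, 0⟩,
  ⟨6070234274328668297383640149805767150152747842214710680203305745334183310023428120296297108740363069256652163498184628492335838164304840419465481805346839976015971386641979968956853486031308883192, 2, 2, 2, 2, 4, 0⟩,
  ⟨6067097322523605968389727756694058883023978292099544566183647344974036883543223806570682582602663725540923660293912803614444641631921153816478869561372022249605251544108399010113622284859433883192, 3, 1, 2, 2, 4, 0⟩,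
  ⟨6071711799030314594706706480569694263928591904317126738189366028657036391146066532718738955593745685413543120112948388127261563702789618007833741153440454023330730250291311002186681366890683883192, 3, 2, 0, 2, 4, 0⟩,
  ⟨6065644935294525578456598706164340863662320289914254479746045193118334158002081019766248478825175183917373117506533474733311373810436903287834603057931536944328954176581249392441655732125058883192, 4, 1, 0, 2, 4, 0⟩,
  ⟨25645951140767937178661746917438916361501212080533133815139990319828447945908168871919656043037628733516533884296455502060257742656086173474977915099229967432477400290279863308272615971944334050430069, 1, 1, 7, 2, 4, 0⟩,
  ⟨25645876886853663270744736394172380991538664919234405439845124705718283006068608894742358933486921026231006824852000601611254975123902909722983733127785954275242124832855868059299246373555662175430069, 1, 2, 5, 2, 4, 0⟩,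
  ⟨25645951122940098713835200483050853252830425875659526789099188289958124024531915190192578749241896932886701051269868657659868230873917213096544994912315692680844597372468658628962294164083005925430069, 2, 1, 5, 2, 4, 0⟩,
  ⟨25645891637595943312350210531166658199178699058520277054700940125734059974900665807053545718751058502619351791995826202508753276482650200850555677058923989153067884682512474152348295750997068425430069, 2, 2, 3, 2, 4, 0⟩,
  ⟨25608269796562976004390882000725778077736918366764601050801317190964192846950335976121336905927337630203298975911043673410286358147664906198175174429233201134066638370766984204850451054952146550430069, 3, 1, 3, 2, 4, 0⟩,
  ⟨25659406395843408304277664609262710450723411392875070828210366865378156502197238667773709439820097513605800436147479224641769334394691222259463350402108676997221897419420517887077585759541990300430069, 3, 2, 1, 2, 4, 0⟩,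
  ⟨25639910458040224181403242916204982789604513693574519274144904825079127952884404969270709032274070351626147329170014021967036832032734678719394937424251369339763078879967313165865198674581052800430069, 4, 1, 1, 2, 4, 0⟩,
  ⟨108406805915663101999109703149539273512824659912416879106649543844984132690850284862084957907768359658072774399538759764891998404430382311274236983790742722075750964167363632300878128873900598559643539446, 1, 1, 8, 2, 4, 0⟩,
  ⟨108464071808503133860325990341154351935812034113067248211037988179576878749693483713089883735578737854232762515749235263347709990746571605409851666877731049832245640802065678004184923040465539965893539446, 1, 2, 6, 2, 4, 0⟩,
  ⟨108012649490806092618053955909290220435016239661415704168745604514838005570720240533592435009349838914544557972747032878944224021011269026714138727512054840882405431729475308971489033567504114184643539446, 2, 1, 6, 2, 4, 0⟩,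
  ⟨108489985651715766020711439796699563092633755337343868472716590335157201089911566980305934691839751816624595494060642266710937956890394148732763433572424308540782905369505384301776251661376184497143539446, 2, 2, 4, 2, 4, 0⟩,
  ⟨108463922564389045927485363741936472807754146355097682934998612584823993013539377755337389484894428692384979045578095275716565954501372913063907990723837698907685949906644451262438855039672082934643539446, 3, 1, 4, 2, 4, 0⟩,
  ⟨108463972188597576389281819170706235722134980079135300840409402856650256559349746432785619554117336745874904758715315712105364166400999256955448575329703073916698779727775614306340179311827844653393539446, 3, 2, 2, 2, 4, 0⟩,
  ⟨108221271117973977871791681462775176389433301770138036096931445622268712146276631202428108063033782330004831081352283022085503162474782008770161552319213859905089708208160514773810467588500207934643539446, 4, 1, 2, 2, 4, 0⟩,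
  ⟨108012379563750747913197149882662919584533637830700436338979943222691009752753716555774339043987015764014285440272498325825377846952953656300261868458764657262816505040527259412231109010771936450268539446, 4, 2, 0, 2, 4, 0⟩,
  ⟨108380879398570791482623847727786310183041327739690390867265428663815330407601940955474722221277409673668120168377536376325753336873504066727018847600725583532091205968762947891848347055510705981518539446, 5, 1, 0, 2, 4, 0⟩,
  ⟨458241254431545486479480050226987041255313316567014799016739174539723384936821919422572924895136723449191127744042097236834796770109997875755808602483153673083519249117719430328627364238241162097055995773823, 1, 1, 9, 2, 4, 0⟩,
  ⟨458130680351072622805641139113121219197375868727453159535924853166329072944879815511958972757231329115552965616907884450192598864417454820333392581248229669185648867610146173943114714225271191393930995773823, 1, 2, 7, 2, 4, 0⟩,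
  ⟨456577654659118936990545268931873286686048030751985728586741612704510911135706327681699885568505901468817177817264702381203425910154994065848088591475311780289313864020036082989001893897989239489634120773823, 2, 1, 7, 2, 4, 0⟩,
  ⟨458486761268093444925139555414367601517783599340215312493547941027847952193996886735615250558300220707228590694153972813359264840660281045372696917366753937264083781019470909709973508020379986559946620773823, 2, 2, 5, 2, 4, 0⟩,
  ⟨458241254431545486479480011111025882580413292347665338171478814354127956239570370702759708803003760252245694098855765970619463849700875851129232930787852846665298585867949843928265632589796032702524745773823, 3, 1, 5, 2, 4, 0⟩,
  ⟨458486310401084190700099086530049971916327785115594329593391630225260017956296507943573368808256875632866232168850318802573795617170396531952587968315150910652051193458296841241001398762205090319712245773823, 3, 2, 3, 2, 4, 0⟩,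
  ⟨458020468041995053906076744294541780566905606569381472188540239357533314313502414253987160531701550088485950336151143704227882952815829469403541733390206136700110336121090715719667510589101757800180995773823, 4, 1, 3, 2, 4, 0⟩,
  ⟨456692581453871036741351274330479823232234889602133544830716734323303215344957675718339165466250868928121941910272802754807481416506151175279601443370828351573658561920828281186452382703760113513071620773823, 4, 2, 1, 2, 4, 0⟩,
  ⟨458131707289783753699919748332162280762674770074377321692467326633892487717524792829827088909048126332265174938766065207766883401099561105887707074337322669065835842034667938182362339089127165387268676211323, 5, 1, 1, 2, 4, 0⟩,
  ⟨1933697429628050676879546161130745532129448227650300718093966453027493741085530248684952856686849529527158574396736031471808765165515112838740660317190568943369674004772905609090115116533748382324938460043206800, 1, 1, 10, 2, 4, 0⟩,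
  ⟨1936542400659600316453172948619660348983905938446774297357832423944542754620015247571770604336756015950023009871145111791051967120359573305391501854330291890291412414717535790603253212961100191442648094130008200, 1, 2, 8, 2, 4, 0⟩,
  ⟨1935609467646201941549057024362767881781478448848170231411060181669932406479738979371934469132439146903343711611871647475398043683695140506062051814321278164559032019124735432316695542541882915741717435634445700, 1, 3, 6, 2, 4, 0⟩,
  ⟨1938046376026553012964922248570769033593308440412830098652599249251553973929323581826377052035600663785936222346781078852364629025819353976436109209730423097723183161502740341691353046538971514074484031630008200, 1, 4, 4, 2, 4, 0⟩,
  ⟨1938050646010327726819021565817271512684491171902172421084152382232924151498113744174971056027544357535160769034242496273329990145196756233588218454761496155497188747111642845058552657721183223969256498134445700, 2, 1, 8, 2, 4, 0⟩,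
  ⟨1936542400659195222371301908379656711554076618644599352775484452159913719702480183903710310385212189288781273825838192906806468383805939793862612803099483226715671542887448827488581619692585392243182279384445700, 2, 2, 6, 2, 4, 0⟩,
  ⟨1938039144844695804688959333265249306171924521750472336681847835047805813938517747033080255919957619925210646412062517524154302647517702812637771521443492000571863367992015644605883599726102276093279935634445700, 2, 3, 4, 2, 4, 0⟩,
  ⟨1938521744501080828198272408047989014229785242108979948292517030106076702849075575533932615854782311720639685985353226143995630139978251746020172660045708912521917765305994459029281665774725527136007469130008200, 2, 4, 2, 2, 4, 0⟩,
  ⟨1935616698828340318291605209986476830357506702761093147977672091837081487937659242913365145484597818896304405140089148111796227811898710650076924775881366708707481716781923727668866368477783127075945951259445700, 3, 3, 2, 2, 4, 0⟩,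
  ⟨1935616589264748977488871522503486084031423981956999415458659454083020533406094902208622116248274965342217757379225912961352030194279306475467349713123766651878755773878477361196813026910266800171649076259445700, 3, 4, 0, 2, 4, 0⟩,
  ⟨1938039035281336181032530615317167341179710242116086844720181877542114134789196010175971516413077063920193449648351326793172567099998604143660559862788925505507171748471079927614367071074983997589861966884445700, 4, 3, 0, 2, 4, 0⟩,
  ⟨8178242943776154118961943418241431840919094483145125771368356436650923848933027869453108157393931795391160525780435674074955168600254895196043433487367885449378731259827646740333113732307543431284049481681477077277, 1, 1, 11, 2, 4, 0⟩,
  ⟨8185864309650248434782946573468046938625819634527556214302788663981558515398779254773142688052649628249626546726786301671187174410699518575808418340929701693267557425012353674306579907053708093730243841349745242577, 1, 2, 9, 2, 4, 0⟩,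
  ⟨8192218605779062871686979742944517801621268342406290497328100209545876026325929038665783963291871364831675449305433507102877285305740986438655678590623093727987530643195729015135013670871592121688160101115370242577, 1, 3, 7, 2, 4, 0⟩,
  ⟨8192251131525851317310270428071237932201533783076291725315501653910893723313268224235909712469700296799838330558309427412892625878011341355459615524874878088542879399352586096968791227183862584201130071818495242577, 1, 4, 5, 2, 4, 0⟩,
  ⟨8185880963240677752898333498682910608727179464062124950069430627342762127613154494867235743590333269340618361460020594328946039093977988838816718931347261734532149071663214775215548999469353817994123423291402805077, 2, 1, 9, 2, 4, 0⟩,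
  ⟨8152195824380360112346185452845194729839508583025282963571200005966557368971414955658863651660881429458394188272687653562198445958607749186276163019329605702137251740358863879295852004062942229802137339307027805077, 2, 2, 7, 2, 4, 0⟩,
  ⟨8192279709268119623396428493034468046864213650543292298899502810526944262637808868102090503459319779965389255888915246984308632318485816643011135087990565886996148973677861134520610195679216646248823130322652805077, 2, 3, 5, 2, 4, 0⟩,
  ⟨8192271270368106699600268668435233132699352883853626545441147990776405530492523364165620307469922473283537138240675908198453212498644041016204508082223381106625312581507719274784078353761321865612989390088277805077, 2, 4, 3, 2, 4, 0⟩,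
  ⟨8152256923927751884438476041217326108533397675072783058994970417220487202121989256649744382380124897990433054906347404374891995457224840113920995683550281101984527648556938180521085288703068160111432993603902805077, 3, 3, 3, 2, 4, 0⟩,
  ⟨8192248694617470685210644497673155339908697147732597492057537340693539015615203461073426811223364449893030889482954276073391088942426937784352122366294822905331378376433633866357324424527212040988239446818495242577, 3, 4, 1, 2, 4, 0⟩,
  ⟨8181983308454757928699079641159415781343334022741513785184646697442761334707300877099899205788324743859949058300281391352751523340262958213019191413904327864759156635085085225997174549476801412669452825724745242577, 4, 3, 1, 2, 4, 0⟩,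
  ⟨34594123703184268028843254880414339776825227772076172884747942312773257404515146322854318161432602352918030930600186930920591861490153180114033720245130107004387724216324410792644443742401889840425454330970023282800554, 1, 1, 12, 2, 4, 0⟩,
  ⟨34602061225708184831386119319604537050324062574074460815780954549799152570041134278873629209947879707538719823772659846635264901761603495356512809350037360648889766600960667961334313897768124900849639699900360494601954, 1, 2, 10, 2, 4, 0⟩,
  ⟨34602061204321622257508201991817868197602437675802207139266038337922809716290089858413418631015572012067849365141821341210861966202735731682664180428258752280990120274668531983081185583304586783142864034617157369601954, 1, 3, 8, 2, 4, 0⟩,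
  ⟨34637814786208844133973334295907948943509500338415237687458205301443766468013117827940737561911762873994576381957034133358669367959403768359809007504493598512026921524060718337286389893788734721631253295157629040363054, 1, 4, 6, 2, 4, 0⟩,
  ⟨6364674793449565055257973295217478020883339819274932547402695870613880741814329201909781269250588512554653951184523584863350770512525122608264823001905056645771082682721208654358996627904296898177431979114737843873327103511641516329102243849719062633314403301086692514058104077278354, 2, 1, 10, 2, 4, 4⟩,
  ⟨6349433155406498846819175389660329998998951935307668247779098670666319104320010851643701660876264728870260735941818747556833809813217320730734773361862431435748509142110881287269180492495801311398966901074843057814200882924510689703336823703844178249939811011758117379780760327278354, 2, 2, 8, 2, 4, 4⟩,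
  ⟨6363523188728837820025473375078763987761247627430145361207436791602942561389348031416836221094413980280135880099535039609349935208532140631840962149907383268627080409336636868866653698203576545459926584882698443482425579780448656642721221827835282762182411333527831735249510327278354, 2, 3, 6, 2, 4, 4⟩,
  ⟨6365091342440813635962741182483719348650581871551676039391929188827012226146422265716200226177626912895285379379507777315469941077299030836328918553787087735627583551258383057754052935609738287753123175848246956165366120807530935282535008440622258785608266251877117658885492530039454, 2, 4, 4, 2, 4, 4⟩,
  ⟨6363567362896283024516304989993303592577003225667445546543461700827837593442753619732513924905212157410834120892825754336300085926111191785744423978588960877146782353163504554394224602149281281150335810079467240210615135060205279430715346606032577892348910453513432050975336280039454, 3, 3, 4, 2, 4, 4⟩,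
  ⟨6365109615461059933696315630001493915188240465887295617842320886244712518401555225550606033441585275651027579232644719024643905162770657282640865203710830095634303789771322329462865451827356998909340149803756077886626009349121399011160003239787907159281586999789047743114008155039454, 3, 4, 2, 2, 4, 4⟩,
  ⟨6361710137872628219134717968791244598496682003522116236005024222541821000146624274586675608365503031455483411282148014000720070127724804571832936991989297040335843680790569946904683652173600930840853824500421534599229724427215428361176945776957545963247643450103164131590874788186654, 4, 3, 2, 2, 4, 4⟩,
  ⟨6374257583586714322060377879126133061596420541857310292736269712840682334358065562967803327433202974947617227726132887976860919971086054043869243882941152624283281892127408166690224220303127170532254415168097229035008407397393704541340008768128010797814230941099402875336078034726954, 4, 4, 0, 2, 4, 4⟩,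
  ⟨6354159933712500525891485612973871838846638026769352493565590073913754765481827973606518518417983788034164015453732105385988915398681240337998817218291446778978266048818526088784864189063593279946312134815905539956348095240990803404808151674259877084259940127731960108546754731646954, 5, 3, 0, 2, 4, 4⟩,
  ⟨146094728259678547091561028950696076792440314914371485630110552703600000454876477465745800981479349805710983847759927098953160299372777140015884344337319141985875263860522687454669390038474656160810315919408710465469841031, 1, 1, 13, 2, 4, 0⟩,
  ⟨26858974443617689509594987519036640208392726331065519229935407936776902302958960426444018956112211530974028825231846307643831072309664401811567189733173800899980712390521331990310028252455763994742160096673656693947862973203597201910585679434170325181826359633114911747196516381134086331, 1, 2, 11, 2, 4, 4⟩,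
  ⟨26839502637103288738658405832253577084448058746829878729429738154805355969629736687853535916939114134370886813404115979913640860107589281133545922531313711507255212580002032877120612793396241461814393398799506923851623713100175608092527786276501133728929875226449944210270246849884086331, 1, 3, 9, 2, 4, 4⟩,
  ⟨26839502637100054653872848694561899119724474121812140984529019111676658470016392123584563276008853542438177490202499360720248439468008220422200508182530029717603805658690390825397735076133365701149339397892648015858194688971148610067281431407556579900260789011363662910679182396759086331, 1, 4, 7, 2, 4, 4⟩,
  ⟨145627897896098456944647397627526450735900060683856129262162595464994573289853487144050061990922266570804891521616452986713105758283823246002706656670138425609014390063573167615263943412725474514690870472268157719187233531, 2, 1, 11, 2, 4, 0⟩,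
  ⟨26858974443527299389026378020723615200893713948416563678450960657029553990013773281134402716757162718367316467212618257208020459296340912696656535178524987173374548452425711767119635998109696338933748954033055256497911264558640092029384395830656861876791612169463910293796858178009086331, 2, 2, 9, 2, 4, 4⟩,
  ⟨26858974427800520709700288712194558968757812884450641200968725675347861261774264506393513235697694374101657902572993119341051845395735579053355870519078458071029615068161020525860851603128770485241771262231480164479716615205457622265461519735571060836450800573211886120060285912384086331, 2, 3, 7, 2, 4, 4⟩,
  ⟨26846226906155356217129357991954462524019383994479348902485091545815283136640446699524894972733453024853483476229661470080168057630540931197656456007794674436611281210459652270856068648933623961561174849698668894893341760404421719972566971533852830818164096720275260639408430443634086331, 2, 4, 5, 2, 4, 4⟩,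
  ⟨26858974430049476777801622491282832290788443928522927575934920056261065121886186639085110153480918401137173115435755736648767163793323726932460330371945595169688182757390129318146506522771853186367848189734347553629156741696613926283723248821319140462678791530188895893314680443634086331, 3, 3, 5, 2, 4, 4⟩,
  ⟨26892592685807034036688396110567921768736220981655939340123667379021012699988603695494760453099283973647913465172430146512237910998356878002291385746665444093545355316341578555285931091110975042038100924294826613507307392239907571020166636914868840564581361894818240381962558666506742581, 3, 4, 3, 2, 4, 4⟩,
  ⟨26858974430049434010109716587164129913132538670036358802283855426486310971854672997083197123359991122393051610924570214405510473427642400575017294909709337532062357246059896220742932178467213119695169058131805429403685340107468500344569932582546955986076812999081589412906965599884086331, 4, 3, 3, 2, 4, 4⟩,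
  ⟨26839706402826738413179001731786035947614341945845716809540575210761933096322426172584323760541301156283343496641281905801316033864655262077199752952197025392241156756562228447041047769565971631101286802354682195172646739475999883671242840032528262505964086883628755193231710928980233531, 4, 4, 1, 2, 4, 4⟩,
  ⟨26826254728402448704285458450295254478226762289191995461571571814970301043239360550887203395517924440747075170095007659565879357811582441710802166261380033941288797174603907468712924032171771708136222993905752428432783176536629326245346908540996277255302339334356305228414449263400128681, 5, 3, 1, 2, 4, 4⟩,
  ⟨617400010461127869783019255105815775508237157992137767489754489917222037025968900485504019626479417489701060922788622322246380410020249130350040504726269232073298660632237819513030079078181719748958321012244319859317493769308, 1, 1, 14, 2, 4, 0⟩,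
  ⟨618267647419917723284605108404324622003325859108602176201819534603764559513442102056866838009499934406967118218006014032746974224145944120966352148533712711427856963384695078239042305119477068816482044281597114139353673008208, 1, 2, 12, 2, 4, 0⟩,
  ⟨617974981576469362030485196900229709221983221023927669179936208791090395836616438303900657348399100625207092460844446298569936831304122365677364988640518025710806870315841401314609133672683801793314471366043067508494298008208, 1, 3, 10, 2, 4, 0⟩,
  ⟨618756248661982199163032710972979061003985061203640791394657153938033243029854972660491912141041858644948163749334967869300423197503176139839875653781586795109917805193290231804188801208021905127966731311912513309275548008208, 1, 4, 8, 2, 4, 0⟩,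
  ⟨113696533870848455228542831200367506298811096942306907708003675975840221564306264702882991815347968195894625738093250132148630481796981920924377341056330048044949910513120196911725865169415980171083393713648409603658537053228103232866120580099173360951358972541407189423985019846922015476958, 2, 1, 12, 2, 4, 4⟩,
  ⟨113778179211259550809730159118482225913839515566481131460391313307326930205493965992262482893337097980103606855241142391415021333043947103719974807299366286602527531850501238250602085814458686297096713514646270882972755124405936012107092276652057791961550240234634955106104203323907089740708, 2, 2, 10, 2, 4, 4⟩,
  ⟨113894337682263252138293761700465306937449761839158951949680802004342567515889887900915929169710383180479104304769632598437600210607305289583106576028321973916980640801679012828773758721873284666990307169365469213841635167582618172655546522853524822734461167654722436423248783274656390476958, 2, 3, 8, 2, 4, 4⟩,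
  ⟨113894260304849870011407388037581920370445590522980027860363470016140499298082174342343365460716187018511479493453283448994730916687238308551703469218696962635307075773567679427185010093096765564333596004647382610439149307337481221353859817001736174475692365112418602813530922576861106465858, 2, 4, 6, 2, 4, 4⟩,
  ⟨2614083587454821460344939107475495641668815539654052960502365798801285078863890059741167571961588892315180227329779751477333761220135292607215736439804393796535380328607359681098898605380425848514446499255781677949906937888847785, 1, 1, 15, 0, 4, 4⟩,
  ⟨479686018403456024176994386143691838030497689726055830572543652193769827396002388763766215242399520853406544950654976197109072669500794287249327586705464488734062166742997656176490736528217883235391833883207514157435054924724706859644193748142631672410201309270578623019710131651744127283305085, 1, 2, 13, 2, 4, 4⟩,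
  ⟨479686018187439489825758505825972460585922148571994685701129221985396217633293511177218012310332456630689008477027110239556283433340279816187072525064870754647410229243869351313833626245507882450384188326147297876112522978494522712902342100784346233438975309121761075422719069487437486658305085, 1, 3, 11, 2, 4, 4⟩,
  ⟨479686018174342270835280993935016906500684314994499063469627807090025013298623233730447515123729395502319574543938569071463736470720658304182193207985187720279190613799834600041760557973674714497985618792382861534279094545746991306128981539451252019596166069953997340255036898619517564783305085, 1, 4, 9, 2, 4, 4⟩,
  ⟨2612827664937805954213351264312538753291312379241397153287361487953847728945103632051060843350907860343600944374257651631412259841791443680548830676709157191084525776136194538320892265270639958663264456673708939905387274906764785, 2, 1, 13, 2, 4, 0⟩,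
  ⟨479686018403426022336882342663195478429115235670360335396718888933753150660772723842671950403082910324565966473970469861192654804097590376227749531008660814098641557962962237661526238399391333618252044589090316071296575730503522493537176890477528283424484561231966200486376830107554674158305085, 2, 2, 11, 2, 4, 4⟩,
  ⟨479686018174391518303169406972203853448015728664323339472600690903008926993211347274550273270620112936710257931465387913922655104793403083438212280239806343927978176389700550957794176008046471578145551432816214500792280651230469232010550771237406281106001875508755166285291262633189439783305085, 2, 3, 9, 2, 4, 4⟩,
  ⟨479686018174342270738701806643200786204362966071722429578556092205220910640943452398349162555044655599451295096673172768022286179375957528705396074917506465103854240710996230382683825821526326097409424437739846700438894890968871498069276068236867152555907017125664698161736079222544908533305085, 2, 4, 7, 2, 4, 4⟩,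
  ⟨11047258566154373540705564771877592597491270035121700735935701557760688572116339243251621823379909133673503914063099902388488128461765477168416535686650471861353101441176578481750274219811477544917270447379780850928416254093658135262, 1, 1, 16, 2, 4, 0⟩,
  ⟨10975056581633016973284707093598043068985850591397120928794977447542448626055075184880847189515924101434137664862542290936626332723809346601806529693964689261861845947557707020891678612470451410254927563748149423058981093420774374162, 1, 2, 14, 2, 4, 0⟩,
  ⟨11041936254923255208053512562425296568602553870354031334278786480301821935791213352169124394624421851249161373230953861530086839945771067766317187403517968155847691100468757367620398402367372833301160456776798593094971798757007664462, 1, 3, 12, 2, 4, 0⟩,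
  ⟨11055964642221107901608440969294507314767008946356531721637237548389253882894688843466629441686464943171825235078104782426530194351502752519887477333727646418902123956859220031192266524423413928237223475171432720711854122975757664462, 1, 4, 10, 2, 4, 0⟩,
  ⟨46685790447258352926182226548838906787813800951443291925111319961936146222448238567253995321316326474377745995296000595254385913645980797567692893984085100465970343196898650908892445063830289672198548373019933036200530761084188652108539, 1, 1, 17, 2, 4, 0⟩,
  ⟨46674669182969480843834500209997584640075598059811596390945924603373079316930911386897098343983005672305757332874152043959761163020186362762272628276091570095068539851970065543646261709031173924805097356612746218875388537795053282546039, 2, 1, 15, 2, 4, 0⟩,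
  ⟨196780499719215552388820322300891816989808530694719315580523939431710282192632080525487515497878385450070228435859163163387646099519027993142606473360165976527204418847895383493780253073272336743569038313743553125686741699773964995843062316, 1, 1, 18, 0, 4, 4⟩,
  ⟨197389660777384850579522078248594099919136184025000240115316714784681751138814424816501076920895055707429760154012971632613626919704862839624505878646373749387156036294718481039168564143086480721711437717524377699647354232149831695498570716, 1, 2, 16, 2, 4, 0⟩,
  ⟨196831342740961556761851827488883525842406439683343555720712105367218168581748622104051832294801701786238314873117448379379480908111114651693467354137314027299647523605449168236016193827593194582804069740005253435138259873987416048224814316, 1, 3, 14, 2, 4, 0⟩,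
  ⟨196249392447211211358512775528201909823519717112869045441985431158414104608648218250313038224882712831140622861552437791036765929567582978106277496314610542232841866584928551984657715069656594436474814628704359762838774888833854394726399016, 1, 4, 12, 2, 4, 0⟩,
  ⟨832613650136408573056374655097517800586410947193446764803408228625458019446915717403272475619519270713160936406885931830060110147044837616396330337256649908916970274772303912936868793788952061728741021663522844255035692461830131523612956104793, 2, 1, 17, 2, 4, 0⟩,
  ⟨153708368760075420940743942391936841720051728914518009504666321104441007440509669333669128981860764426469963607067756378866759622613050283034343448284182851473304646037627772917422324491130449811012658119009376524522457386204307422237233139217310946782973608904638145702753407638850440552328748771466486756343, 3, 1, 15, 2, 4, 4⟩,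
  ⟨648898635619791174879509683600690346396831704506673756851723183515783634691482877164293861906972062851705275276829151328071821167349997455463770254514926643662882990258725934316120649312282044162396317579497580866790121676315816218242437108793470976276884155470690877958559733428148828502344980179064590327749170, 1, 2, 18, 2, 4, 4⟩,
  ⟨3516098222841060446280414542818075226311512605204621181960313595718221813862269873922644890304791832804022804582985484156793010984857827236528147681347560920761372777593601417364087348607314790780527465345177575019587438370920571930618289216488070, 1, 3, 16, 2, 4, 0⟩,
  ⟨649424206849531461044435169070656170169454130925072133883474049552859147618620058887401794596819930882990115629093853908457165180902290159925639304185495933940103381662251195089017680834977827131115676081159350105282374833164895969099850221535165402440280469850596541275087597454861991530390132339291836205092920, 1, 4, 14, 2, 4, 4⟩,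
  ⟨14897891434001403977442476856934922729994002876659720844128470559137403732235180302073709971815368118543878035890439172889555016294547941788440305441066756081751420743033074209092440056014789354977391026895624278568341003822138275196096634115223005747, 2, 1, 19, 2, 4, 0⟩,
  ⟨11594442819389667719141481299042980547399915623389941241770401439496982024703652428692907020022207298143950669219321515303653512154648371992986125013236393524943746513132351025629626423294805201582835482953053607052405848709141425503243908370256603897322950976300304057970896474484447783355913589410382109350127201186674, 1, 3, 18, 2, 4, 4⟩,
  ⟨62809693365253390037527813942689519343585042286301167996644128342315964067483825875481226091901136070632809127761990888359129405959338016406924198690997987245146716274103781906080092832704224144557691651745834863389279205383703521792731305237701639573424, 1, 4, 16, 0, 4, 4⟩,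
  ⟨11546662711458003993542743087714730536550187470739210894033287826099852882416669138015529036734493596344109307352531358740451783530354518669050743129616695776987309224708045288149298318884211961456403841773994782243281915417205265988504095699110345511733059730561355967306249861059883819551816199994134809049759570916524, 3, 1, 18, 2, 4, 4⟩,
  ⟨3686797247530216443084620862461497522769793309244805471220175245968890902637899528655560438072865321010967610670050401292379931718391633303138099470059094378362449134112986074005924648181994305380717133710651812673669054194995962755334199085119227804651575920387965699099763156843620856880966548889915876876438255530677533969531854032, 3, 4, 16, 2, 4, 4⟩,
  ⟨11047094411552897965964805845384768755693111253131791575876518681155166833493444989309322565093081591887467922753208909299673863185840437375325297161989347683696805009224222943950535269706441341088885788331390639840155372312199136512, 1, 1, 16, 0, 4, 4⟩,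
  ⟨46674843014538357676018941771772346460236583482449104744051479525230259921427184605722231024536587178955713676184519802338238345110215852565001166011314223464061902080361292174016565558010076655928654909877425425427931978294778713742639, 1, 1, 17, 0, 4, 4⟩,
  ⟨36298749422658566927461084888043557884584300598420781672672121586864122711998481847228352750625083384676263267649753235945411307397161954428152665195304146046007585097080976647767704058104409793051290289502534250299889287582036459600968493049065882583215622105321968875944393147177344556583552912320945966, 1, 2, 16, 2, 4, 4⟩,
  ⟨833981637955424733878452894379051563355313378011153254771309185864091938926138046010753581568498778852602976376539592461503599209095569968551788160404114746499529920669307166521722594425828144989956831626889001716924839754509122723558750211393, 2, 1, 17, 0, 4, 4⟩,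
  ⟨649735376436832379659319453475960689525314553713308081920190432495323569615656207568106763548298286862245898900827497288366029288846696422869995327025676780359705751304599069168862188735208491338853605611332321646084849730637846034539850577597014225394091973256159042696965220688935126316158465624858461631936920, 1, 3, 16, 2, 4, 4⟩,
  ⟨646745484246901839456797422410432829889496012956088296861943126626055384883789676311210253045710382726362048571322143058277990490365012377432437183588878057365157333491368145715268378653179282946362942788385878813437360980504647100562607724282294336025857618063791030984202966127790362015843548632447679302385570, 3, 1, 16, 2, 4, 4⟩,
  ⟨2740315640092224619033690250370311449706545773002223775055861095654176645485896322780518729672933887092719020563304242644722961574349410206187409139223176831739402949938264781575473478677517558124473186887385617932387148825903962942037153608360719403878865924001647818440632562202429998826126574402173824500257881297, 2, 1, 19, 2, 4, 4⟩,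
  ⟨2733100941961691584725042975849501493758623851772261755436242413290793051623675625128493447943910800080396581274156997909441242105831079593019342907803425218195109376366007440001584811575491765734847049864527088260798869742933017206711028165108028182030893703452781499868255082873057503377642543998239350586861475097, 3, 1, 17, 2, 4, 4⟩,
  ⟨48811571250269251560110021125511594877822685204710262435565781297973121413357982180516513186596940414951809989020815865474612634784822898400530946208034235306022967648891106037654799868409533930971978582932091269444026739594202487440968056817310976785662205074412877058804458038099947513612431769299184988514089897422693851, 4, 1, 17, 2, 4, 4⟩]

theorem valid_oddEvenEntries : allB oddEvenEntries (Entry.valid 1 2 0) = true := by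
  decide +kernel

theorem covers_oddEvenEntries : covers 1 1 oddEvenEntries = true := by
  decide +kernel

/-- Decompositions when the bicycles fit into the gap between the two long cycles. -/
theorem hasOPSolution_of_le_sub {m₁ m₂ b : ℕ} (h₁ : 3 ≤ m₁) (hb : 1 ≤ b)
    (hle : 2 * b ≤ m₂ - m₁ - m₁ % 2) :
    HasOPSolution ([m₁, m₂] ++ List.replicate b 2) := by
  rcases Nat.mod_two_eq_zero_or_one m₁ with h | h <;>
    rcases Nat.mod_two_eq_zero_or_one m₂ with h' | h'
  · obtain ⟨p, hp⟩ : ∃ p, m₁ = 2 * p + 0 := ⟨m₁ / 2, by omega⟩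
    obtain ⟨k, rfl⟩ : ∃ k, b = k + 1 := ⟨b - 1, by omega⟩
    obtain ⟨u, hu⟩ : ∃ u, m₂ = 2 * (p + k + u) + 2 := ⟨m₂ / 2 - 1 - p - k, by omega⟩
    rw [hp, hu]
    exact hasOPSolution_of_covers (by norm_num) (by norm_num) valid_evenEvenEntries
      covers_evenEvenEntries (by omega) (by omega)
  · obtain ⟨p, hp⟩ : ∃ p, m₁ = 2 * p + 0 := ⟨m₁ / 2, by omega⟩
    obtain ⟨u, hu⟩ : ∃ u, m₂ = 2 * (p + b + u) + 1 := ⟨m₂ / 2 - p - b, by omega⟩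
    rw [hp, hu]
    exact hasOPSolution_of_covers (by norm_num) (by norm_num) valid_evenOddEntries
      covers_evenOddEntries (by omega) hb
  · obtain ⟨p, hp⟩ : ∃ p, m₁ = 2 * p + 1 := ⟨m₁ / 2, by omega⟩
    obtain ⟨u, hu⟩ : ∃ u, m₂ = 2 * (p + b + u) + 2 := ⟨m₂ / 2 - 1 - p - b, by omega⟩
    rw [hp, hu]
    exact hasOPSolution_of_covers (by norm_num) (by norm_num) valid_oddEvenEntries
      covers_oddEvenEntries (by omega) hb
  · obtain ⟨p, hp⟩ : ∃ p, m₁ = 2 * p + 1 := ⟨m₁ / 2, by omega⟩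
    obtain ⟨k, rfl⟩ : ∃ k, b = k + 1 := ⟨b - 1, by omega⟩
    obtain ⟨u, hu⟩ : ∃ u, m₂ = 2 * (p + k + u) + 5 := ⟨m₂ / 2 - 2 - p - k, by omega⟩
    rw [hp, hu]
    exact hasOPSolution_of_covers (by norm_num) (by norm_num) valid_oddOddEntries
      covers_oddOddEntries (by omega) (by omega)

/-- Corollary: OP*(m₁, m₂, 2^⟨b⟩) has a solution in each of the cases
(i), (ii), (iii) of Corollary 8.4. -/
theorem stmt6 (m₁ m₂ b : ℕ) (h1 : 3 ≤ m₁) (h12 : m₁ ≤ m₂) (hb : 1 ≤ b)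
    (hcase :
      (HasOPSolution [m₁, m₂] ∧
        (m₁ + m₂ + deltaOdd m₁ + deltaOdd m₂ ≤ 2 * b ∨
          2 * b ≤ m₂ - m₁ - deltaOdd m₁)) ∨
      (m₁ = 3 ∧ m₂ = 3) ∨
      ((m₁ = 4 ∨ m₁ = 6) ∧ Even m₂ ∧ 14 ≤ m₁ + m₂ ∧
        (m₁ + m₂ + 4 ≤ 2 * b ∨ 2 * b ≤ m₂ - m₁))) :
    HasOPSolution ([m₁, m₂] ++ List.replicate b 2) := by
  rcases hcase with ⟨hL, h | h⟩ | ⟨rfl, rfl⟩ | ⟨hm, he, hs, h⟩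
  · unfold deltaOdd at h
    have := HasOPSolution.extend (m₁ := m₁) (m₂ := m₂) (r := 0) (c := b) (by omega) (by omega) (by simpa using hL)
      (by omega) (by omega)
    simpa only [Nat.zero_add] using this
  · exact hasOPSolution_of_le_sub h1 hb h
  · exact hasOPSolution_three_three hb
  · have he' := Nat.even_iff.1 he
    rcases h with h | h
    · have := HasOPSolution.extend (m₁ := m₁) (m₂ := m₂) (r := 1) (c := b - 1) (by omega) (by omega)
        (hasOPSolution_of_le_sub (m₁ := m₁) (m₂ := m₂) h1 le_rfl (by omega)) (by omega) (by omega)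
      rwa [Nat.add_sub_cancel' hb] at this
    · exact hasOPSolution_of_le_sub h1 hb (by omega)
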